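/- There exists a universal constant C₁ > 0 such that for every entire maximal surface S in three-dimensional Anti-de Sitter space whose principal curvatures satisfy ‖λ‖∞ < 1, and whose asymptotic boundary is the graph of an orientation-preserving homeomorphism of ℝP¹ with convex hull of width w, one has ‖λ‖∞ ≤ C₁ · tan(w). -/

import Mathlib

/-!
Common framework for formalizing "Maximal surfaces in Anti-de Sitter space, width of
convex hulls and quasiconformal extensions of quasisymmetric homeomorphisms" (A. Seppi).

Anti-de Sitter space is modeled projectively: `qform` is the bilinear form of
signature (2,2) on ℝ⁴, `AdS3` is the projectivization of its negative cone,
and spacelike surfaces are recorded through (lifts of) smooth spacelike embeddings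
of ℝ² into the quadric {⟨x,x⟩ = -1} (the double cover of AdS³), together with a
future-directed unit normal field and the associated shape operator.
-/

noncomputable section

open Real Set Filter Topology

namespace AdSPaper

/-- The bilinear form of signature `(2,2)` on `ℝ⁴`. -/
def qform (x y : Fin 4 → ℝ) : ℝ :=
  x 0 * y 0 + x 1 * y 1 - x 2 * y 2 - x 3 * y 3

/-- Quotient topology on a projectivization. -/
instance (K V : Type*) [DivisionRing K] [AddCommGroup V] [Module K V] [TopologicalSpace V] :
    TopologicalSpace (Projectivization K V) := by
  unfold Projectivization
  infer_instance

/-- Real projective 3-space. -/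
abbrev RP3 := Projectivization ℝ (Fin 4 → ℝ)

/-- The real projective line. -/
abbrev RP1 := Projectivization ℝ (Fin 2 → ℝ)

/-- The point of `ℝP³` determined by a nonzero vector of `ℝ⁴`. -/
def projPt (x : Fin 4 → ℝ) (hx : x ≠ 0) : RP3 := Projectivization.mk ℝ x hx

/-- Anti-de Sitter space: the projectivization of the negative cone of `qform`.
(The sign of `qform x x` does not depend on the chosen representative.) -/
def AdS3 : Set RP3 := {P | qform P.rep P.rep < 0}

/-- The boundary at infinity of Anti-de Sitter space: the projectivization of the null cone. -/
def bdryAdS3 : Set RP3 := {P | qform P.rep P.rep = 0}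

/-- The nonzero lifts of a subset of `ℝP³`. -/
def lifts (Γ : Set RP3) : Set (Fin 4 → ℝ) :=
  {x | ∃ hx : x ≠ 0, projPt x hx ∈ Γ}

/-- The (projective) convex hull of a set `Γ ⊆ ℝP³` contained in an affine chart:
the image of the convex hull of a coherent family of lifts of `Γ`, chosen on the positive
side of a linear hyperplane avoiding all lifts of `Γ` (i.e. an affine chart containing `Γ`). -/
def projConvexHull (Γ : Set RP3) : Set RP3 :=
  {P | ∃ L : (Fin 4 → ℝ) →ₗ[ℝ] ℝ, (∀ x ∈ lifts Γ, L x ≠ 0) ∧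
      ∃ (y : Fin 4 → ℝ) (hy : y ≠ 0), projPt y hy = P ∧
        y ∈ convexHull ℝ {x | x ∈ lifts Γ ∧ 0 < L x}}

/-- The width of (the convex hull of) a set `Γ ⊆ ℝP³`: the supremum of the lengths of
timelike geodesic segments `t ↦ [cos t • a + sin t • b]` contained in the convex hull of `Γ`. -/
def width (Γ : Set RP3) : ℝ :=
  sSup {T : ℝ | 0 ≤ T ∧ T < π ∧ ∃ a b : Fin 4 → ℝ,
      qform a a = -1 ∧ qform b b = -1 ∧ qform a b = 0 ∧
      ∀ t ∈ Icc (0 : ℝ) T, ∃ h : (Real.cos t • a + Real.sin t • b) ≠ 0,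
        projPt (Real.cos t • a + Real.sin t • b) h ∈ projConvexHull Γ}

/-- Inverse hyperbolic cosine. -/
def arcosh (x : ℝ) : ℝ := Real.log (x + Real.sqrt (x ^ 2 - 1))

/-! ### The projective line, cross-ratios and quasisymmetric homeomorphisms -/

/-- Determinant of a pair of vectors of ℝ². -/
def det2 (v w : Fin 2 → ℝ) : ℝ := v 0 * w 1 - v 1 * w 0

/-- The cross-ratio of a quadruple of points of `ℝP¹`, with the convention
`cr(z₁,z₂,z₃,z₄) = (z₄−z₁)(z₃−z₂)/((z₂−z₁)(z₃−z₄))`.  (The expression below is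
invariant under rescaling of each of the four representatives.) -/
def crossRatio (z₁ z₂ z₃ z₄ : RP1) : ℝ :=
  (det2 z₄.rep z₁.rep * det2 z₃.rep z₂.rep) / (det2 z₂.rep z₁.rep * det2 z₃.rep z₄.rep)

/-- The cyclic orientation invariant of a triple of points of `ℝP¹`
(for finite points `a,b,c` it equals `(a−b)(b−c)(c−a)` and its sign is scale invariant). -/
def tripleOrient (a b c : RP1) : ℝ :=
  det2 a.rep b.rep * det2 b.rep c.rep * det2 c.rep a.rep

/-- A map of `ℝP¹` is orientation-preserving if it preserves the cyclic orientation
of triples of points. -/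
def OrientationPreserving (φ : RP1 → RP1) : Prop :=
  ∀ a b c : RP1, 0 < tripleOrient a b c → 0 < tripleOrient (φ a) (φ b) (φ c)

/-- The set of cross-ratio distortions `|ln |cr(φ(Q))||` of symmetric quadruples
(`cr(Q) = -1`) under the map `φ`. -/
def crSet (φ : RP1 → RP1) : Set ℝ :=
  {r | ∃ z₁ z₂ z₃ z₄ : RP1, crossRatio z₁ z₂ z₃ z₄ = -1 ∧
      r = |Real.log (abs (crossRatio (φ z₁) (φ z₂) (φ z₃) (φ z₄)))|}

/-- The cross-ratio norm `‖φ‖_cr` of a circle map `φ`. -/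
def crNorm (φ : RP1 → RP1) : ℝ := sSup (crSet φ)

/-- A quasisymmetric homeomorphism of `ℝP¹`: an orientation-preserving homeomorphism
with finite cross-ratio norm. -/
def Quasisymmetric (φ : RP1 ≃ₜ RP1) : Prop :=
  OrientationPreserving ⇑φ ∧ BddAbove (crSet ⇑φ)

/-- The null vector of ℝ^{2,2} corresponding to the pair of lines `([v],[w]) ∈ ℝP¹ × ℝP¹`
under the standard identification of `∂∞AdS³` with `ℝP¹ × ℝP¹` (via the rank-one
2×2 matrix `v wᵀ`, identifying ℝ^{2,2} with 2×2 matrices with minus the determinant). -/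
def toBoundary (v w : Fin 2 → ℝ) : Fin 4 → ℝ :=
  ![(v 0 * w 0 - v 1 * w 1) / 2, (v 0 * w 1 + v 1 * w 0) / 2,
    (v 0 * w 0 + v 1 * w 1) / 2, (v 0 * w 1 - v 1 * w 0) / 2]

/-- The graph `gr(φ)` of a map `φ : ℝP¹ → ℝP¹`, as a curve in `∂∞AdS³ ⊆ ℝP³`. -/
def grGraph (φ : RP1 → RP1) : Set RP3 :=
  {P | ∃ (v w : Fin 2 → ℝ) (hv : v ≠ 0) (hw : w ≠ 0) (hx : toBoundary v w ≠ 0),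
      projPt (toBoundary v w) hx = P ∧
      φ (Projectivization.mk ℝ v hv) = Projectivization.mk ℝ w hw}

/-! ### Spacelike and maximal surfaces in AdS³ -/

/-- The global timelike vector field `x ↦ (0,0,−x₄,x₃)` on the quadric, fixing the
time orientation of AdS³. -/
def timeVec (x : Fin 4 → ℝ) : Fin 4 → ℝ := ![0, 0, -(x 3), x 2]

/-- A (lifted, parametrized) smooth spacelike embedded disc in AdS³: a smooth embedding
of ℝ² into the quadric `{⟨x,x⟩ = −1} ⊆ ℝ^{2,2}` (the double cover of AdS³), with spacelike
first fundamental form, together with its future-directed unit normal field and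
the associated shape operator `B = ∇N`. -/
structure SpacelikeSurface where
  /-- the embedding of ℝ² into the quadric -/
  emb : (Fin 2 → ℝ) → (Fin 4 → ℝ)
  /-- the future-directed unit normal vector field -/
  normal : (Fin 2 → ℝ) → (Fin 4 → ℝ)
  /-- the shape operator, in the coordinates of the parametrization -/
  shape : (Fin 2 → ℝ) → ((Fin 2 → ℝ) →ₗ[ℝ] (Fin 2 → ℝ))
  smooth_emb : ContDiff ℝ (⊤ : ℕ∞) emb
  smooth_normal : ContDiff ℝ (⊤ : ℕ∞) normal
  inj : Function.Injective emb
  on_quadric : ∀ y, qform (emb y) (emb y) = -1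
  spacelike : ∀ y v, v ≠ 0 → 0 < qform (fderiv ℝ emb y v) (fderiv ℝ emb y v)
  normal_unit : ∀ y, qform (normal y) (normal y) = -1
  normal_orth_base : ∀ y, qform (normal y) (emb y) = 0
  normal_orth : ∀ y v, qform (normal y) (fderiv ℝ emb y v) = 0
  normal_future : ∀ y, qform (normal y) (timeVec (emb y)) < 0
  shape_spec : ∀ y v, fderiv ℝ normal y v = fderiv ℝ emb y (shape y v)

namespace SpacelikeSurface

variable (S : SpacelikeSurface)

/-- A spacelike surface is maximal if its shape operator is traceless. -/
def IsMaximal : Prop := ∀ y, LinearMap.trace ℝ (Fin 2 → ℝ) (S.shape y) = 0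

/-- The surface as a subset of `ℝP³` (i.e. of AdS³). -/
def proj : Set RP3 :=
  {P | ∃ (y : Fin 2 → ℝ) (h : S.emb y ≠ 0), projPt (S.emb y) h = P}

/-- The asymptotic boundary `∂∞S` of the surface: the frontier `closure S \ S`. -/
def bdryAtInfinity : Set RP3 := closure S.proj \ S.proj

/-- The surface is entire if its frontier is contained in the boundary at
infinity of AdS³. -/
def IsEntire : Prop := S.bdryAtInfinity ⊆ bdryAdS3

/-- The nonnegative principal curvature `λ` at a point: for a maximal surface the
principal curvatures are `±λ` with `λ = √(−det B)`. -/
def lambdaAt (y : Fin 2 → ℝ) : ℝ := Real.sqrt (-(LinearMap.det (S.shape y)))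

/-- The supremum `‖λ‖∞` of the principal curvatures of the surface. -/
def lambdaSup : ℝ := ⨆ y, S.lambdaAt y

/-- Nonpositive curvature: by the Gauss equation `K = −1 + λ²`, this is `λ ≤ 1`. -/
def NonpositiveCurvature : Prop := ∀ y, S.lambdaAt y ≤ 1

/-- Uniformly negative curvature: `λ ≤ 1 − ε` for some `ε > 0`. -/
def UniformlyNegativeCurvature : Prop := ∃ ε > 0, ∀ y, S.lambdaAt y ≤ 1 - ε

/-- The set of non-umbilical points of a maximal surface (where `λ ≠ 0`). -/
def nonUmbilic : Set (Fin 2 → ℝ) := {y | LinearMap.det (S.shape y) ≠ 0}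

/-- The intrinsic distance of the induced Riemannian metric on the surface. -/
def idist (y₁ y₂ : Fin 2 → ℝ) : ℝ :=
  sInf {L | ∃ c : ℝ → (Fin 2 → ℝ), ContDiff ℝ (⊤ : ℕ∞) c ∧ c 0 = y₁ ∧ c 1 = y₂ ∧
      L = ∫ t in (0:ℝ)..(1:ℝ),
        Real.sqrt (qform (deriv (fun s => S.emb (c s)) t) (deriv (fun s => S.emb (c s)) t))}

/-- `F` is the intrinsic gradient field of the function `f` on `U ⊆ S`: the vector field
which is `I`-dual to the differential of `f`. -/
def IsGradientOn (U : Set (Fin 2 → ℝ)) (f : (Fin 2 → ℝ) → ℝ)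
    (F : (Fin 2 → ℝ) → (Fin 2 → ℝ)) : Prop :=
  ∀ y ∈ U, ∀ v, qform (fderiv ℝ S.emb y (F y)) (fderiv ℝ S.emb y v) = fderiv ℝ f y v

/-- `H` is the intrinsic Hessian (as a (1,1)-tensor) of a function with gradient field `F`
on `U ⊆ S`: the tangential part of the ambient flat derivative of the ambient gradient
field (the normal part, in the ambient coordinates, lies in `span{σ(y), N(y)}`). -/
def IsHessianOn (U : Set (Fin 2 → ℝ)) (F : (Fin 2 → ℝ) → (Fin 2 → ℝ))
    (H : (Fin 2 → ℝ) → ((Fin 2 → ℝ) →ₗ[ℝ] (Fin 2 → ℝ))) : Prop :=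
  ∀ y ∈ U, ∀ v, ∃ a b : ℝ,
    fderiv ℝ (fun y' => fderiv ℝ S.emb y' (F y')) y v
      = fderiv ℝ S.emb y (H y v) + a • S.emb y + b • S.normal y

/-- The squared norm `‖grad f‖²` of a gradient field `F`, for the induced metric. -/
def gradNormSq (F : (Fin 2 → ℝ) → (Fin 2 → ℝ)) (y : Fin 2 → ℝ) : ℝ :=
  qform (fderiv ℝ S.emb y (F y)) (fderiv ℝ S.emb y (F y))

/-- `Δf` is the Laplace–Beltrami operator of the induced metric applied to `f`, on `U`:
the trace of the intrinsic Hessian. -/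
def IsLaplacianOn (U : Set (Fin 2 → ℝ)) (f Δf : (Fin 2 → ℝ) → ℝ) : Prop :=
  ∃ F H, S.IsGradientOn U f F ∧ S.IsHessianOn U F H ∧
    ∀ y ∈ U, Δf y = LinearMap.trace ℝ (Fin 2 → ℝ) (H y)

/-- `c` parametrizes an intrinsic geodesic of the surface: the ambient acceleration
is orthogonal to the surface, i.e. lies in `span{σ(c t), N(c t)}`. -/
def IsIntrinsicGeodesic (c : ℝ → (Fin 2 → ℝ)) : Prop :=
  ∀ t, ∃ a b : ℝ,
    deriv (deriv (fun s => S.emb (c s))) t = a • S.emb (c t) + b • S.normal (c t)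

/-- `E` is a system of normal coordinates for the surface centered at `y₀` (i.e. the
exponential map of the induced metric at that point, read in an orthonormal frame). -/
def IsNormalCoordsAt (y₀ : Fin 2 → ℝ) (E : (Fin 2 → ℝ) → (Fin 2 → ℝ)) : Prop :=
  E 0 = y₀ ∧ (∀ v, S.IsIntrinsicGeodesic (fun t => E (t • v))) ∧
  ∀ v w : Fin 2 → ℝ,
    qform (deriv (fun t : ℝ => S.emb (E (t • v))) 0) (deriv (fun t : ℝ => S.emb (E (t • w))) 0)
      = v 0 * w 0 + v 1 * w 1

end SpacelikeSurface

/-- The normal flow at time `ρ`: the parametrization of the surface `S_ρ` at constant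
timelike distance `ρ` from `S`. -/
def parallelEmb (S : SpacelikeSurface) (ρ : ℝ) : (Fin 2 → ℝ) → (Fin 4 → ℝ) :=
  fun y => Real.cos ρ • S.emb y + Real.sin ρ • S.normal y

/-- The pull-back to `S` of the first fundamental form of the parallel surface `S_ρ`. -/
def Irho (S : SpacelikeSurface) (ρ : ℝ) (y : Fin 2 → ℝ) (v w : Fin 2 → ℝ) : ℝ :=
  qform (fderiv ℝ (parallelEmb S ρ) y v) (fderiv ℝ (parallelEmb S ρ) y w)

/-- The second fundamental form of the parallel surface `S_ρ`, via `II_ρ = ½ dI_ρ/dρ`. -/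
def IIrho (S : SpacelikeSurface) (ρ : ℝ) (y : Fin 2 → ℝ) (v w : Fin 2 → ℝ) : ℝ :=
  (1 / 2) * deriv (fun ρ' => Irho S ρ' y v w) ρ

/-! ### Euclidean balls and `C⁰`/`C²` norms on ℝ² -/

/-- The Euclidean ball of radius `r` centered at the origin of ℝ². -/
def eball (r : ℝ) : Set (Fin 2 → ℝ) := {z | Real.sqrt ((z 0) ^ 2 + (z 1) ^ 2) < r}

/-- The `C⁰` norm of a function on the Euclidean ball of radius `r`. -/
def C0norm (u : (Fin 2 → ℝ) → ℝ) (r : ℝ) : ℝ :=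
  sSup {a | ∃ z ∈ eball r, a = |u z|}

/-- The `C²` norm of a function on the Euclidean ball of radius `r`. -/
def C2norm (u : (Fin 2 → ℝ) → ℝ) (r : ℝ) : ℝ :=
  sSup {a | ∃ z ∈ eball r, a = |u z| + ‖fderiv ℝ u z‖ + ‖fderiv ℝ (fderiv ℝ u) z‖}

end AdSPaper

namespace AdSPaper

open scoped ContDiff

/-! ### The bilinear form -/

lemma qform_comm (x y : Fin 4 → ℝ) : qform x y = qform y x := by
  simp only [qform]; ring

lemma qform_add_left (x y z : Fin 4 → ℝ) : qform (x + y) z = qform x z + qform y z := by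
  simp only [qform, Pi.add_apply]; ring

lemma qform_add_right (x y z : Fin 4 → ℝ) : qform x (y + z) = qform x y + qform x z := by
  simp only [qform, Pi.add_apply]; ring

lemma qform_sub_left (x y z : Fin 4 → ℝ) : qform (x - y) z = qform x z - qform y z := by
  simp only [qform, Pi.sub_apply]; ring

lemma qform_sub_right (x y z : Fin 4 → ℝ) : qform x (y - z) = qform x y - qform x z := by
  simp only [qform, Pi.sub_apply]; ring

lemma qform_smul_left (c : ℝ) (x y : Fin 4 → ℝ) : qform (c • x) y = c * qform x y := by
  simp only [qform, Pi.smul_apply, smul_eq_mul]; ring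

lemma qform_smul_right (c : ℝ) (x y : Fin 4 → ℝ) : qform x (c • y) = c * qform x y := by
  simp only [qform, Pi.smul_apply, smul_eq_mul]; ring

lemma qform_neg_left (x y : Fin 4 → ℝ) : qform (-x) y = -qform x y := by
  simp only [qform, Pi.neg_apply]; ring

lemma qform_neg_right (x y : Fin 4 → ℝ) : qform x (-y) = -qform x y := by
  simp only [qform, Pi.neg_apply]; ring

lemma qform_zero_left (x : Fin 4 → ℝ) : qform 0 x = 0 := by simp [qform]

lemma qform_zero_right (x : Fin 4 → ℝ) : qform x 0 = 0 := by simp [qform]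

/-- `qform` as a continuous bilinear map. -/
def qformCLM : (Fin 4 → ℝ) →L[ℝ] (Fin 4 → ℝ) →L[ℝ] ℝ :=
  LinearMap.mkContinuous₂
    (LinearMap.mk₂ ℝ qform qform_add_left qform_smul_left qform_add_right qform_smul_right) 4 (by
      intro x y
      have h : ∀ i, |x i * y i| ≤ ‖x‖ * ‖y‖ := fun i => by
        rw [abs_mul]
        exact mul_le_mul (norm_le_pi_norm x i) (norm_le_pi_norm y i) (abs_nonneg _) (norm_nonneg _)
      have h0 := abs_le.1 (h 0)
      have h1 := abs_le.1 (h 1)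
      have h2 := abs_le.1 (h 2)
      have h3 := abs_le.1 (h 3)
      simp only [LinearMap.mk₂_apply, qform, Real.norm_eq_abs]
      rw [abs_le]
      constructor <;> linarith [h0.1, h0.2, h1.1, h1.2, h2.1, h2.2, h3.1, h3.2])

lemma qformCLM_apply (x y : Fin 4 → ℝ) : qformCLM x y = qform x y := rfl

lemma continuous_qform : Continuous fun p : (Fin 4 → ℝ) × (Fin 4 → ℝ) => qform p.1 p.2 := by
  unfold qform; fun_prop

lemma _root_.Continuous.qform {X : Type*} [TopologicalSpace X] {u w : X → Fin 4 → ℝ}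
    (hu : Continuous u) (hw : Continuous w) : Continuous fun y => qform (u y) (w y) :=
  continuous_qform.comp (hu.prodMk hw)

lemma _root_.ContDiff.qform {E : Type*} [NormedAddCommGroup E] [NormedSpace ℝ E] {n : WithTop ℕ∞}
    {u w : E → Fin 4 → ℝ} (hu : ContDiff ℝ n u) (hw : ContDiff ℝ n w) :
    ContDiff ℝ n fun y => qform (u y) (w y) := by
  have hu' := contDiff_pi.1 hu
  have hw' := contDiff_pi.1 hw
  unfold AdSPaper.qform
  exact ((((hu' 0).mul (hw' 0)).add ((hu' 1).mul (hw' 1))).sub ((hu' 2).mul (hw' 2))).sub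
    ((hu' 3).mul (hw' 3))

lemma _root_.HasFDerivAt.qform {E : Type*} [NormedAddCommGroup E] [NormedSpace ℝ E]
    {u w : E → Fin 4 → ℝ} {u' w' : E →L[ℝ] Fin 4 → ℝ} {y : E} (hu : HasFDerivAt u u' y)
    (hw : HasFDerivAt w w' y) :
    HasFDerivAt (fun y => qform (u y) (w y))
      (qformCLM.precompR E (u y) w' + qformCLM.precompL E u' (w y)) y :=
  qformCLM.hasFDerivAt_of_bilinear hu hw

lemma fderiv_qform_apply {E : Type*} [NormedAddCommGroup E] [NormedSpace ℝ E]
    {u w : E → Fin 4 → ℝ} {y : E} (hu : DifferentiableAt ℝ u y) (hw : DifferentiableAt ℝ w y)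
    (v : E) :
    fderiv ℝ (fun y => qform (u y) (w y)) y v
      = qform (fderiv ℝ u y v) (w y) + qform (u y) (fderiv ℝ w y v) := by
  rw [(hu.hasFDerivAt.qform hw.hasFDerivAt).fderiv]
  exact add_comm _ _

/-- A pseudo-orthonormal basis of `ℝ^{2,2}`. -/
structure IsOrthoFrame (e₁ e₂ x n : Fin 4 → ℝ) : Prop where
  e11 : qform e₁ e₁ = 1
  e22 : qform e₂ e₂ = 1
  xx : qform x x = -1
  nn : qform n n = -1
  e12 : qform e₁ e₂ = 0
  e1x : qform e₁ x = 0
  e1n : qform e₁ n = 0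
  e2x : qform e₂ x = 0
  e2n : qform e₂ n = 0
  xn : qform x n = 0

lemma IsOrthoFrame.expand {e₁ e₂ x n : Fin 4 → ℝ} (h : IsOrthoFrame e₁ e₂ x n) (v : Fin 4 → ℝ) :
    v = qform v e₁ • e₁ + qform v e₂ • e₂ - qform v x • x - qform v n • n := by
  obtain ⟨h11, h22, hxx, hnn, h12, h1x, h1n, h2x, h2n, hxn⟩ := h
  let A : Matrix (Fin 4) (Fin 4) ℝ := Matrix.of ![e₁, e₂, x, n]
  let B : Matrix (Fin 4) (Fin 4) ℝ :=
    Matrix.of ![![e₁ 0, e₂ 0, -x 0, -n 0], ![e₁ 1, e₂ 1, -x 1, -n 1],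
      ![-e₁ 2, -e₂ 2, x 2, n 2], ![-e₁ 3, -e₂ 3, x 3, n 3]]
  have hAB : A * B = 1 := by
    simp only [qform] at *
    ext i j
    fin_cases i <;> fin_cases j <;>
      simp [A, B, Matrix.mul_apply, Fin.sum_univ_four] <;> linarith
  have hBA : B * A = 1 := mul_eq_one_comm.1 hAB
  have hij : ∀ i j, (B * A) i j = (1 : Matrix (Fin 4) (Fin 4) ℝ) i j := fun i j => by rw [hBA]
  simp only [Matrix.mul_apply, Fin.sum_univ_four] at hij
  have h0 := fun j => hij 0 j
  have h1 := fun j => hij 1 j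
  have h2 := fun j => hij 2 j
  have h3 := fun j => hij 3 j
  simp only [Fin.forall_fin_succ, IsEmpty.forall_iff, Matrix.one_apply, A, B] at h0 h1 h2 h3
  simp at h0 h1 h2 h3
  ext k
  simp only [qform, Pi.add_apply, Pi.sub_apply, Pi.smul_apply, smul_eq_mul]
  fin_cases k <;> simp
  · linear_combination -v 0 * h0.1 - v 1 * h0.2.1 + v 2 * h0.2.2.1 + v 3 * h0.2.2.2
  · linear_combination -v 0 * h1.1 - v 1 * h1.2.1 + v 2 * h1.2.2.1 + v 3 * h1.2.2.2
  · linear_combination v 0 * h2.1 + v 1 * h2.2.1 - v 2 * h2.2.2.1 - v 3 * h2.2.2.2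
  · linear_combination v 0 * h3.1 + v 1 * h3.2.1 - v 2 * h3.2.2.1 - v 3 * h3.2.2.2

lemma IsOrthoFrame.qform_expand {e₁ e₂ x n : Fin 4 → ℝ} (h : IsOrthoFrame e₁ e₂ x n)
    (v p : Fin 4 → ℝ) :
    qform v p = qform v e₁ * qform e₁ p + qform v e₂ * qform e₂ p - qform v x * qform x p
      - qform v n * qform n p := by
  conv_lhs => rw [h.expand v]
  simp only [qform_sub_left, qform_add_left, qform_smul_left]

/-! ### The algebra of smooth functions on the parameter plane -/

/-- Smooth functions on `ℝ²`. -/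
def smoothFn : Subalgebra ℝ ((Fin 2 → ℝ) → ℝ) where
  carrier := {φ | ContDiff ℝ ∞ φ}
  mul_mem' := fun {a b} (ha : ContDiff ℝ ∞ a) (hb : ContDiff ℝ ∞ b) => ha.mul hb
  add_mem' := fun {a b} (ha : ContDiff ℝ ∞ a) (hb : ContDiff ℝ ∞ b) => ha.add hb
  algebraMap_mem' := fun r => (contDiff_const : ContDiff ℝ ∞ fun _ : Fin 2 → ℝ => r)

lemma smoothFn.contDiff (φ : smoothFn) : ContDiff ℝ ∞ φ.1 := φ.2

lemma smoothFn.differentiable (φ : smoothFn) : Differentiable ℝ φ.1 :=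
  (smoothFn.contDiff φ).differentiable (by simp)

lemma contDiff_fderiv_apply_field {F : Type*} [NormedAddCommGroup F] [NormedSpace ℝ F]
    {u : (Fin 2 → ℝ) → F} {E : (Fin 2 → ℝ) → Fin 2 → ℝ} (hu : ContDiff ℝ ∞ u)
    (hE : ContDiff ℝ ∞ E) : ContDiff ℝ ∞ fun y => fderiv ℝ u y (E y) :=
  (hu.fderiv_right (m := ∞) (by simp)).clm_apply hE

/-- The derivation of the algebra of smooth functions given by a smooth vector field. -/
def fieldDeriv (E : (Fin 2 → ℝ) → Fin 2 → ℝ) (hE : ContDiff ℝ ∞ E) :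
    Derivation ℝ smoothFn smoothFn :=
  Derivation.mk'
    { toFun := fun φ => ⟨fun y => fderiv ℝ φ.1 y (E y), contDiff_fderiv_apply_field φ.2 hE⟩
      map_add' := fun φ ψ => by
        ext y
        change fderiv ℝ (φ.1 + ψ.1) y (E y) = _
        rw [fderiv_add (smoothFn.differentiable φ y) (smoothFn.differentiable ψ y)]
        rfl
      map_smul' := fun c φ => by
        ext y
        change fderiv ℝ (c • φ.1) y (E y) = _
        rw [fderiv_const_smul (smoothFn.differentiable φ y)]
        rfl }
    fun φ ψ => by
      ext y
      change fderiv ℝ (φ.1 * ψ.1) y (E y) = φ.1 y * fderiv ℝ ψ.1 y (E y)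
        + ψ.1 y * fderiv ℝ φ.1 y (E y)
      rw [fderiv_mul (smoothFn.differentiable φ y) (smoothFn.differentiable ψ y)]
      simp

lemma fieldDeriv_apply (E : (Fin 2 → ℝ) → Fin 2 → ℝ) (hE : ContDiff ℝ ∞ E) (φ : smoothFn)
    (y : Fin 2 → ℝ) : (fieldDeriv E hE φ).1 y = fderiv ℝ φ.1 y (E y) := rfl

lemma fderiv_fderiv_apply_field {F : Type*} [NormedAddCommGroup F] [NormedSpace ℝ F]
    {u : (Fin 2 → ℝ) → F} {E : (Fin 2 → ℝ) → Fin 2 → ℝ} (hu : ContDiff ℝ ∞ u)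
    (hE : ContDiff ℝ ∞ E) (y v : Fin 2 → ℝ) :
    fderiv ℝ (fun y => fderiv ℝ u y (E y)) y v
      = fderiv ℝ (fderiv ℝ u) y v (E y) + fderiv ℝ u y (fderiv ℝ E y v) := by
  have h1 : DifferentiableAt ℝ (fderiv ℝ u) y :=
    ((hu.fderiv_right (m := ∞) (by simp)).differentiable (by simp)) y
  have h2 : DifferentiableAt ℝ E y := (hE.differentiable (by simp)) y
  rw [(h1.hasFDerivAt.clm_apply h2.hasFDerivAt).fderiv]
  simp [add_comm]

/-- The bracket of two vector fields on `ℝ²`. -/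
def fieldBracket (E E' : (Fin 2 → ℝ) → Fin 2 → ℝ) (y : Fin 2 → ℝ) : Fin 2 → ℝ :=
  fderiv ℝ E' y (E y) - fderiv ℝ E y (E' y)

lemma fderiv_bracket {F : Type*} [NormedAddCommGroup F] [NormedSpace ℝ F]
    {u : (Fin 2 → ℝ) → F} {E E' : (Fin 2 → ℝ) → Fin 2 → ℝ} (hu : ContDiff ℝ ∞ u)
    (hE : ContDiff ℝ ∞ E) (hE' : ContDiff ℝ ∞ E') (y : Fin 2 → ℝ) :
    fderiv ℝ (fun y => fderiv ℝ u y (E' y)) y (E y) - fderiv ℝ (fun y => fderiv ℝ u y (E y)) y (E' y)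
      = fderiv ℝ u y (fieldBracket E E' y) := by
  rw [fderiv_fderiv_apply_field hu hE', fderiv_fderiv_apply_field hu hE]
  have hsymm : IsSymmSndFDerivAt ℝ u y :=
    hu.contDiffAt.isSymmSndFDerivAt (by
      rw [minSmoothness_of_isRCLikeNormedField]
      exact WithTop.coe_le_coe.2 (le_top : (2 : ℕ∞) ≤ ⊤))
  rw [hsymm (E y) (E' y), fieldBracket, map_sub]
  abel

/-! ### Moving frames -/

/-- A smooth moving orthonormal frame on a spacelike surface. -/
structure MovingFrame (S : SpacelikeSurface) where
  /-- the first vector field -/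
  E₁ : (Fin 2 → ℝ) → Fin 2 → ℝ
  /-- the second vector field -/
  E₂ : (Fin 2 → ℝ) → Fin 2 → ℝ
  smooth₁ : ContDiff ℝ ∞ E₁
  smooth₂ : ContDiff ℝ ∞ E₂
  norm₁ : ∀ y, qform (fderiv ℝ S.emb y (E₁ y)) (fderiv ℝ S.emb y (E₁ y)) = 1
  norm₂ : ∀ y, qform (fderiv ℝ S.emb y (E₂ y)) (fderiv ℝ S.emb y (E₂ y)) = 1
  orth : ∀ y, qform (fderiv ℝ S.emb y (E₁ y)) (fderiv ℝ S.emb y (E₂ y)) = 0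

lemma SpacelikeSurface.contDiff_emb (S : SpacelikeSurface) : ContDiff ℝ ∞ S.emb := S.smooth_emb

lemma SpacelikeSurface.contDiff_normal (S : SpacelikeSurface) : ContDiff ℝ ∞ S.normal :=
  S.smooth_normal

lemma SpacelikeSurface.emb_orth (S : SpacelikeSurface) (y v : Fin 2 → ℝ) :
    qform (S.emb y) (fderiv ℝ S.emb y v) = 0 := by
  have hd := (S.contDiff_emb.differentiable (by simp)) y
  have h := fderiv_qform_apply hd hd v
  have hc : (fun y => qform (S.emb y) (S.emb y)) = fun _ => (-1 : ℝ) := funext S.on_quadric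
  rw [hc, qform_comm (fderiv ℝ S.emb y v)] at h
  simp at h
  linarith

lemma SpacelikeSurface.nonempty_movingFrame (S : SpacelikeSurface) : Nonempty (MovingFrame S) := by
  let c : Fin 2 → (Fin 2 → ℝ) := fun i => Pi.single i 1
  have hX : ∀ i, ContDiff ℝ ∞ fun y => fderiv ℝ S.emb y (c i) := fun i =>
    contDiff_fderiv_apply_field S.contDiff_emb contDiff_const
  let g : Fin 2 → Fin 2 → (Fin 2 → ℝ) → ℝ := fun i j y =>
    qform (fderiv ℝ S.emb y (c i)) (fderiv ℝ S.emb y (c j))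
  have hg : ∀ i j, ContDiff ℝ ∞ (g i j) := fun i j => (hX i).qform (hX j)
  have hg0 : ∀ y, 0 < g 0 0 y := fun y => S.spacelike y _ (by simp [c])
  let e : (Fin 2 → ℝ) → Fin 2 → ℝ := fun y => g 0 0 y • c 1 - g 0 1 y • c 0
  have he0 : ∀ y, e y ≠ 0 := fun y h => by
    have := congrFun h 1
    simp [e, c] at this
    exact (hg0 y).ne' this
  have hsymm : ∀ y, g 1 0 y = g 0 1 y := fun y => qform_comm _ _
  have hlen : ∀ y, qform (fderiv ℝ S.emb y (e y)) (fderiv ℝ S.emb y (e y))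
      = g 0 0 y * (g 0 0 y * g 1 1 y - g 0 1 y ^ 2) := fun y => by
    simp only [e, map_sub, map_smul, qform_sub_left, qform_sub_right, qform_smul_left,
      qform_smul_right]
    have := hsymm y
    simp only [g] at this ⊢
    rw [this]; ring
  have horth : ∀ y, qform (fderiv ℝ S.emb y (c 0)) (fderiv ℝ S.emb y (e y)) = 0 := fun y => by
    simp only [e, map_sub, map_smul, qform_sub_right, qform_smul_right, g]; ring
  have hpos : ∀ y, 0 < g 0 0 y * (g 0 0 y * g 1 1 y - g 0 1 y ^ 2) := fun y => by
    rw [← hlen]; exact S.spacelike y _ (he0 y)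
  have hs : ∀ {q : (Fin 2 → ℝ) → ℝ}, ContDiff ℝ ∞ q → (∀ y, 0 < q y) →
      ContDiff ℝ ∞ fun y => (√(q y))⁻¹ := fun hq hp =>
    (hq.sqrt fun y => (hp y).ne').inv fun y => (Real.sqrt_pos.2 (hp y)).ne'
  have hnorm : ∀ {q : ℝ}, 0 < q → (√q)⁻¹ * ((√q)⁻¹ * q) = 1 := fun hq => by
    have := Real.mul_self_sqrt hq.le
    have h0 := (Real.sqrt_pos.2 hq).ne'
    field_simp
    nlinarith
  refine ⟨⟨fun y => (√(g 0 0 y))⁻¹ • c 0,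
    fun y => (√(g 0 0 y * (g 0 0 y * g 1 1 y - g 0 1 y ^ 2)))⁻¹ • e y,
    (hs (hg 0 0) hg0).smul contDiff_const,
    (hs ((hg 0 0).mul (((hg 0 0).mul (hg 1 1)).sub ((hg 0 1).pow 2))) hpos).smul
      (((hg 0 0).smul contDiff_const).sub ((hg 0 1).smul contDiff_const)), ?_, ?_, ?_⟩⟩
  · intro y
    simp only [map_smul, qform_smul_left, qform_smul_right]
    exact hnorm (hg0 y)
  · intro y
    simp only [map_smul, qform_smul_left, qform_smul_right]
    rw [hlen]
    exact hnorm (hpos y)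
  · intro y
    simp only [map_smul, qform_smul_left, qform_smul_right]
    rw [horth]; ring

namespace MovingFrame

variable {S : SpacelikeSurface} (F : MovingFrame S)

/-- The first frame vector in `ℝ^{2,2}`. -/
def e₁ (y : Fin 2 → ℝ) : Fin 4 → ℝ := fderiv ℝ S.emb y (F.E₁ y)

/-- The second frame vector in `ℝ^{2,2}`. -/
def e₂ (y : Fin 2 → ℝ) : Fin 4 → ℝ := fderiv ℝ S.emb y (F.E₂ y)

lemma contDiff_e₁ : ContDiff ℝ ∞ F.e₁ := contDiff_fderiv_apply_field S.contDiff_emb F.smooth₁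

lemma contDiff_e₂ : ContDiff ℝ ∞ F.e₂ := contDiff_fderiv_apply_field S.contDiff_emb F.smooth₂

lemma orthoFrame (y : Fin 2 → ℝ) : IsOrthoFrame (F.e₁ y) (F.e₂ y) (S.emb y) (S.normal y) where
  e11 := F.norm₁ y
  e22 := F.norm₂ y
  xx := S.on_quadric y
  nn := S.normal_unit y
  e12 := F.orth y
  e1x := by rw [qform_comm]; exact S.emb_orth y _
  e1n := by rw [qform_comm]; exact S.normal_orth y _
  e2x := by rw [qform_comm]; exact S.emb_orth y _
  e2n := by rw [qform_comm]; exact S.normal_orth y _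
  xn := by rw [qform_comm]; exact S.normal_orth_base y

/-- Derivative of functions along the first frame field. -/
def D₁ : Derivation ℝ smoothFn smoothFn := fieldDeriv F.E₁ F.smooth₁

/-- Derivative of functions along the second frame field. -/
def D₂ : Derivation ℝ smoothFn smoothFn := fieldDeriv F.E₂ F.smooth₂

/-- Derivative of the normal along the first frame field. -/
def n₁ (y : Fin 2 → ℝ) : Fin 4 → ℝ := fderiv ℝ S.normal y (F.E₁ y)

/-- Derivative of the normal along the second frame field. -/
def n₂ (y : Fin 2 → ℝ) : Fin 4 → ℝ := fderiv ℝ S.normal y (F.E₂ y)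

lemma contDiff_n₁ : ContDiff ℝ ∞ F.n₁ := contDiff_fderiv_apply_field S.contDiff_normal F.smooth₁

/-- The entry `⟨B e₁, e₁⟩` of the shape operator. -/
def a : smoothFn := ⟨fun y => qform (F.n₁ y) (F.e₁ y), F.contDiff_n₁.qform F.contDiff_e₁⟩

/-- The entry `⟨B e₁, e₂⟩` of the shape operator. -/
def b : smoothFn := ⟨fun y => qform (F.n₁ y) (F.e₂ y), F.contDiff_n₁.qform F.contDiff_e₂⟩

/-- The connection form evaluated on the first frame field. -/
def ω₁ : smoothFn := ⟨fun y => qform (fderiv ℝ F.e₁ y (F.E₁ y)) (F.e₂ y),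
  (contDiff_fderiv_apply_field F.contDiff_e₁ F.smooth₁).qform F.contDiff_e₂⟩

/-- The connection form evaluated on the second frame field. -/
def ω₂ : smoothFn := ⟨fun y => qform (fderiv ℝ F.e₁ y (F.E₂ y)) (F.e₂ y),
  (contDiff_fderiv_apply_field F.contDiff_e₁ F.smooth₂).qform F.contDiff_e₂⟩

/-- The linear function `⟨·, p⟩` on the first frame vector. -/
def f₁ (p : Fin 4 → ℝ) : smoothFn := ⟨fun y => qform (F.e₁ y) p, F.contDiff_e₁.qform contDiff_const⟩

/-- The linear function `⟨·, p⟩` on the second frame vector. -/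
def f₂ (p : Fin 4 → ℝ) : smoothFn := ⟨fun y => qform (F.e₂ y) p, F.contDiff_e₂.qform contDiff_const⟩

end MovingFrame

/-- The linear function `⟨·, p⟩` on the surface. -/
def SpacelikeSurface.f (S : SpacelikeSurface) (p : Fin 4 → ℝ) : smoothFn :=
  ⟨fun y => qform (S.emb y) p, S.contDiff_emb.qform contDiff_const⟩

/-- The linear function `⟨·, p⟩` on the normal of the surface. -/
def SpacelikeSurface.g (S : SpacelikeSurface) (p : Fin 4 → ℝ) : smoothFn :=
  ⟨fun y => qform (S.normal y) p, S.contDiff_normal.qform contDiff_const⟩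

lemma fderiv_qform_const {u : (Fin 2 → ℝ) → Fin 4 → ℝ} (hu : ContDiff ℝ ∞ u) (p : Fin 4 → ℝ)
    (y v : Fin 2 → ℝ) : fderiv ℝ (fun y => qform (u y) p) y v = qform (fderiv ℝ u y v) p := by
  rw [fderiv_qform_apply ((hu.differentiable (by simp)) y) (differentiableAt_const p)]
  simp [qform_zero_right]

lemma qform_fderiv_eq_neg {u w : (Fin 2 → ℝ) → Fin 4 → ℝ} (hu : ContDiff ℝ ∞ u)
    (hw : ContDiff ℝ ∞ w) {c : ℝ} (h : ∀ y, qform (u y) (w y) = c) (y v : Fin 2 → ℝ) :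
    qform (fderiv ℝ u y v) (w y) = -qform (fderiv ℝ w y v) (u y) := by
  have h1 := fderiv_qform_apply ((hu.differentiable (by simp)) y) ((hw.differentiable (by simp)) y) v
  rw [show (fun y => qform (u y) (w y)) = fun _ => c from funext h] at h1
  rw [qform_comm (fderiv ℝ w y v)]
  simp at h1
  linarith

lemma qform_fderiv_self {u : (Fin 2 → ℝ) → Fin 4 → ℝ} (hu : ContDiff ℝ ∞ u)
    {c : ℝ} (h : ∀ y, qform (u y) (u y) = c) (y v : Fin 2 → ℝ) :
    qform (fderiv ℝ u y v) (u y) = 0 := by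
  have := qform_fderiv_eq_neg hu hu h y v
  linarith

namespace MovingFrame

variable {S : SpacelikeSurface} (F : MovingFrame S)

lemma fderiv_e₁_sub (y : Fin 2 → ℝ) :
    fderiv ℝ F.e₂ y (F.E₁ y) - fderiv ℝ F.e₁ y (F.E₂ y)
      = fderiv ℝ S.emb y (fieldBracket F.E₁ F.E₂ y) :=
  fderiv_bracket S.contDiff_emb F.smooth₁ F.smooth₂ y

lemma fderiv_emb_injective (S : SpacelikeSurface) (y : Fin 2 → ℝ) :
    Function.Injective (fderiv ℝ S.emb y) := by
  rw [injective_iff_map_eq_zero]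
  intro v hv
  by_contra h
  have := S.spacelike y v h
  rw [hv, qform_zero_left] at this
  exact lt_irrefl _ this

lemma fderiv_emb_expand (y v : Fin 2 → ℝ) :
    v = qform (fderiv ℝ S.emb y v) (F.e₁ y) • F.E₁ y
      + qform (fderiv ℝ S.emb y v) (F.e₂ y) • F.E₂ y := by
  apply fderiv_emb_injective S y
  conv_lhs => rw [(F.orthoFrame y).expand (fderiv ℝ S.emb y v)]
  have h1 : qform (fderiv ℝ S.emb y v) (S.emb y) = 0 := by rw [qform_comm]; exact S.emb_orth y _
  have h2 : qform (fderiv ℝ S.emb y v) (S.normal y) = 0 := by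
    rw [qform_comm]; exact S.normal_orth y _
  rw [h1, h2]
  simp [e₁, e₂]

lemma qform_n₂_e₁ (y : Fin 2 → ℝ) : qform (F.n₂ y) (F.e₁ y) = F.b.1 y := by
  have h1 : qform (F.n₂ y) (F.e₁ y) = _ := qform_fderiv_eq_neg S.contDiff_normal F.contDiff_e₁
    (fun y => S.normal_orth y _) y (F.E₂ y)
  have h2 : qform (F.n₁ y) (F.e₂ y) = _ := qform_fderiv_eq_neg S.contDiff_normal F.contDiff_e₂
    (fun y => S.normal_orth y _) y (F.E₁ y)
  have h3 := S.normal_orth y (fieldBracket F.E₁ F.E₂ y)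
  rw [← F.fderiv_e₁_sub, qform_comm, qform_sub_left] at h3
  change _ = qform (F.n₁ y) (F.e₂ y)
  rw [h1, h2]; linarith

lemma bracket_eq (y : Fin 2 → ℝ) :
    fieldBracket F.E₁ F.E₂ y = -(F.ω₁.1 y) • F.E₁ y - F.ω₂.1 y • F.E₂ y := by
  conv_lhs => rw [F.fderiv_emb_expand y (fieldBracket F.E₁ F.E₂ y), ← F.fderiv_e₁_sub]
  have h1 : qform (fderiv ℝ F.e₂ y (F.E₁ y)) (F.e₁ y) = _ :=
    qform_fderiv_eq_neg F.contDiff_e₂ F.contDiff_e₁ (c := 0)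
      (fun y => by rw [qform_comm]; exact F.orth y) y (F.E₁ y)
  have h2 : qform (fderiv ℝ F.e₁ y (F.E₂ y)) (F.e₁ y) = 0 :=
    qform_fderiv_self F.contDiff_e₁ F.norm₁ y _
  have h3 : qform (fderiv ℝ F.e₂ y (F.E₁ y)) (F.e₂ y) = 0 :=
    qform_fderiv_self F.contDiff_e₂ F.norm₂ y _
  simp only [qform_sub_left, h1, h2, h3, ω₁, ω₂]
  simp [sub_eq_add_neg]

lemma commutator (φ : smoothFn) :
    F.D₁ (F.D₂ φ) - F.D₂ (F.D₁ φ) = -F.ω₁ * F.D₁ φ - F.ω₂ * F.D₂ φ := by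
  ext y
  have h := fderiv_bracket φ.2 F.smooth₁ F.smooth₂ y
  rw [F.bracket_eq, map_sub, map_smul, map_smul] at h
  exact h

lemma D₁_f (p : Fin 4 → ℝ) : F.D₁ (S.f p) = F.f₁ p := by
  ext y; exact fderiv_qform_const S.contDiff_emb p y _

lemma D₂_f (p : Fin 4 → ℝ) : F.D₂ (S.f p) = F.f₂ p := by
  ext y; exact fderiv_qform_const S.contDiff_emb p y _

lemma D₁_g (p : Fin 4 → ℝ) : F.D₁ (S.g p) = F.a * F.f₁ p + F.b * F.f₂ p := by
  ext y
  refine (fderiv_qform_const S.contDiff_normal p y _).trans ?_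
  rw [(F.orthoFrame y).qform_expand]
  have h1 := qform_fderiv_self S.contDiff_normal S.normal_unit y (F.E₁ y)
  have h2 := qform_fderiv_eq_neg S.contDiff_normal S.contDiff_emb S.normal_orth_base y (F.E₁ y)
  rw [h1, h2, qform_comm (fderiv ℝ S.emb y _), S.normal_orth y]
  simp [a, b, f₁, f₂, n₁]

lemma D₁_f₁ (p : Fin 4 → ℝ) : F.D₁ (F.f₁ p) = F.ω₁ * F.f₂ p + S.f p + F.a * S.g p := by
  ext y
  refine (fderiv_qform_const F.contDiff_e₁ p y _).trans ?_
  rw [(F.orthoFrame y).qform_expand]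
  have h1 := qform_fderiv_self F.contDiff_e₁ F.norm₁ y (F.E₁ y)
  have h2 := qform_fderiv_eq_neg F.contDiff_e₁ S.contDiff_emb (c := 0)
    (fun y => (F.orthoFrame y).e1x) y (F.E₁ y)
  have h3 := qform_fderiv_eq_neg F.contDiff_e₁ S.contDiff_normal (c := 0)
    (fun y => (F.orthoFrame y).e1n) y (F.E₁ y)
  have h4 : qform (fderiv ℝ S.emb y (F.E₁ y)) (F.e₁ y) = 1 := (F.orthoFrame y).e11
  rw [h1, h2, h3, h4]
  simp [ω₁, a, f₂, n₁, SpacelikeSurface.f, SpacelikeSurface.g]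

lemma D₂_f₁ (p : Fin 4 → ℝ) : F.D₂ (F.f₁ p) = F.ω₂ * F.f₂ p + F.b * S.g p := by
  ext y
  refine (fderiv_qform_const F.contDiff_e₁ p y _).trans ?_
  rw [(F.orthoFrame y).qform_expand]
  have h1 := qform_fderiv_self F.contDiff_e₁ F.norm₁ y (F.E₂ y)
  have h2 := qform_fderiv_eq_neg F.contDiff_e₁ S.contDiff_emb (c := 0)
    (fun y => (F.orthoFrame y).e1x) y (F.E₂ y)
  have h3 := qform_fderiv_eq_neg F.contDiff_e₁ S.contDiff_normal (c := 0)
    (fun y => (F.orthoFrame y).e1n) y (F.E₂ y)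
  have h4 : qform (fderiv ℝ S.emb y (F.E₂ y)) (F.e₁ y) = 0 := by
    rw [qform_comm]; exact (F.orthoFrame y).e12
  rw [h1, h2, h3, h4, show qform (fderiv ℝ S.normal y (F.E₂ y)) (F.e₁ y) = _ from F.qform_n₂_e₁ y]
  simp [ω₂, f₂, SpacelikeSurface.g]

lemma D₁_f₂ (p : Fin 4 → ℝ) : F.D₁ (F.f₂ p) = -F.ω₁ * F.f₁ p + F.b * S.g p := by
  ext y
  refine (fderiv_qform_const F.contDiff_e₂ p y _).trans ?_
  rw [(F.orthoFrame y).qform_expand]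
  have h1 := qform_fderiv_self F.contDiff_e₂ F.norm₂ y (F.E₁ y)
  have h2 := qform_fderiv_eq_neg F.contDiff_e₂ S.contDiff_emb (c := 0)
    (fun y => (F.orthoFrame y).e2x) y (F.E₁ y)
  have h3 := qform_fderiv_eq_neg F.contDiff_e₂ S.contDiff_normal (c := 0)
    (fun y => (F.orthoFrame y).e2n) y (F.E₁ y)
  have h4 : qform (fderiv ℝ S.emb y (F.E₁ y)) (F.e₂ y) = 0 := (F.orthoFrame y).e12
  have h5 := qform_fderiv_eq_neg F.contDiff_e₂ F.contDiff_e₁ (c := 0)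
    (fun y => by rw [qform_comm]; exact F.orth y) y (F.E₁ y)
  rw [h1, h2, h3, h4, h5]
  simp [ω₁, b, n₁, f₁, SpacelikeSurface.g]

/-- In a moving frame, the trace of the shape operator. -/
lemma trace_shape (y : Fin 2 → ℝ) : LinearMap.trace ℝ (Fin 2 → ℝ) (S.shape y)
    = F.a.1 y + qform (F.n₂ y) (F.e₂ y) ∧
    LinearMap.det (S.shape y) = F.a.1 y * qform (F.n₂ y) (F.e₂ y) - F.b.1 y ^ 2 := by
  have hli : LinearIndependent ℝ ![F.E₁ y, F.E₂ y] := by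
    rw [LinearIndependent.pair_iff]
    intro s t hst
    have h := congrArg (fderiv ℝ S.emb y) hst
    simp only [map_add, map_smul, map_zero] at h
    have h1 := congrArg (fun v => qform v (F.e₁ y)) h
    have h2 := congrArg (fun v => qform v (F.e₂ y)) h
    have o := F.orthoFrame y
    have o1 : qform (fderiv ℝ S.emb y (F.E₁ y)) (F.e₁ y) = 1 := o.e11
    have o2 : qform (fderiv ℝ S.emb y (F.E₂ y)) (F.e₂ y) = 1 := o.e22
    have o3 : qform (fderiv ℝ S.emb y (F.E₁ y)) (F.e₂ y) = 0 := o.e12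
    have o4 : qform (fderiv ℝ S.emb y (F.E₂ y)) (F.e₁ y) = 0 := by rw [qform_comm]; exact o.e12
    simp only [qform_add_left, qform_smul_left, qform_zero_left, o1, o2, o3, o4] at h1 h2
    constructor <;> linarith
  let B := basisOfLinearIndependentOfCardEqFinrank hli (by simp)
  have hB0 : B 0 = F.E₁ y := by simp [B]
  have hB1 : B 1 = F.E₂ y := by simp [B]
  have hexp : ∀ v, B.repr v 0 = qform (fderiv ℝ S.emb y v) (F.e₁ y) ∧
      B.repr v 1 = qform (fderiv ℝ S.emb y v) (F.e₂ y) := by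
    intro v
    have : B.repr v = B.repr (qform (fderiv ℝ S.emb y v) (F.e₁ y) • B 0
      + qform (fderiv ℝ S.emb y v) (F.e₂ y) • B 1) := by
      rw [hB0, hB1, ← F.fderiv_emb_expand]
    rw [this]
    simp
  have ha : F.a.1 y = qform (F.n₁ y) (F.e₁ y) := rfl
  have hb : F.b.1 y = qform (F.n₁ y) (F.e₂ y) := rfl
  have hn1 : F.n₁ y = fderiv ℝ S.emb y (S.shape y (F.E₁ y)) := S.shape_spec y _
  have hn2 : F.n₂ y = fderiv ℝ S.emb y (S.shape y (F.E₂ y)) := S.shape_spec y _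
  have hb' := F.qform_n₂_e₁ y
  constructor
  · rw [LinearMap.trace_eq_matrix_trace ℝ B, Matrix.trace, Fin.sum_univ_two]
    simp only [Matrix.diag, LinearMap.toMatrix_apply, hexp, hB0, hB1]
    rw [ha, hn1, hn2]
  · rw [← LinearMap.det_toMatrix B, Matrix.det_fin_two]
    simp only [LinearMap.toMatrix_apply, hexp, hB0, hB1]
    rw [← hn1, ← hn2, hb', ← ha, ← hb]; ring

lemma qform_n₂_e₂ (hS : S.IsMaximal) (y : Fin 2 → ℝ) : qform (F.n₂ y) (F.e₂ y) = -F.a.1 y := by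
  have := (F.trace_shape y).1
  rw [hS y] at this
  linarith

lemma lambdaAt_eq (hS : S.IsMaximal) (y : Fin 2 → ℝ) : S.lambdaAt y = √(F.a.1 y ^ 2 + F.b.1 y ^ 2) := by
  rw [SpacelikeSurface.lambdaAt, (F.trace_shape y).2, F.qform_n₂_e₂ hS]
  congr 1; ring

lemma D₂_g (hS : S.IsMaximal) (p : Fin 4 → ℝ) : F.D₂ (S.g p) = F.b * F.f₁ p - F.a * F.f₂ p := by
  ext y
  refine (fderiv_qform_const S.contDiff_normal p y _).trans ?_
  rw [(F.orthoFrame y).qform_expand]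
  have h1 := qform_fderiv_self S.contDiff_normal S.normal_unit y (F.E₂ y)
  have h2 := qform_fderiv_eq_neg S.contDiff_normal S.contDiff_emb S.normal_orth_base y (F.E₂ y)
  rw [h1, h2, qform_comm (fderiv ℝ S.emb y _), S.normal_orth y,
    show qform (fderiv ℝ S.normal y (F.E₂ y)) (F.e₁ y) = _ from F.qform_n₂_e₁ y,
    show qform (fderiv ℝ S.normal y (F.E₂ y)) (F.e₂ y) = _ from F.qform_n₂_e₂ hS y]
  simp [f₁, f₂, sub_eq_add_neg]

lemma D₂_f₂ (hS : S.IsMaximal) (p : Fin 4 → ℝ) : F.D₂ (F.f₂ p) = -F.ω₂ * F.f₁ p + S.f p - F.a * S.g p := by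
  ext y
  refine (fderiv_qform_const F.contDiff_e₂ p y _).trans ?_
  rw [(F.orthoFrame y).qform_expand]
  have h1 := qform_fderiv_self F.contDiff_e₂ F.norm₂ y (F.E₂ y)
  have h2 := qform_fderiv_eq_neg F.contDiff_e₂ S.contDiff_emb (c := 0)
    (fun y => (F.orthoFrame y).e2x) y (F.E₂ y)
  have h3 := qform_fderiv_eq_neg F.contDiff_e₂ S.contDiff_normal (c := 0)
    (fun y => (F.orthoFrame y).e2n) y (F.E₂ y)
  have h4 : qform (fderiv ℝ S.emb y (F.E₂ y)) (F.e₂ y) = 1 := (F.orthoFrame y).e22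
  have h5 := qform_fderiv_eq_neg F.contDiff_e₂ F.contDiff_e₁ (c := 0)
    (fun y => by rw [qform_comm]; exact F.orth y) y (F.E₂ y)
  rw [h1, h2, h3, h4, h5,
    show qform (fderiv ℝ S.normal y (F.E₂ y)) (F.e₂ y) = _ from F.qform_n₂_e₂ hS y]
  simp [ω₂, f₁, SpacelikeSurface.f, SpacelikeSurface.g, sub_eq_add_neg]

lemma sq_add_sq (p : Fin 4 → ℝ) :
    F.f₁ p ^ 2 + F.f₂ p ^ 2 = S.f p ^ 2 + S.g p ^ 2 + algebraMap ℝ smoothFn (qform p p) := by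
  ext y
  change qform (F.e₁ y) p ^ 2 + qform (F.e₂ y) p ^ 2 = qform (S.emb y) p ^ 2
    + qform (S.normal y) p ^ 2 + qform p p
  rw [(F.orthoFrame y).qform_expand p p, qform_comm p, qform_comm p, qform_comm p, qform_comm p]
  ring

end MovingFrame

namespace MovingFrame

variable {S : SpacelikeSurface} (F : MovingFrame S)

/-- The Laplace–Beltrami operator in a moving frame. -/
def lap (φ : smoothFn) : smoothFn :=
  F.D₁ (F.D₁ φ) + F.D₂ (F.D₂ φ) - F.ω₁ * F.D₂ φ + F.ω₂ * F.D₁ φ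

/-- The component of the derivative of the second fundamental form along the first field. -/
def α : smoothFn := F.D₁ F.a - 2 * F.b * F.ω₁

/-- The component of the derivative of the second fundamental form along the second field. -/
def β : smoothFn := F.D₂ F.a - 2 * F.b * F.ω₂

lemma f₁_e₁ (y : Fin 2 → ℝ) : (F.f₁ (F.e₁ y)).1 y = 1 := (F.orthoFrame y).e11
lemma f₂_e₁ (y : Fin 2 → ℝ) : (F.f₂ (F.e₁ y)).1 y = 0 := by
  rw [show (F.f₂ (F.e₁ y)).1 y = _ from qform_comm _ _]; exact (F.orthoFrame y).e12
lemma f₁_e₂ (y : Fin 2 → ℝ) : (F.f₁ (F.e₂ y)).1 y = 0 := (F.orthoFrame y).e12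
lemma f₂_e₂ (y : Fin 2 → ℝ) : (F.f₂ (F.e₂ y)).1 y = 1 := (F.orthoFrame y).e22

/-- A relation between the linear functions of the frame vectors has trivial coefficients. -/
lemma coeff_eq_zero {u w : smoothFn} (h : ∀ p, u * F.f₁ p + w * F.f₂ p = 0) : u = 0 ∧ w = 0 := by
  constructor
  · ext y
    have := congrFun (congrArg Subtype.val (h (F.e₁ y))) y
    change u.1 y * (F.f₁ (F.e₁ y)).1 y + w.1 y * (F.f₂ (F.e₁ y)).1 y = 0 at this
    rw [f₁_e₁, f₂_e₁] at this
    change u.1 y = 0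
    linarith
  · ext y
    have := congrFun (congrArg Subtype.val (h (F.e₂ y))) y
    change u.1 y * (F.f₁ (F.e₂ y)).1 y + w.1 y * (F.f₂ (F.e₂ y)).1 y = 0 at this
    rw [f₁_e₂, f₂_e₂] at this
    change w.1 y = 0
    linarith

lemma lap_add (φ ψ : smoothFn) : F.lap (φ + ψ) = F.lap φ + F.lap ψ := by
  simp only [lap, map_add]; ring

lemma lap_sub (φ ψ : smoothFn) : F.lap (φ - ψ) = F.lap φ - F.lap ψ := by
  simp only [lap, map_sub]; ring

lemma lap_mul (φ ψ : smoothFn) : F.lap (φ * ψ) = φ * F.lap ψ + ψ * F.lap φ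
    + 2 * (F.D₁ φ * F.D₁ ψ + F.D₂ φ * F.D₂ ψ) := by
  simp only [lap, map_add, Derivation.leibniz, smul_eq_mul]; ring

lemma lap_algebraMap (c : ℝ) : F.lap (algebraMap ℝ smoothFn c) = 0 := by
  simp [lap]

lemma codazzi (hS : S.IsMaximal) :
    F.D₁ F.b = F.β - 2 * F.a * F.ω₁ ∧ F.D₂ F.b = -F.α - 2 * F.a * F.ω₂ := by
  have h := F.coeff_eq_zero (u := F.D₁ F.b - (F.β - 2 * F.a * F.ω₁))
    (w := -(F.D₂ F.b - (-F.α - 2 * F.a * F.ω₂))) fun p => by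
      have := F.commutator (S.g p)
      simp only [F.D₁_g, F.D₂_g hS, map_add, map_sub, Derivation.leibniz, smul_eq_mul, F.D₁_f₁,
        F.D₂_f₁, F.D₁_f₂, F.D₂_f₂ hS] at this
      simp only [α, β]
      linear_combination this
  exact ⟨sub_eq_zero.1 h.1, sub_eq_zero.1 (neg_eq_zero.1 h.2)⟩

lemma gauss (hS : S.IsMaximal) : F.D₁ F.ω₂ - F.D₂ F.ω₁
    = 1 - F.a ^ 2 - F.b ^ 2 - F.ω₁ ^ 2 - F.ω₂ ^ 2 := by
  have hb1 := (F.codazzi hS).1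
  have h := F.coeff_eq_zero (u := 0) (w := F.D₁ F.ω₂ - F.D₂ F.ω₁ -
    (1 - F.a ^ 2 - F.b ^ 2 - F.ω₁ ^ 2 - F.ω₂ ^ 2)) fun p => by
      have := F.commutator (F.f₁ p)
      simp only [F.D₂_f, F.D₁_g, F.D₂_g hS, map_add, Derivation.leibniz,
        smul_eq_mul, F.D₁_f₁, F.D₂_f₁, F.D₁_f₂, F.D₂_f₂ hS, hb1, β] at this
      linear_combination this
  exact sub_eq_zero.1 h.2

lemma lap_f (hS : S.IsMaximal) (p : Fin 4 → ℝ) : F.lap (S.f p) = 2 * S.f p := by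
  simp only [lap, F.D₁_f, F.D₂_f, F.D₁_f₁, F.D₂_f₂ hS]; ring

/-- The square of the principal curvature. -/
def Q : smoothFn := F.a ^ 2 + F.b ^ 2

lemma lap_g (hS : S.IsMaximal) (p : Fin 4 → ℝ) : F.lap (S.g p) = 2 * F.Q * S.g p := by
  obtain ⟨hb1, hb2⟩ := F.codazzi hS
  simp only [lap, F.D₁_g, F.D₂_g hS, map_add, map_sub, Derivation.leibniz,
        smul_eq_mul, F.D₁_f₁, F.D₂_f₁, F.D₁_f₂, F.D₂_f₂ hS, hb1, hb2, α, β, Q]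
  ring

lemma D₁_Q (hS : S.IsMaximal) : F.D₁ F.Q = 2 * (F.a * F.α + F.b * F.β) := by
  simp only [Q, map_add, pow_two, Derivation.leibniz, smul_eq_mul, (F.codazzi hS).1, α]; ring

lemma D₂_Q (hS : S.IsMaximal) : F.D₂ F.Q = 2 * (F.a * F.β - F.b * F.α) := by
  simp only [Q, map_add, pow_two, Derivation.leibniz, smul_eq_mul, (F.codazzi hS).2, β]; ring

/-- Simons' identity. -/
lemma lap_Q (hS : S.IsMaximal) :
    F.lap F.Q = 4 * F.Q * (F.Q - 1) + 4 * (F.α ^ 2 + F.β ^ 2) := by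
  have ha := F.commutator F.a
  have hb := F.commutator F.b
  have ha1 : F.D₁ F.a = F.α + 2 * F.b * F.ω₁ := by simp only [α]; ring
  have ha2 : F.D₂ F.a = F.β + 2 * F.b * F.ω₂ := by simp only [β]; ring
  have h2 : ∀ D : Derivation ℝ smoothFn smoothFn, D 2 = 0 := fun D => by
    exact_mod_cast D.map_natCast 2
  obtain ⟨hb1, hb2⟩ := F.codazzi hS
  have hg := F.gauss hS
  simp only [ha1, ha2, hb1, hb2, map_add, map_sub, map_neg, Derivation.leibniz, smul_eq_mul, h2]
    at ha hb
  rw [lap, F.D₁_Q hS, F.D₂_Q hS]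
  simp only [ha1, ha2, hb1, hb2, map_add, map_sub, Derivation.leibniz, smul_eq_mul, h2, Q]
  linear_combination -2 * F.a * hb + 2 * F.b * ha - 4 * (F.a ^ 2 + F.b ^ 2) * hg

end MovingFrame

lemma deriv_deriv_nonpos_of_isLocalMax {h : ℝ → ℝ} {s : ℝ} (hc : ContinuousAt h s)
    (hm : IsLocalMax h s) : deriv (deriv h) s ≤ 0 := by
  by_contra! hpos
  have hmin := isLocalMin_of_deriv_deriv_pos hpos hm.deriv_eq_zero hc
  have hconst : h =ᶠ[𝓝 s] fun _ => h s := by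
    filter_upwards [hm, hmin] with t h1 h2
    exact le_antisymm h1 h2
  have h2 : deriv h =ᶠ[𝓝 s] fun _ => 0 := by
    have := hconst.deriv
    simpa using this
  rw [h2.deriv_eq] at hpos
  simp at hpos

namespace MovingFrame

variable {S : SpacelikeSurface} (F : MovingFrame S)

lemma deriv_field_sq {φ : smoothFn} {y : Fin 2 → ℝ} (h : IsLocalMax φ.1 y)
    {E : (Fin 2 → ℝ) → Fin 2 → ℝ} (hE : ContDiff ℝ ∞ E) :
    (fieldDeriv E hE (fieldDeriv E hE φ)).1 y ≤ 0 := by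
  have h0 : fderiv ℝ φ.1 y = 0 := h.fderiv_eq_zero
  rw [fieldDeriv_apply]
  change fderiv ℝ (fun y => fderiv ℝ φ.1 y (E y)) y (E y) ≤ 0
  rw [fderiv_fderiv_apply_field φ.2 hE, h0]
  rw [show ∀ v, (0 : (Fin 2 → ℝ) →L[ℝ] ℝ) v = 0 from fun _ => rfl, add_zero]
  let c : ℝ → Fin 2 → ℝ := fun s => y + s • E y
  have hc : ∀ s, HasDerivAt c (E y) s := fun s => by
    have := ((hasDerivAt_id s).smul_const (E y)).const_add y
    rwa [one_smul] at this
  have hc0 : c 0 = y := by simp [c]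
  have hcc : ContinuousAt c 0 := (hc 0).continuousAt
  have hd : deriv (fun s => φ.1 (c s)) = fun s => fderiv ℝ φ.1 (c s) (E y) := by
    funext s
    exact ((smoothFn.differentiable φ (c s)).hasFDerivAt.comp_hasDerivAt s (hc s)).deriv
  have hdd : deriv (deriv fun s => φ.1 (c s)) 0 = fderiv ℝ (fderiv ℝ φ.1) y (E y) (E y) := by
    rw [hd]
    have h1 : DifferentiableAt ℝ (fderiv ℝ φ.1) (c 0) :=
      (((smoothFn.contDiff φ).fderiv_right (m := ∞) (by simp)).differentiable (by simp)) _
    have := (h1.hasFDerivAt.comp_hasDerivAt 0 (hc 0)).clm_apply (hasDerivAt_const 0 (E y))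
    refine (HasDerivAt.deriv this).trans ?_
    simp [hc0]
  rw [← hdd]
  apply deriv_deriv_nonpos_of_isLocalMax
  · exact ContinuousAt.comp (smoothFn.differentiable φ _).continuousAt hcc
  · have : Tendsto c (𝓝 0) (𝓝 y) := by simpa [hc0] using hcc.tendsto
    have h3 := this.eventually h
    filter_upwards [h3] with s hs
    simpa [hc0] using hs

/-- First and second order conditions at a local maximum. -/
lemma of_isLocalMax {φ : smoothFn} {y : Fin 2 → ℝ} (h : IsLocalMax φ.1 y) :
    (F.D₁ φ).1 y = 0 ∧ (F.D₂ φ).1 y = 0 ∧ (F.lap φ).1 y ≤ 0 := by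
  have h0 : fderiv ℝ φ.1 y = 0 := h.fderiv_eq_zero
  have h1 : (F.D₁ φ).1 y = 0 := by
    change fderiv ℝ φ.1 y (F.E₁ y) = 0
    simp [h0]
  have h2 : (F.D₂ φ).1 y = 0 := by
    change fderiv ℝ φ.1 y (F.E₂ y) = 0
    simp [h0]
  refine ⟨h1, h2, ?_⟩
  change (F.D₁ (F.D₁ φ)).1 y + (F.D₂ (F.D₂ φ)).1 y - F.ω₁.1 y * (F.D₂ φ).1 y
    + F.ω₂.1 y * (F.D₁ φ).1 y ≤ 0
  have h3 : (F.D₁ (F.D₁ φ)).1 y ≤ 0 := deriv_field_sq h F.smooth₁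
  have h4 : (F.D₂ (F.D₂ φ)).1 y ≤ 0 := deriv_field_sq h F.smooth₂
  rw [h1, h2]
  linarith

/-- The squared gradient of a linear function. -/
def gradSq (p : Fin 4 → ℝ) : smoothFn := F.f₁ p ^ 2 + F.f₂ p ^ 2

/-- The function `λ² ⟨N, p⟩²`. -/
def G (p : Fin 4 → ℝ) : smoothFn := F.Q * S.g p ^ 2

/-- First component of the normalized gradient of `G`. -/
def M₁ (p : Fin 4 → ℝ) : smoothFn :=
  S.g p * F.α + F.a * (F.a * F.f₁ p + F.b * F.f₂ p) - F.b * (F.b * F.f₁ p - F.a * F.f₂ p)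

/-- Second component of the normalized gradient of `G`. -/
def M₂ (p : Fin 4 → ℝ) : smoothFn :=
  S.g p * F.β + F.b * (F.a * F.f₁ p + F.b * F.f₂ p) + F.a * (F.b * F.f₁ p - F.a * F.f₂ p)

lemma D₁_G (hS : S.IsMaximal) (p : Fin 4 → ℝ) :
    F.D₁ (F.G p) = 2 * S.g p * (F.a * F.M₁ p + F.b * F.M₂ p) := by
  simp only [G, pow_two, Derivation.leibniz, smul_eq_mul, F.D₁_Q hS, F.D₁_g, M₁, M₂]
  simp only [Q]; ring

lemma D₂_G (hS : S.IsMaximal) (p : Fin 4 → ℝ) :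
    F.D₂ (F.G p) = 2 * S.g p * (F.a * F.M₂ p - F.b * F.M₁ p) := by
  simp only [G, pow_two, Derivation.leibniz, smul_eq_mul, F.D₂_Q hS, F.D₂_g hS, M₁, M₂]
  simp only [Q]; ring

lemma lap_G (hS : S.IsMaximal) (p : Fin 4 → ℝ) : F.lap (F.G p)
    = 4 * F.G p * (2 * F.Q - 1) + 4 * (F.M₁ p ^ 2 + F.M₂ p ^ 2) - 2 * F.Q ^ 2 * F.gradSq p := by
  rw [G, pow_two, F.lap_mul, F.lap_mul, F.lap_Q hS, F.lap_g hS]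
  simp only [Derivation.leibniz, smul_eq_mul, F.D₁_Q hS, F.D₂_Q hS, F.D₁_g, F.D₂_g hS, M₁, M₂,
    gradSq]
  simp only [Q]; ring

lemma D₁_gradSq (p : Fin 4 → ℝ) : F.D₁ (F.gradSq p)
    = 2 * (F.f₁ p * (S.f p + F.a * S.g p) + F.f₂ p * (F.b * S.g p)) := by
  simp only [gradSq, pow_two, map_add, Derivation.leibniz, smul_eq_mul, F.D₁_f₁, F.D₁_f₂]; ring

lemma D₂_gradSq (hS : S.IsMaximal) (p : Fin 4 → ℝ) : F.D₂ (F.gradSq p)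
    = 2 * (F.f₁ p * (F.b * S.g p) + F.f₂ p * (S.f p - F.a * S.g p)) := by
  simp only [gradSq, pow_two, map_add, Derivation.leibniz, smul_eq_mul, F.D₂_f₁, F.D₂_f₂ hS]; ring

lemma lap_gradSq (hS : S.IsMaximal) (p : Fin 4 → ℝ) : F.lap (F.gradSq p)
    = 4 * S.f p ^ 2 + 4 * F.G p + 2 * (1 + F.Q) * F.gradSq p := by
  have h := F.sq_add_sq p
  conv_lhs => rw [gradSq, h, F.lap_add, F.lap_add, F.lap_algebraMap, pow_two, pow_two, F.lap_mul,
    F.lap_mul, F.lap_f hS, F.lap_g hS]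
  simp only [F.D₁_f, F.D₂_f, F.D₁_g, F.D₂_g hS, G, Q, gradSq]
  ring

end MovingFrame

/-! ### Curves at infinity -/

lemma toBoundary_smul_left (c : ℝ) (v w : Fin 2 → ℝ) :
    toBoundary (c • v) w = c • toBoundary v w := by
  ext i
  fin_cases i <;> simp [toBoundary] <;> ring

lemma toBoundary_ne_zero {v w : Fin 2 → ℝ} (hv : v ≠ 0) (hw : w ≠ 0) : toBoundary v w ≠ 0 := by
  intro h
  have h0 := congrFun h 0
  have h1 := congrFun h 1
  have h2 := congrFun h 2
  have h3 := congrFun h 3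
  simp only [toBoundary, Matrix.cons_val, Pi.zero_apply] at h0 h1 h2 h3
  have h00 : v 0 * w 0 = 0 := by linarith
  have h11 : v 1 * w 1 = 0 := by linarith
  have h01 : v 0 * w 1 = 0 := by linarith
  have h10 : v 1 * w 0 = 0 := by linarith
  rcases eq_or_ne (v 0) 0 with hv0 | hv0
  · rcases eq_or_ne (v 1) 0 with hv1 | hv1
    · exact hv (by ext i; fin_cases i <;> simpa)
    · exact hw (by ext i; fin_cases i <;> simp_all)
  · exact hw (by ext i; fin_cases i <;> simp_all)

lemma qform_toBoundary (v w v' w' : Fin 2 → ℝ) :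
    qform (toBoundary v w) (toBoundary v' w') = -(det2 v v' * det2 w w') / 2 := by
  simp [qform, toBoundary, det2]; ring

lemma exists_smul_of_det2_eq_zero {v w : Fin 2 → ℝ} (hv : v ≠ 0) (hw : w ≠ 0)
    (h : det2 v w = 0) : ∃ c : ℝ, c ≠ 0 ∧ w = c • v := by
  simp only [det2] at h
  suffices h : ∃ c : ℝ, w = c • v by
    obtain ⟨c, rfl⟩ := h
    exact ⟨c, fun hc => hw (by simp [hc]), rfl⟩
  rcases eq_or_ne (v 0) 0 with hv0 | hv0
  · have hv1 : v 1 ≠ 0 := fun hv1 => hv (by ext i; fin_cases i <;> simpa)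
    refine ⟨w 1 / v 1, ?_⟩
    ext i
    fin_cases i
    · have : w 0 = 0 := by simpa [hv0, hv1] using h
      simp [hv0, this]
    · simp [hv1]
  · refine ⟨w 0 / v 0, ?_⟩
    ext i
    fin_cases i
    · simp [hv0]
    · simp; field_simp; linarith

lemma mem_lifts_grGraph {φ : RP1 → RP1} {x : Fin 4 → ℝ} : x ∈ lifts (grGraph φ) ↔
    ∃ (v w : Fin 2 → ℝ) (hv : v ≠ 0) (hw : w ≠ 0), x = toBoundary v w ∧
      φ (Projectivization.mk ℝ v hv) = Projectivization.mk ℝ w hw := by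
  constructor
  · rintro ⟨hx, v, w, hv, hw, h, he, hφ⟩
    obtain ⟨c, hc⟩ := (Projectivization.mk_eq_mk_iff' ℝ _ _ h hx).1 he
    have hc0 : c ≠ 0 := by rintro rfl; exact h (by rw [← hc, zero_smul])
    have : Projectivization.mk ℝ (c⁻¹ • v) (smul_ne_zero (inv_ne_zero hc0) hv)
        = Projectivization.mk ℝ v hv :=
      (Projectivization.mk_eq_mk_iff' ℝ _ _ _ _).2 ⟨c⁻¹, rfl⟩
    refine ⟨c⁻¹ • v, w, smul_ne_zero (inv_ne_zero hc0) hv, hw, ?_, by rw [this, hφ]⟩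
    rw [toBoundary_smul_left, ← hc, smul_smul, inv_mul_cancel₀ hc0, one_smul]
  · rintro ⟨v, w, hv, hw, rfl, hφ⟩
    exact ⟨toBoundary_ne_zero hv hw, v, w, hv, hw, toBoundary_ne_zero hv hw, rfl, hφ⟩

lemma det2_smul_smul (c d : ℝ) (v w : Fin 2 → ℝ) : det2 (c • v) (d • w) = c * d * det2 v w := by
  simp [det2]; ring

lemma mk_eq_mk_of_det2 {v w : Fin 2 → ℝ} (hv : v ≠ 0) (hw : w ≠ 0) (h : det2 v w = 0) :
    Projectivization.mk ℝ v hv = Projectivization.mk ℝ w hw := by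
  obtain ⟨c, hc, rfl⟩ := exists_smul_of_det2_eq_zero hv hw h
  exact ((Projectivization.mk_eq_mk_iff' ℝ _ _ _ _).2 ⟨c, rfl⟩).symm

lemma det2_eq_zero_of_mk_eq_mk {v w : Fin 2 → ℝ} (hv : v ≠ 0) (hw : w ≠ 0)
    (h : Projectivization.mk ℝ v hv = Projectivization.mk ℝ w hw) : det2 v w = 0 := by
  obtain ⟨c, rfl⟩ := (Projectivization.mk_eq_mk_iff' ℝ _ _ _ _).1 h
  simp [det2]; ring

lemma tripleOrient_mk {u v w : Fin 2 → ℝ} (hu : u ≠ 0) (hv : v ≠ 0) (hw : w ≠ 0) :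
    ∃ c : ℝ, 0 < c ∧ tripleOrient (Projectivization.mk ℝ u hu) (Projectivization.mk ℝ v hv)
      (Projectivization.mk ℝ w hw) = c * (det2 u v * det2 v w * det2 w u) := by
  obtain ⟨a, ha⟩ := Projectivization.exists_smul_eq_mk_rep ℝ u hu
  obtain ⟨b, hb⟩ := Projectivization.exists_smul_eq_mk_rep ℝ v hv
  obtain ⟨c, hc⟩ := Projectivization.exists_smul_eq_mk_rep ℝ w hw
  refine ⟨((a : ℝ) * b * c) ^ 2, sq_pos_of_ne_zero
    (mul_ne_zero (mul_ne_zero a.ne_zero b.ne_zero) c.ne_zero), ?_⟩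
  rw [tripleOrient, ← ha, ← hb, ← hc]
  simp only [Units.smul_def, det2_smul_smul]
  ring

lemma OrientationPreserving.det2_mul_nonneg {φ : RP1 → RP1} (h : OrientationPreserving φ)
    {u v w u' v' w' : Fin 2 → ℝ} (hu : u ≠ 0) (hv : v ≠ 0) (hw : w ≠ 0) (hu' : u' ≠ 0)
    (hv' : v' ≠ 0) (hw' : w' ≠ 0)
    (eu : φ (Projectivization.mk ℝ u hu) = Projectivization.mk ℝ u' hu')
    (ev : φ (Projectivization.mk ℝ v hv) = Projectivization.mk ℝ v' hv')
    (ew : φ (Projectivization.mk ℝ w hw) = Projectivization.mk ℝ w' hw') :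
    0 ≤ (det2 u v * det2 v w * det2 w u) * (det2 u' v' * det2 v' w' * det2 w' u') := by
  obtain ⟨c, hc, h1⟩ := tripleOrient_mk hu hv hw
  obtain ⟨d, hd, h2⟩ := tripleOrient_mk hu' hv' hw'
  obtain ⟨c', hc', h1'⟩ := tripleOrient_mk hu hw hv
  obtain ⟨d', hd', h2'⟩ := tripleOrient_mk hu' hw' hv'
  have swap : ∀ u v w : Fin 2 → ℝ, det2 u w * det2 w v * det2 v u
      = -(det2 u v * det2 v w * det2 w u) := fun u v w => by simp only [det2]; ring
  rw [swap] at h1' h2'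
  rcases lt_trichotomy (det2 u v * det2 v w * det2 w u) 0 with hn | hz | hp
  · have := h (Projectivization.mk ℝ u hu) (Projectivization.mk ℝ w hw) (Projectivization.mk ℝ v hv)
      (by rw [h1']; exact mul_pos hc' (by linarith))
    rw [eu, ev, ew, h2'] at this
    have := (mul_pos_iff_of_pos_left hd').1 this
    nlinarith
  · rw [hz, zero_mul]
  · have := h (Projectivization.mk ℝ u hu) (Projectivization.mk ℝ v hv) (Projectivization.mk ℝ w hw)
      (by rw [h1]; exact mul_pos hc hp)
    rw [eu, ev, ew, h2] at this
    have := (mul_pos_iff_of_pos_left hd).1 this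
    positivity

/-- The set of lifts of an achronal curve in the boundary at infinity. -/
structure IsBoundaryCone (Λ : Set (Fin 4 → ℝ)) : Prop where
  ne_zero : ∀ ζ ∈ Λ, ζ ≠ 0
  null : ∀ ζ ∈ Λ, qform ζ ζ = 0
  smul_mem : ∀ ζ ∈ Λ, ∀ c : ℝ, c ≠ 0 → c • ζ ∈ Λ
  proportional : ∀ ζ ∈ Λ, ∀ ξ ∈ Λ, qform ζ ξ = 0 → ∃ c : ℝ, c ≠ 0 ∧ ξ = c • ζ
  triple : ∀ ζ ∈ Λ, ∀ ξ ∈ Λ, ∀ η ∈ Λ, qform ζ ξ * qform ξ η * qform η ζ ≤ 0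
  exists_three : ∃ ζ ∈ Λ, ∃ ξ ∈ Λ, ∃ η ∈ Λ, qform ζ ξ ≠ 0 ∧ qform ξ η ≠ 0 ∧ qform η ζ ≠ 0
  mem_of_tendsto : ∀ (u : ℕ → Fin 4 → ℝ) (ζ : Fin 4 → ℝ), (∀ n, u n ∈ Λ) →
    Tendsto u atTop (𝓝 ζ) → ζ ≠ 0 → ζ ∈ Λ
  sign : ∀ L L' : (Fin 4 → ℝ) →ₗ[ℝ] ℝ, (∀ ζ ∈ Λ, L ζ ≠ 0) → (∀ ζ ∈ Λ, L' ζ ≠ 0) →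
    (∀ ζ ∈ Λ, 0 < L ζ * L' ζ) ∨ (∀ ζ ∈ Λ, L ζ * L' ζ < 0)

lemma continuous_projMk {V : Type*} [AddCommGroup V] [Module ℝ V] [TopologicalSpace V] :
    Continuous fun v : {v : V // v ≠ 0} => Projectivization.mk ℝ v.1 v.2 :=
  continuous_quotient_mk'

lemma continuous_toBoundary : Continuous fun p : (Fin 2 → ℝ) × (Fin 2 → ℝ) =>
    toBoundary p.1 p.2 := by
  refine continuous_pi fun i => ?_
  fin_cases i <;> simp [toBoundary] <;> fun_prop

lemma tendsto_toBoundary {u w : ℕ → Fin 2 → ℝ} {v v' : Fin 2 → ℝ} (hu : Tendsto u atTop (𝓝 v))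
    (hw : Tendsto w atTop (𝓝 v')) :
    Tendsto (fun n => toBoundary (u n) (w n)) atTop (𝓝 (toBoundary v v')) :=
  Tendsto.comp (g := fun p : (Fin 2 → ℝ) × (Fin 2 → ℝ) => toBoundary p.1 p.2)
    (f := fun n => (u n, w n)) (continuous_toBoundary.tendsto (v, v')) (hu.prodMk_nhds hw)

lemma isConnected_plane_compl : IsPreconnected {v : Fin 2 → ℝ | v ≠ 0} := by
  have : 1 < Module.rank ℝ (Fin 2 → ℝ) := by simp
  exact (isConnected_compl_singleton_of_one_lt_rank this 0).isPreconnected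

lemma exists_image_mk (φ : RP1 → RP1) {v : Fin 2 → ℝ} (hv : v ≠ 0) :
    ∃ (w : Fin 2 → ℝ) (hw : w ≠ 0), ‖w‖ = 1 ∧
      φ (Projectivization.mk ℝ v hv) = Projectivization.mk ℝ w hw := by
  induction hP : φ (Projectivization.mk ℝ v hv) using Projectivization.ind with
  | h w hw =>
    have hn : ‖w‖ ≠ 0 := norm_ne_zero_iff.2 hw
    refine ⟨‖w‖⁻¹ • w, smul_ne_zero (inv_ne_zero hn) hw, ?_, ?_⟩
    · rw [norm_smul, norm_inv, norm_norm, inv_mul_cancel₀ hn]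
    · exact (Projectivization.mk_eq_mk_iff' ℝ _ _ _ _).2 ⟨‖w‖, by
        rw [smul_smul, mul_inv_cancel₀ hn, one_smul]⟩

lemma grGraph_sign {φ : RP1 ≃ₜ RP1}
    (hcl : ∀ (u : ℕ → Fin 4 → ℝ) (ζ : Fin 4 → ℝ), (∀ n, u n ∈ lifts (grGraph ⇑φ)) →
      Tendsto u atTop (𝓝 ζ) → ζ ≠ 0 → ζ ∈ lifts (grGraph ⇑φ))
    (L L' : (Fin 4 → ℝ) →ₗ[ℝ] ℝ) (hL : ∀ ζ ∈ lifts (grGraph ⇑φ), L ζ ≠ 0)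
    (hL' : ∀ ζ ∈ lifts (grGraph ⇑φ), L' ζ ≠ 0) :
    (∀ ζ ∈ lifts (grGraph ⇑φ), 0 < L ζ * L' ζ) ∨ (∀ ζ ∈ lifts (grGraph ⇑φ), L ζ * L' ζ < 0) := by
  have hLc : Continuous L := L.continuous_of_finiteDimensional
  have hLc' : Continuous L' := L'.continuous_of_finiteDimensional
  let A : ℝ → Set (Fin 2 → ℝ) := fun s => {v | ∃ (w : Fin 2 → ℝ) (hv : v ≠ 0) (hw : w ≠ 0),
    ‖w‖ = 1 ∧ φ (Projectivization.mk ℝ v hv) = Projectivization.mk ℝ w hw ∧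
    0 < s * (L (toBoundary v w) * L' (toBoundary v w))}
  have hclosed : ∀ s : ℝ, s ≠ 0 → ∀ (u : ℕ → Fin 2 → ℝ) (v : Fin 2 → ℝ), (∀ n, u n ∈ A s) →
      Tendsto u atTop (𝓝 v) → v ≠ 0 → v ∈ A s := by
    intro s hs u v hu hlim hv
    choose w hun hw hw1 hφ hpos using hu
    obtain ⟨w', hw', ψ, hψ, hψlim⟩ := (isCompact_sphere (0 : Fin 2 → ℝ) 1).tendsto_subseq
      (x := w) (fun n => by simp [hw1])
    have hw'1 : ‖w'‖ = 1 := by simpa using hw'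
    have hw'0 : w' ≠ 0 := fun h => by simp [h] at hw'1
    have hlim2 : Tendsto (fun n => toBoundary (u (ψ n)) (w (ψ n))) atTop
        (𝓝 (toBoundary v w')) :=
      tendsto_toBoundary (hlim.comp hψ.tendsto_atTop) hψlim
    have hin : ∀ n, toBoundary (u (ψ n)) (w (ψ n)) ∈ lifts (grGraph ⇑φ) := fun n =>
      mem_lifts_grGraph.2 ⟨u (ψ n), w (ψ n), hun _, hw _, rfl, hφ (ψ n)⟩
    have hmem := hcl (fun n => toBoundary (u (ψ n)) (w (ψ n))) (toBoundary v w') hin hlim2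
      (toBoundary_ne_zero hv hw'0)
    have hge : 0 ≤ s * (L (toBoundary v w') * L' (toBoundary v w')) := by
      refine ge_of_tendsto' (((hLc.tendsto _).comp hlim2).mul ((hLc'.tendsto _).comp hlim2)
        |>.const_mul s) fun n => (hpos (ψ n)).le
    have hne : s * (L (toBoundary v w') * L' (toBoundary v w')) ≠ 0 :=
      mul_ne_zero hs (mul_ne_zero (hL _ hmem) (hL' _ hmem))
    obtain ⟨v₂, w₂, hv₂, hw₂, he, hφ₂⟩ := mem_lifts_grGraph.1 hmem
    refine ⟨w', hv, hw'0, hw'1, ?_, lt_of_le_of_ne hge hne.symm⟩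
    have hv2 : det2 v v₂ = 0 ∧ det2 w' w₂ = 0 := by
      have e0 := congrFun he 0
      have e1 := congrFun he 1
      have e2 := congrFun he 2
      have e3 := congrFun he 3
      simp only [toBoundary, Matrix.cons_val] at e0 e1 e2 e3
      have a00 : v 0 * w' 0 = v₂ 0 * w₂ 0 := by linarith
      have a11 : v 1 * w' 1 = v₂ 1 * w₂ 1 := by linarith
      have a01 : v 0 * w' 1 = v₂ 0 * w₂ 1 := by linarith
      have a10 : v 1 * w' 0 = v₂ 1 * w₂ 0 := by linarith
      constructor
      · by_contra hne
        apply hw'0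
        ext i
        apply (mul_eq_zero.1 _).resolve_left hne
        fin_cases i <;> simp only [det2, Fin.zero_eta, Fin.mk_one]
        · linear_combination v₂ 1 * a00 - v₂ 0 * a10
        · linear_combination v₂ 1 * a01 - v₂ 0 * a11
      · by_contra hne
        apply hv
        ext i
        apply (mul_eq_zero.1 _).resolve_left hne
        fin_cases i <;> simp only [det2, Fin.zero_eta, Fin.mk_one]
        · linear_combination w₂ 1 * a00 - w₂ 0 * a01
        · linear_combination w₂ 1 * a10 - w₂ 0 * a11
    rw [mk_eq_mk_of_det2 hv hv₂ hv2.1, hφ₂, mk_eq_mk_of_det2 hw'0 hw₂ hv2.2]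
  have hmemA : ∀ v : Fin 2 → ℝ, v ≠ 0 → v ∈ A 1 ∨ v ∈ A (-1) := by
    intro v hv
    obtain ⟨w, hw, hw1, e⟩ := exists_image_mk φ hv
    have hmem := mem_lifts_grGraph.2 ⟨v, w, hv, hw, rfl, e⟩
    rcases lt_or_gt_of_ne (mul_ne_zero (hL _ hmem) (hL' _ hmem)) with h0 | h0
    · exact Or.inr ⟨w, hv, hw, hw1, e, by linarith⟩
    · exact Or.inl ⟨w, hv, hw, hw1, e, by linarith⟩
  have hdir : ∀ v w : Fin 2 → ℝ, ∀ (hv : v ≠ 0) (hw : w ≠ 0),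
      φ (Projectivization.mk ℝ v hv) = Projectivization.mk ℝ w hw → ∀ s, v ∈ A s →
      0 < s * (L (toBoundary v w) * L' (toBoundary v w)) := by
    rintro v w hv hw e s ⟨w', _, hw', -, e', hs⟩
    obtain ⟨c, hc, rfl⟩ := exists_smul_of_det2_eq_zero hw' hw
      (det2_eq_zero_of_mk_eq_mk hw' hw (e'.symm.trans e))
    have : toBoundary v (c • w') = c • toBoundary v w' := by
      ext i; fin_cases i <;> simp [toBoundary] <;> ring
    rw [this, map_smul, map_smul, smul_eq_mul, smul_eq_mul]
    have : 0 < c ^ 2 := by positivity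
    nlinarith [mul_pos this hs]
  by_cases hA : ∃ v, v ∈ A (-1)
  · by_cases hB : ∃ v, v ∈ A 1
    · exfalso
      have hcl' : ∀ s : ℝ, s ≠ 0 → ∀ v ∈ closure (A s), v ≠ 0 → v ∈ A s := by
        intro s hs v hv hv0
        obtain ⟨u, hu, hlim⟩ := mem_closure_iff_seq_limit.1 hv
        exact hclosed s hs u v hu hlim hv0
      have := isPreconnected_closed_iff.1 isConnected_plane_compl (closure (A 1))
        (closure (A (-1))) isClosed_closure isClosed_closure
        (fun v hv => (hmemA v hv).imp (fun h => subset_closure h) fun h => subset_closure h)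
        (hB.imp fun v hv => ⟨hv.elim fun _ h => h.elim fun h0 _ => h0, subset_closure hv⟩)
        (hA.imp fun v hv => ⟨hv.elim fun _ h => h.elim fun h0 _ => h0, subset_closure hv⟩)
      obtain ⟨v, hv0, hv1, hv2⟩ := this
      have h1 := hcl' 1 one_ne_zero v hv1 hv0
      have h2 := hcl' (-1) (by norm_num) v hv2 hv0
      obtain ⟨w, hw, -, e⟩ := exists_image_mk φ hv0
      linarith [hdir v w hv0 hw e _ h1, hdir v w hv0 hw e _ h2]
    · right
      intro ζ hζ
      obtain ⟨v, w, hv, hw, rfl, e⟩ := mem_lifts_grGraph.1 hζ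
      rcases hmemA v hv with h0 | h0
      · exact absurd ⟨v, h0⟩ hB
      · linarith [hdir v w hv hw e _ h0]
  · left
    intro ζ hζ
    obtain ⟨v, w, hv, hw, rfl, e⟩ := mem_lifts_grGraph.1 hζ
    rcases hmemA v hv with h0 | h0
    · linarith [hdir v w hv hw e _ h0]
    · exact absurd ⟨v, h0⟩ hA

lemma isBoundaryCone_of_grGraph {φ : RP1 ≃ₜ RP1} (h : OrientationPreserving ⇑φ)
    (hcl : ∀ (u : ℕ → Fin 4 → ℝ) (ζ : Fin 4 → ℝ), (∀ n, u n ∈ lifts (grGraph ⇑φ)) →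
      Tendsto u atTop (𝓝 ζ) → ζ ≠ 0 → ζ ∈ lifts (grGraph ⇑φ)) :
    IsBoundaryCone (lifts (grGraph ⇑φ)) where
  ne_zero := fun ζ hζ => hζ.1
  null := fun ζ hζ => by
    obtain ⟨v, w, hv, hw, rfl, -⟩ := mem_lifts_grGraph.1 hζ
    rw [qform_toBoundary]; simp only [det2]; ring
  smul_mem := fun ζ hζ c hc => by
    obtain ⟨v, w, hv, hw, rfl, e⟩ := mem_lifts_grGraph.1 hζ
    refine mem_lifts_grGraph.2 ⟨c • v, w, smul_ne_zero hc hv, hw, (toBoundary_smul_left _ _ _).symm,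
      ?_⟩
    rw [← e]
    congr 1
    exact (Projectivization.mk_eq_mk_iff' ℝ _ _ _ _).2 ⟨c, rfl⟩
  proportional := fun ζ hζ ξ hξ hq => by
    obtain ⟨v, w, hv, hw, rfl, e⟩ := mem_lifts_grGraph.1 hζ
    obtain ⟨v', w', hv', hw', rfl, e'⟩ := mem_lifts_grGraph.1 hξ
    rw [qform_toBoundary] at hq
    have hz : det2 v v' * det2 w w' = 0 := by linarith
    have hmk : Projectivization.mk ℝ v hv = Projectivization.mk ℝ v' hv' := by
      rcases mul_eq_zero.1 hz with h0 | h0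
      · exact mk_eq_mk_of_det2 hv hv' h0
      · apply φ.injective
        rw [e, e', mk_eq_mk_of_det2 hw hw' h0]
    have hmk' : Projectivization.mk ℝ w hw = Projectivization.mk ℝ w' hw' := by
      rw [← e, ← e', hmk]
    obtain ⟨c, hc, rfl⟩ := exists_smul_of_det2_eq_zero hv hv' (det2_eq_zero_of_mk_eq_mk _ _ hmk)
    obtain ⟨d, hd, rfl⟩ := exists_smul_of_det2_eq_zero hw hw' (det2_eq_zero_of_mk_eq_mk _ _ hmk')
    refine ⟨c * d, mul_ne_zero hc hd, ?_⟩
    ext i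
    fin_cases i <;> simp [toBoundary] <;> ring
  triple := fun ζ hζ ξ hξ η hη => by
    obtain ⟨v₁, w₁, hv₁, hw₁, rfl, e₁⟩ := mem_lifts_grGraph.1 hζ
    obtain ⟨v₂, w₂, hv₂, hw₂, rfl, e₂⟩ := mem_lifts_grGraph.1 hξ
    obtain ⟨v₃, w₃, hv₃, hw₃, rfl, e₃⟩ := mem_lifts_grGraph.1 hη
    have := h.det2_mul_nonneg hv₁ hv₂ hv₃ hw₁ hw₂ hw₃ e₁ e₂ e₃
    simp only [qform_toBoundary]
    nlinarith
  exists_three := by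
    have h1 : (![1, 0] : Fin 2 → ℝ) ≠ 0 := fun h => by simpa using congrFun h 0
    have h2 : (![0, 1] : Fin 2 → ℝ) ≠ 0 := fun h => by simpa using congrFun h 1
    have h3 : (![1, 1] : Fin 2 → ℝ) ≠ 0 := fun h => by simpa using congrFun h 0
    obtain ⟨w₁, hw₁, -, e₁⟩ := exists_image_mk φ h1
    obtain ⟨w₂, hw₂, -, e₂⟩ := exists_image_mk φ h2
    obtain ⟨w₃, hw₃, -, e₃⟩ := exists_image_mk φ h3
    have key : ∀ {v v' w w' : Fin 2 → ℝ} (hv : v ≠ 0) (hv' : v' ≠ 0) (hw : w ≠ 0) (hw' : w' ≠ 0),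
        φ (Projectivization.mk ℝ v hv) = Projectivization.mk ℝ w hw →
        φ (Projectivization.mk ℝ v' hv') = Projectivization.mk ℝ w' hw' → det2 v v' ≠ 0 →
        qform (toBoundary v w) (toBoundary v' w') ≠ 0 := by
      intro v v' w w' hv hv' hw hw' e e' hd hq
      rw [qform_toBoundary] at hq
      have hz : det2 w w' = 0 := by
        rcases mul_eq_zero.1 (by linarith : det2 v v' * det2 w w' = 0) with h0 | h0
        · exact absurd h0 hd
        · exact h0
      apply hd
      apply det2_eq_zero_of_mk_eq_mk hv hv'
      apply φ.injective
      rw [e, e', mk_eq_mk_of_det2 hw hw' hz]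
    refine ⟨_, mem_lifts_grGraph.2 ⟨_, _, h1, hw₁, rfl, e₁⟩, _,
      mem_lifts_grGraph.2 ⟨_, _, h2, hw₂, rfl, e₂⟩, _, mem_lifts_grGraph.2 ⟨_, _, h3, hw₃, rfl, e₃⟩,
      key _ _ _ _ e₁ e₂ ?_, key _ _ _ _ e₂ e₃ ?_, key _ _ _ _ e₃ e₁ ?_⟩ <;> simp [det2]
  mem_of_tendsto := hcl
  sign := grGraph_sign hcl

/-! ### The closure of an entire surface -/

lemma mem_lifts_closure {A : Set RP3} {u : ℕ → Fin 4 → ℝ} {x : Fin 4 → ℝ}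
    (hu : ∀ᶠ n in atTop, u n ∈ lifts A) (h : Tendsto u atTop (𝓝 x)) (hx : x ≠ 0) :
    x ∈ lifts (closure A) := by
  obtain ⟨m, hm⟩ := eventually_atTop.1 hu
  have hmem : ∀ n, u (n + m) ∈ lifts A := fun n => hm _ (Nat.le_add_left m n)
  let w : ℕ → {v : Fin 4 → ℝ // v ≠ 0} := fun n => ⟨u (n + m), (hmem n).1⟩
  have hw : Tendsto w atTop (𝓝 ⟨x, hx⟩) :=
    tendsto_subtype_rng.2 (h.comp (tendsto_add_atTop_nat m))
  exact ⟨hx, mem_closure_of_tendsto ((continuous_projMk.tendsto _).comp hw)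
    (Eventually.of_forall fun n => (hmem n).2)⟩

lemma qform_self_of_projPt_eq {x z : Fin 4 → ℝ} (hx : x ≠ 0) (hz : z ≠ 0)
    (h : projPt x hx = projPt z hz) : ∃ c : ℝ, c ≠ 0 ∧ x = c • z := by
  obtain ⟨c, hc⟩ := (Projectivization.mk_eq_mk_iff' ℝ _ _ hx hz).1 h
  exact ⟨c, fun h0 => hx (by rw [← hc, h0, zero_smul]), hc.symm⟩

lemma mem_lifts_bdryAdS3 {x : Fin 4 → ℝ} (h : x ∈ lifts bdryAdS3) : qform x x = 0 := by
  obtain ⟨hx, h⟩ := h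
  obtain ⟨a, ha⟩ := Projectivization.exists_smul_eq_mk_rep ℝ x hx
  change qform (Projectivization.mk ℝ x hx).rep (Projectivization.mk ℝ x hx).rep = 0 at h
  rw [← ha, Units.smul_def, qform_smul_left, qform_smul_right] at h
  simpa using h

namespace SpacelikeSurface

variable (S : SpacelikeSurface)

lemma emb_ne_zero (y : Fin 2 → ℝ) : S.emb y ≠ 0 := fun h => by
  have := S.on_quadric y
  rw [h, qform_zero_left] at this
  norm_num at this

/-- The preimage of the surface in the quadric `{⟨x, x⟩ = -1}`. -/
def cover : Set (Fin 4 → ℝ) := {x | ∃ y, x = S.emb y ∨ x = -S.emb y}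

lemma mem_lifts_proj {x : Fin 4 → ℝ} : x ∈ lifts S.proj ↔ ∃ y, ∃ c : ℝ, c ≠ 0 ∧ x = c • S.emb y := by
  constructor
  · rintro ⟨hx, y, hy, h⟩
    obtain ⟨c, hc, h⟩ := qform_self_of_projPt_eq hx hy h.symm
    exact ⟨y, c, hc, h⟩
  · rintro ⟨y, c, hc, rfl⟩
    exact ⟨smul_ne_zero hc (S.emb_ne_zero y), y, S.emb_ne_zero y,
      ((Projectivization.mk_eq_mk_iff' ℝ _ _ _ _).2 ⟨c, rfl⟩).symm⟩

lemma emb_mem_cover (y : Fin 2 → ℝ) : S.emb y ∈ S.cover := ⟨y, Or.inl rfl⟩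

variable {S}

lemma qform_cover {x : Fin 4 → ℝ} (h : x ∈ S.cover) : qform x x = -1 := by
  obtain ⟨y, rfl | rfl⟩ := h
  · exact S.on_quadric y
  · rw [qform_neg_left, qform_neg_right, neg_neg, S.on_quadric]

lemma smul_mem_lifts_proj {x : Fin 4 → ℝ} (h : x ∈ S.cover) {c : ℝ} (hc : c ≠ 0) :
    c • x ∈ lifts S.proj := by
  obtain ⟨y, rfl | rfl⟩ := h
  · exact S.mem_lifts_proj.2 ⟨y, c, hc, rfl⟩
  · exact S.mem_lifts_proj.2 ⟨y, -c, neg_ne_zero.2 hc, by simp⟩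

lemma mem_lifts_bdry_of_null {x : Fin 4 → ℝ} (h : x ∈ lifts (closure S.proj))
    (h0 : qform x x = 0) : x ∈ lifts S.bdryAtInfinity := by
  refine ⟨h.1, h.2, fun hp => ?_⟩
  obtain ⟨y, c, hc, rfl⟩ := S.mem_lifts_proj.1 ⟨h.1, hp⟩
  rw [qform_smul_left, qform_smul_right, S.on_quadric] at h0
  have : c * c = 0 := by linarith
  exact hc (mul_self_eq_zero.1 this)

lemma IsEntire.isClosed_cover (hE : S.IsEntire) : IsClosed S.cover := by
  refine isClosed_of_closure_subset fun x hx => ?_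
  obtain ⟨u, hu, hlim⟩ := mem_closure_iff_seq_limit.1 hx
  have hq : qform x x = -1 :=
    tendsto_nhds_unique (((continuous_id.qform continuous_id).tendsto x).comp hlim)
      (tendsto_const_nhds.congr fun n => (qform_cover (hu n)).symm)
  have hx0 : x ≠ 0 := fun h => by rw [h, qform_zero_left] at hq; norm_num at hq
  have hcl := mem_lifts_closure (A := S.proj) (Eventually.of_forall fun n => by
    simpa using smul_mem_lifts_proj (hu n) one_ne_zero) hlim hx0
  have hp : x ∈ lifts S.proj := by
    refine ⟨hx0, ?_⟩
    by_contra hn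
    have := mem_lifts_bdryAdS3 ⟨hx0, hE ⟨hcl.2, hn⟩⟩
    linarith
  obtain ⟨y, c, hc, rfl⟩ := S.mem_lifts_proj.1 hp
  rw [qform_smul_left, qform_smul_right, S.on_quadric] at hq
  have : c * c = 1 := by linarith
  rcases mul_self_eq_one_iff.1 this with rfl | rfl
  · exact ⟨y, Or.inl (one_smul _ _)⟩
  · exact ⟨y, Or.inr (by simp)⟩

lemma mem_lifts_bdry_of_tendsto {Z : ℕ → Fin 4 → ℝ} {c : ℕ → ℝ} {x : Fin 4 → ℝ}
    (hZ : ∀ n, Z n ∈ S.cover) (hc : Tendsto c atTop (𝓝 0))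
    (h : Tendsto (fun n => c n • Z n) atTop (𝓝 x)) (hx : x ≠ 0) :
    x ∈ lifts S.bdryAtInfinity := by
  have hq : qform x x = 0 := by
    refine tendsto_nhds_unique (((continuous_id.qform continuous_id).tendsto x).comp h) ?_
    have : Tendsto (fun n => c n * c n * (-1)) atTop (𝓝 (0 * 0 * (-1))) :=
      (hc.mul hc).mul_const _
    rw [zero_mul, zero_mul] at this
    refine this.congr fun n => ?_
    simp only [Function.comp_apply, id, qform_smul_left, qform_smul_right, qform_cover (hZ n)]
    ring
  refine mem_lifts_bdry_of_null (mem_lifts_closure ?_ h hx) hq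
  filter_upwards [h.eventually_ne hx] with n hn
  exact smul_mem_lifts_proj (hZ n) fun h0 => hn (by rw [h0, zero_smul])

lemma IsEntire.mem_lifts_bdry_of_tendsto (hE : S.IsEntire) (u : ℕ → Fin 4 → ℝ) (ζ : Fin 4 → ℝ)
    (hu : ∀ n, u n ∈ lifts S.bdryAtInfinity) (h : Tendsto u atTop (𝓝 ζ)) (hζ : ζ ≠ 0) :
    ζ ∈ lifts S.bdryAtInfinity := by
  have hq : qform ζ ζ = 0 :=
    tendsto_nhds_unique (((continuous_id.qform continuous_id).tendsto ζ).comp h)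
      (tendsto_const_nhds.congr fun n => (mem_lifts_bdryAdS3 ⟨(hu n).1, hE (hu n).2⟩).symm)
  refine mem_lifts_bdry_of_null ?_ hq
  have := mem_lifts_closure (A := closure S.proj)
    (Eventually.of_forall fun n => ⟨(hu n).1, (hu n).2.1⟩) h hζ
  rwa [closure_closure] at this

/-! ### Spacelike lines through points of the surface -/

/-- The component of the spacelike part along `(U 0, U 1)`. -/
def along (U : Fin 2 → ℝ) (x : Fin 4 → ℝ) : ℝ := U 0 * x 0 + U 1 * x 1

/-- The component of the spacelike part orthogonal to `(U 0, U 1)`. -/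
def across (U : Fin 2 → ℝ) (x : Fin 4 → ℝ) : ℝ := -U 1 * x 0 + U 0 * x 1

lemma qform_eq_along_across {U : Fin 2 → ℝ} (hU : U 0 ^ 2 + U 1 ^ 2 = 1) (x z : Fin 4 → ℝ) :
    qform x z = along U x * along U z + across U x * across U z - x 2 * z 2 - x 3 * z 3 := by
  simp only [qform, along, across]
  linear_combination (-(x 0 * z 0) - x 1 * z 1) * hU

lemma along_sub (U : Fin 2 → ℝ) (x z : Fin 4 → ℝ) : along U (x - z) = along U x - along U z := by
  simp only [along, Pi.sub_apply]; ring

lemma across_sub (U : Fin 2 → ℝ) (x z : Fin 4 → ℝ) :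
    across U (x - z) = across U x - across U z := by
  simp only [across, Pi.sub_apply]; ring

lemma along_smul (U : Fin 2 → ℝ) (c : ℝ) (x : Fin 4 → ℝ) : along U (c • x) = c * along U x := by
  simp only [along, Pi.smul_apply, smul_eq_mul]; ring

lemma across_smul (U : Fin 2 → ℝ) (c : ℝ) (x : Fin 4 → ℝ) :
    across U (c • x) = c * across U x := by
  simp only [across, Pi.smul_apply, smul_eq_mul]; ring

lemma continuous_along (U : Fin 2 → ℝ) : Continuous (along U) := by
  unfold along; fun_prop

lemma continuous_across (U : Fin 2 → ℝ) : Continuous (across U) := by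
  unfold across; fun_prop

/-- The projection of `ℝ⁴` to the spacelike plane, as a map to `ℝ²`. -/
def planeProj (U : Fin 2 → ℝ) : (Fin 4 → ℝ) →L[ℝ] (Fin 2 → ℝ) :=
  LinearMap.toContinuousLinearMap
    { toFun := fun x => ![across U x, along U x]
      map_add' := fun x z => by ext i; fin_cases i <;> simp [along, across] <;> ring
      map_smul' := fun c x => by ext i; fin_cases i <;> simp [along, across] <;> ring }

lemma planeProj_apply (U : Fin 2 → ℝ) (x : Fin 4 → ℝ) :
    planeProj U x = ![across U x, along U x] := rfl

variable (S) in
lemma exists_curve {U : Fin 2 → ℝ} (hU : U 0 ^ 2 + U 1 ^ 2 = 1) (y : Fin 2 → ℝ) :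
    ∃ γ : ℝ → (Fin 2 → ℝ), ∀ᶠ s in 𝓝[≠] (0 : ℝ), across U (S.emb (γ s)) = across U (S.emb y) ∧
      along U (S.emb (γ s)) = along U (S.emb y) + s ∧
      0 < qform (S.emb (γ s) - S.emb y) (S.emb (γ s) - S.emb y) := by
  have hX : HasStrictFDerivAt S.emb (fderiv ℝ S.emb y) y :=
    S.contDiff_emb.contDiffAt.hasStrictFDerivAt (by simp)
  have hP : HasStrictFDerivAt (fun y => planeProj U (S.emb y))
      ((planeProj U).comp (fderiv ℝ S.emb y)) y := (planeProj U).hasStrictFDerivAt.comp y hX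
  have hinj : Function.Injective ((planeProj U).comp (fderiv ℝ S.emb y)) := by
    rw [injective_iff_map_eq_zero]
    intro v hv
    by_contra hv0
    have h := S.spacelike y v hv0
    have h0 : ![across U (fderiv ℝ S.emb y v), along U (fderiv ℝ S.emb y v)] = 0 := hv
    have h1 : across U (fderiv ℝ S.emb y v) = 0 := congrFun h0 0
    have h2 : along U (fderiv ℝ S.emb y v) = 0 := congrFun h0 1
    rw [qform_eq_along_across hU, h1, h2] at h
    nlinarith [mul_self_nonneg (fderiv ℝ S.emb y v 2), mul_self_nonneg (fderiv ℝ S.emb y v 3)]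
  let e : (Fin 2 → ℝ) ≃L[ℝ] (Fin 2 → ℝ) := (LinearEquiv.ofInjectiveEndo
    ((planeProj U).comp (fderiv ℝ S.emb y)).toLinearMap hinj).toContinuousLinearEquiv
  have he : (e : (Fin 2 → ℝ) →L[ℝ] (Fin 2 → ℝ)) = (planeProj U).comp (fderiv ℝ S.emb y) := rfl
  rw [← he] at hP
  let line : ℝ → Fin 2 → ℝ := fun s => planeProj U (S.emb y) + s • ![0, 1]
  have hline0 : line 0 = planeProj U (S.emb y) := by
    change _ + (0 : ℝ) • _ = _
    rw [zero_smul, add_zero]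
  have hline : HasDerivAt line ![0, 1] 0 := by
    have := ((hasDerivAt_id (0 : ℝ)).smul_const (![0, 1] : Fin 2 → ℝ)).const_add
      (planeProj U (S.emb y))
    rwa [one_smul] at this
  have hinv : HasFDerivAt (hP.localInverse _ e y) (e.symm : (Fin 2 → ℝ) →L[ℝ] (Fin 2 → ℝ))
      (line 0) := by
    rw [hline0]; exact hP.to_localInverse.hasFDerivAt
  have hγ : HasDerivAt (fun s => hP.localInverse _ e y (line s)) (e.symm ![0, 1]) 0 :=
    hinv.comp_hasDerivAt 0 hline
  have hγ0 : hP.localInverse _ e y (line 0) = y := by rw [hline0]; exact hP.localInverse_apply_image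
  have hemb : HasDerivAt (fun s => S.emb (hP.localInverse _ e y (line s)))
      (fderiv ℝ S.emb y (e.symm ![0, 1])) 0 := by
    have h : HasFDerivAt S.emb (fderiv ℝ S.emb y) (hP.localInverse _ e y (line 0)) := by
      rw [hγ0]; exact hX.hasFDerivAt
    exact h.comp_hasDerivAt 0 hγ
  have hne : e.symm ![0, 1] ≠ 0 := by
    intro h
    rw [ContinuousLinearEquiv.map_eq_zero_iff] at h
    simpa using congrFun h 1
  refine ⟨fun s => hP.localInverse _ e y (line s), ?_⟩
  have h1 : ∀ᶠ s in 𝓝[≠] (0 : ℝ), planeProj U (S.emb (hP.localInverse _ e y (line s))) = line s := by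
    apply Filter.Eventually.filter_mono nhdsWithin_le_nhds
    have := hP.eventually_right_inverse
    rw [← hline0] at this
    exact hline.continuousAt.eventually this
  have h2 : ∀ᶠ s in 𝓝[≠] (0 : ℝ), 0 < qform
      (slope (fun s => S.emb (hP.localInverse _ e y (line s))) 0 s)
      (slope (fun s => S.emb (hP.localInverse _ e y (line s))) 0 s) :=
    (((continuous_id.qform continuous_id).tendsto _).comp hemb.tendsto_slope).eventually_const_lt
      (S.spacelike y _ hne)
  filter_upwards [h1, h2, self_mem_nhdsWithin] with s hs hs2 hs0
  have hs0' : s ≠ 0 := hs0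
  have e0 := congrFun hs 0
  have e1 := congrFun hs 1
  simp only [planeProj_apply, line, Pi.add_apply, Pi.smul_apply, Matrix.cons_val_zero,
    Matrix.cons_val_one, smul_eq_mul, mul_zero, add_zero, mul_one] at e0 e1
  refine ⟨e0, e1, ?_⟩
  rw [slope_def_module, sub_zero, qform_smul_left, qform_smul_right, hγ0, ← mul_assoc] at hs2
  exact (pos_iff_pos_of_mul_pos hs2).1 (mul_self_pos.2 (inv_ne_zero hs0'))

end SpacelikeSurface

namespace SpacelikeSurface

variable {S : SpacelikeSurface}

lemma exists_later {U : Fin 2 → ℝ} (hU : U 0 ^ 2 + U 1 ^ 2 = 1) {Y : Fin 4 → ℝ}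
    (hY : Y ∈ S.cover) : ∃ Z ∈ S.cover, across U Z = across U Y ∧ along U Y < along U Z ∧
      (Z 2 - Y 2) ^ 2 + (Z 3 - Y 3) ^ 2 < (along U Z - along U Y) ^ 2 := by
  obtain ⟨y, hy⟩ := hY
  obtain ⟨γ, hγ⟩ := S.exists_curve hU y
  have hr : ∃ s : ℝ, 0 < s ∧ across U (S.emb (γ s)) = across U (S.emb y) ∧
      along U (S.emb (γ s)) = along U (S.emb y) + s ∧
      0 < qform (S.emb (γ s) - S.emb y) (S.emb (γ s) - S.emb y) :=
    (((hγ.filter_mono (nhdsGT_le_nhdsNE 0)).and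
      self_mem_nhdsWithin).exists).imp fun s hs => ⟨hs.2, hs.1⟩
  have hl : ∃ s : ℝ, s < 0 ∧ across U (S.emb (γ s)) = across U (S.emb y) ∧
      along U (S.emb (γ s)) = along U (S.emb y) + s ∧
      0 < qform (S.emb (γ s) - S.emb y) (S.emb (γ s) - S.emb y) :=
    (((hγ.filter_mono (nhdsLT_le_nhdsNE 0)).and
      self_mem_nhdsWithin).exists).imp fun s hs => ⟨hs.2, hs.1⟩
  rcases hy with rfl | rfl
  · obtain ⟨s, hs, h1, h2, h3⟩ := hr
    refine ⟨S.emb (γ s), ⟨_, Or.inl rfl⟩, h1, by linarith, ?_⟩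
    rw [qform_eq_along_across hU, across_sub, h1, sub_self, along_sub] at h3
    simp only [Pi.sub_apply] at h3
    nlinarith
  · obtain ⟨s, hs, h1, h2, h3⟩ := hl
    have hn : ∀ x : Fin 4 → ℝ, across U (-x) = -across U x ∧ along U (-x) = -along U x := fun x => by
      constructor <;> simp only [across, along, Pi.neg_apply] <;> ring
    refine ⟨-S.emb (γ s), ⟨_, Or.inr rfl⟩, by rw [(hn _).1, (hn _).1, h1], ?_, ?_⟩
    · rw [(hn _).2, (hn _).2]; linarith
    · rw [qform_eq_along_across hU, across_sub, h1, sub_self, along_sub] at h3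
      simp only [Pi.sub_apply] at h3
      rw [(hn _).2, (hn _).2]
      simp only [Pi.neg_apply]
      nlinarith

/-- The points of the surface in the future half of a lightcone in a Lorentzian 3-space. -/
def later (S : SpacelikeSurface) (U : Fin 2 → ℝ) (Y : Fin 4 → ℝ) : Set (Fin 4 → ℝ) :=
  {Z | Z ∈ S.cover ∧ across U Z = across U Y ∧ along U Y ≤ along U Z ∧
    (Z 2 - Y 2) ^ 2 + (Z 3 - Y 3) ^ 2 ≤ (along U Z - along U Y) ^ 2}

lemma IsEntire.isClosed_later (hE : S.IsEntire) (U : Fin 2 → ℝ) (Y : Fin 4 → ℝ) :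
    IsClosed (S.later U Y) := by
  have h1 := continuous_along U
  have h2 := continuous_across U
  have h3 : IsClosed {Z : Fin 4 → ℝ |
      (Z 2 - Y 2) ^ 2 + (Z 3 - Y 3) ^ 2 ≤ (along U Z - along U Y) ^ 2} :=
    isClosed_le (by fun_prop) (by fun_prop)
  exact hE.isClosed_cover.inter ((isClosed_eq h2 continuous_const).inter
    ((isClosed_le continuous_const h1).inter h3))

lemma sq_add_sq_le_of_cone {a b c d s t : ℝ} (hs : 0 ≤ s) (ht : 0 ≤ t) (h1 : a ^ 2 + b ^ 2 ≤ s ^ 2)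
    (h2 : c ^ 2 + d ^ 2 ≤ t ^ 2) : a * c + b * d ≤ s * t := by
  have : (a * c + b * d) ^ 2 ≤ (s * t) ^ 2 := by
    have h3 : (a * c + b * d) ^ 2 ≤ (a ^ 2 + b ^ 2) * (c ^ 2 + d ^ 2) := by
      nlinarith [sq_nonneg (a * d - b * c)]
    have h4 : (a ^ 2 + b ^ 2) * (c ^ 2 + d ^ 2) ≤ s ^ 2 * t ^ 2 :=
      mul_le_mul h1 h2 (by positivity) (by positivity)
    linarith [mul_pow s t 2]
  exact (abs_le.1 (abs_le_of_sq_le_sq this (mul_nonneg hs ht))).2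

lemma mem_later_trans {U : Fin 2 → ℝ} {X Y Z : Fin 4 → ℝ} (h1 : Y ∈ S.later U X)
    (h2 : Z ∈ S.later U Y) : Z ∈ S.later U X := by
  obtain ⟨-, a1, b1, c1⟩ := h1
  obtain ⟨hZ, a2, b2, c2⟩ := h2
  refine ⟨hZ, a2.trans a1, b1.trans b2, ?_⟩
  have := sq_add_sq_le_of_cone (sub_nonneg.2 b1) (sub_nonneg.2 b2) c1 c2
  nlinarith

/-- Coordinates of `ℝ⁴` are controlled by the adapted ones. -/
lemma norm_le_of_along {U : Fin 2 → ℝ} (hU : U 0 ^ 2 + U 1 ^ 2 = 1) {Z : Fin 4 → ℝ} {R : ℝ}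
    (h0 : |along U Z| ≤ R) (h1 : |across U Z| ≤ R) (h2 : |Z 2| ≤ R) (h3 : |Z 3| ≤ R) :
    ‖Z‖ ≤ 2 * R := by
  have hR : 0 ≤ R := (abs_nonneg _).trans h0
  have e : Z 0 ^ 2 + Z 1 ^ 2 = along U Z ^ 2 + across U Z ^ 2 := by
    simp only [along, across]; linear_combination (-(Z 0 ^ 2) - Z 1 ^ 2) * hU
  have k0 := sq_le_sq' (abs_le.1 h0).1 (abs_le.1 h0).2
  have k1 := sq_le_sq' (abs_le.1 h1).1 (abs_le.1 h1).2
  refine (pi_norm_le_iff_of_nonneg (by linarith)).2 fun i => ?_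
  rw [Real.norm_eq_abs]
  fin_cases i
  · exact abs_le_of_sq_le_sq (a := Z 0) (by nlinarith [sq_nonneg (Z 1)]) (by linarith)
  · exact abs_le_of_sq_le_sq (a := Z 1) (by nlinarith [sq_nonneg (Z 0)]) (by linarith)
  · exact h2.trans (by linarith)
  · exact h3.trans (by linarith)

lemma later_norm_le {U : Fin 2 → ℝ} (hU : U 0 ^ 2 + U 1 ^ 2 = 1) (Y : Fin 4 → ℝ) :
    ∃ C : ℝ, 0 < C ∧ ∀ Z ∈ S.later U Y, ‖Z‖ ≤ C + 2 * |along U Z| := by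
  refine ⟨2 * (|along U Y| + |across U Y| + |Y 2| + |Y 3| + 1), by positivity, fun Z hZ => ?_⟩
  obtain ⟨-, h1, h2, h3⟩ := hZ
  have hs := sub_nonneg.2 h2
  have k2 := abs_le.1 <| abs_le_of_sq_le_sq (show (Z 2 - Y 2) ^ 2 ≤ (along U Z - along U Y) ^ 2 by
    nlinarith [sq_nonneg (Z 3 - Y 3)]) hs
  have k3 := abs_le.1 <| abs_le_of_sq_le_sq (show (Z 3 - Y 3) ^ 2 ≤ (along U Z - along U Y) ^ 2 by
    nlinarith [sq_nonneg (Z 2 - Y 2)]) hs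
  have b0 := abs_nonneg (along U Y)
  have b1 := abs_nonneg (across U Y)
  have b2 := abs_nonneg (Y 2)
  have b3 := abs_nonneg (Y 3)
  have b4 := abs_nonneg (along U Z)
  have := norm_le_of_along hU (Z := Z)
    (R := |along U Y| + |across U Y| + |Y 2| + |Y 3| + 1 + |along U Z|) (by linarith)
    (by rw [h1]; linarith)
    (abs_le.2 ⟨by linarith [neg_abs_le (Y 2), le_abs_self (along U Z), neg_abs_le (along U Y)],
      by linarith [le_abs_self (Y 2), le_abs_self (along U Z), neg_abs_le (along U Y)]⟩)
    (abs_le.2 ⟨by linarith [neg_abs_le (Y 3), le_abs_self (along U Z), neg_abs_le (along U Y)],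
      by linarith [le_abs_self (Y 3), le_abs_self (along U Z), neg_abs_le (along U Y)]⟩)
  linarith

lemma IsEntire.exists_later_gt (hE : S.IsEntire) {U : Fin 2 → ℝ} (hU : U 0 ^ 2 + U 1 ^ 2 = 1)
    {Y : Fin 4 → ℝ} (hY : Y ∈ S.cover) (R : ℝ) : ∃ Z ∈ S.later U Y, R < along U Z := by
  by_contra! hR
  have hYY : Y ∈ S.later U Y := ⟨hY, rfl, le_rfl, by simp⟩
  obtain ⟨C, -, hC⟩ := later_norm_le (S := S) hU Y
  have hK : IsCompact (S.later U Y) := by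
    refine Metric.isCompact_of_isClosed_isBounded (hE.isClosed_later U Y)
      (isBounded_iff_forall_norm_le.2 ⟨C + 2 * max |along U Y| |R|, fun Z hZ => ?_⟩)
    have : |along U Z| ≤ max |along U Y| |R| := abs_le_max_abs_abs hZ.2.2.1 (hR Z hZ)
    linarith [hC Z hZ]
  obtain ⟨Z, hZ, hmax⟩ := hK.exists_isMaxOn ⟨Y, hYY⟩ (continuous_along U).continuousOn
  obtain ⟨W, hW, h1, h2, h3⟩ := exists_later hU hZ.1
  exact absurd (hmax (mem_later_trans hZ ⟨hW, h1, h2.le, h3.le⟩)) (not_le.2 h2)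

lemma IsEntire.exists_ideal (hE : S.IsEntire) {U : Fin 2 → ℝ} (hU : U 0 ^ 2 + U 1 ^ 2 = 1)
    {X : Fin 4 → ℝ} (hX : X ∈ S.cover) :
    ∃ e ∈ lifts S.bdryAtInfinity, along U e = 1 ∧ across U e = 0 ∧ qform X e < 0 := by
  obtain ⟨Y, hY, y1, y2, y3⟩ := exists_later hU hX
  obtain ⟨C, hC0, hC⟩ := later_norm_le (S := S) hU Y
  choose Z hZ hgt using fun n : ℕ => hE.exists_later_gt hU hY (n + 1)
  have hpos : ∀ n, 0 < along U (Z n) := fun n => lt_trans (by positivity) (hgt n)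
  have hbdd : ∀ n, (along U (Z n))⁻¹ • Z n ∈ Metric.closedBall (0 : Fin 4 → ℝ) (C + 2) := by
    intro n
    rw [mem_closedBall_zero_iff, norm_smul, norm_inv, Real.norm_eq_abs, abs_of_pos (hpos n),
      inv_mul_le_iff₀ (hpos n)]
    have := hC _ (hZ n)
    rw [abs_of_pos (hpos n)] at this
    have h1 : (1 : ℝ) ≤ along U (Z n) := le_trans (by simp) (hgt n).le
    nlinarith
  obtain ⟨e, -, ψ, hψ, hlim⟩ := (isCompact_closedBall _ _).tendsto_subseq hbdd
  have hinv : Tendsto (fun n => (along U (Z n))⁻¹) atTop (𝓝 0) := by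
    refine tendsto_inv_atTop_zero.comp (tendsto_atTop_mono (fun n => (hgt n).le) ?_)
    exact tendsto_atTop_add_const_right _ _ tendsto_natCast_atTop_atTop
  have hinv' := hinv.comp hψ.tendsto_atTop
  have ha : along U e = 1 := by
    refine tendsto_nhds_unique (((continuous_along U).tendsto e).comp hlim)
      (tendsto_const_nhds.congr fun n => ?_)
    simp only [Function.comp_apply]
    rw [along_smul, inv_mul_cancel₀ (hpos _).ne']
  have hb : across U e = 0 := by
    refine tendsto_nhds_unique (((continuous_across U).tendsto e).comp hlim) ?_
    have := hinv'.mul_const (across U Y)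
    rw [zero_mul] at this
    refine this.congr fun n => ?_
    simp only [Function.comp_apply]
    rw [across_smul, (hZ _).2.1]
  have he0 : e ≠ 0 := fun h => by simp [h, along] at ha
  have heΓ : e ∈ lifts S.bdryAtInfinity :=
    SpacelikeSurface.mem_lifts_bdry_of_tendsto (fun n => (hZ (ψ n)).1) hinv' hlim he0
  refine ⟨e, heΓ, ha, hb, ?_⟩
  have hnull : qform e e = 0 := mem_lifts_bdryAdS3 ⟨he0, hE heΓ.2⟩
  have key : ∀ W ∈ S.later U Y, 0 ≤ -qform X W - (along U Y - along U X) * (along U W - along U Y)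
      + (Y 2 - X 2) * (W 2 - Y 2) + (Y 3 - X 3) * (W 3 - Y 3) := by
    rintro W ⟨hW, w1, w2, w3⟩
    have h1 := qform_cover hX
    have h2 := qform_cover hW
    have h3 : qform (W - X) (W - X) = -2 - 2 * qform X W := by
      rw [qform_sub_left, qform_sub_right, qform_sub_right, h1, h2, qform_comm W X]; ring
    rw [qform_eq_along_across hU, across_sub, along_sub, w1, y1] at h3
    simp only [Pi.sub_apply] at h3
    nlinarith
  have hlim2 : 0 ≤ -qform X e - (along U Y - along U X) * along U e
      + (Y 2 - X 2) * e 2 + (Y 3 - X 3) * e 3 := by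
    have hcont : Continuous fun W : Fin 4 → ℝ => -qform X W - (along U Y - along U X) * along U W
        + (Y 2 - X 2) * W 2 + (Y 3 - X 3) * W 3 := by
      have := continuous_along U
      have := (continuous_const (y := X)).qform continuous_id
      simp only [id] at this
      fun_prop
    have h2 := ((hcont.tendsto e).comp hlim).add
      (hinv'.mul_const ((along U Y - along U X) * along U Y - (Y 2 - X 2) * Y 2
        - (Y 3 - X 3) * Y 3))
    rw [zero_mul, add_zero] at h2
    refine ge_of_tendsto' h2 fun n => ?_
    have := mul_nonneg (inv_nonneg.2 (hpos (ψ n)).le) (key _ (hZ (ψ n)))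
    simp only [Function.comp_apply, along_smul, qform_smul_right, Pi.smul_apply, smul_eq_mul]
    linarith
  rw [qform_eq_along_across hU, ha, hb] at hnull
  rw [ha] at hlim2
  have hcs : ((Y 2 - X 2) * e 2 + (Y 3 - X 3) * e 3) ^ 2 < (along U Y - along U X) ^ 2 := by
    have : ((Y 2 - X 2) * e 2 + (Y 3 - X 3) * e 3) ^ 2
        ≤ ((Y 2 - X 2) ^ 2 + (Y 3 - X 3) ^ 2) * (e 2 * e 2 + e 3 * e 3) := by
      nlinarith [sq_nonneg ((Y 2 - X 2) * e 3 - (Y 3 - X 3) * e 2)]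
    have h1 : e 2 * e 2 + e 3 * e 3 = 1 := by linarith
    rw [h1, mul_one] at this
    linarith
  have := abs_lt.1 (abs_lt_of_sq_lt_sq hcs (by linarith))
  linarith [this.2]

/-- A spacelike entire surface is disjoint from the lightlike planes tangent at its boundary. -/
lemma IsEntire.qform_ne_zero (hE : S.IsEntire) (hΛ : IsBoundaryCone (lifts S.bdryAtInfinity))
    {X ζ : Fin 4 → ℝ} (hX : X ∈ S.cover) (hζ : ζ ∈ lifts S.bdryAtInfinity) : qform X ζ ≠ 0 := by
  intro hXζ
  have hnull := hΛ.null ζ hζ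
  set r := √(ζ 0 ^ 2 + ζ 1 ^ 2) with hr
  have hr2 : r ^ 2 = ζ 0 ^ 2 + ζ 1 ^ 2 := Real.sq_sqrt (by positivity)
  have hr0 : 0 < r := by
    refine lt_of_le_of_ne (Real.sqrt_nonneg _) fun h => hζ.1 ?_
    rw [← h] at hr2
    simp only [qform] at hnull
    have h0 : ζ 0 = 0 := by nlinarith [sq_nonneg (ζ 0), sq_nonneg (ζ 1)]
    have h1 : ζ 1 = 0 := by nlinarith [sq_nonneg (ζ 0), sq_nonneg (ζ 1)]
    have h2 : ζ 2 = 0 := by nlinarith [sq_nonneg (ζ 2), sq_nonneg (ζ 3)]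
    have h3 : ζ 3 = 0 := by nlinarith [sq_nonneg (ζ 2), sq_nonneg (ζ 3)]
    ext i; fin_cases i <;> assumption
  let U : Fin 2 → ℝ := ![ζ 0 / r, ζ 1 / r]
  have hU : U 0 ^ 2 + U 1 ^ 2 = 1 := by simp [U]; field_simp; linarith
  have hUn : (-U) 0 ^ 2 + (-U) 1 ^ 2 = 1 := by simpa using hU
  have haζ : along U ζ = r := by simp [along, U]; field_simp; linarith
  have hbζ : across U ζ = 0 := by simp [across, U]; ring
  obtain ⟨e, he, e1, e2, e3⟩ := hE.exists_ideal hU hX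
  obtain ⟨d, hd, d1, d2, d3⟩ := hE.exists_ideal hUn hX
  have d1' : along U d = -1 := by
    simp only [along, Pi.neg_apply] at d1 ⊢; linarith
  have d2' : across U d = 0 := by
    simp only [across, Pi.neg_apply] at d2 ⊢; linarith
  have hne : ∀ x ∈ lifts S.bdryAtInfinity, qform X x < 0 → qform ζ x ≠ 0 := by
    intro x hx hXx h0
    obtain ⟨c, hc, rfl⟩ := hΛ.proportional ζ hζ x hx h0
    rw [qform_smul_right, hXζ] at hXx
    simp at hXx
  have hee := hΛ.null e he
  have hdd := hΛ.null d hd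
  have hζe := hne e he e3
  have hζd := hne d hd d3
  have ht := hΛ.triple ζ hζ e he d hd
  rw [qform_comm d ζ] at ht
  rw [qform_eq_along_across hU] at hee hdd hnull
  rw [e1, e2] at hee
  rw [d1', d2'] at hdd
  rw [haζ, hbζ] at hnull
  have hee' : e 2 ^ 2 + e 3 ^ 2 = 1 := by linarith [sq (e 2), sq (e 3)]
  have hdd' : d 2 ^ 2 + d 3 ^ 2 = 1 := by linarith [sq (d 2), sq (d 3)]
  have hζ' : ζ 2 ^ 2 + ζ 3 ^ 2 = r ^ 2 := by linarith [sq (ζ 2), sq (ζ 3), sq r]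
  have p1 : 0 < qform ζ e := by
    refine lt_of_le_of_ne ?_ hζe.symm
    rw [qform_eq_along_across hU, haζ, e1, hbζ]
    have := sq_add_sq_le_of_cone (a := ζ 2) (b := ζ 3) (c := e 2) (d := e 3) (s := r) (t := 1)
      hr0.le zero_le_one (by simpa using hζ'.le) (by simpa using hee'.le)
    linarith
  have p2 : qform ζ d < 0 := by
    refine lt_of_le_of_ne ?_ hζd
    rw [qform_eq_along_across hU, haζ, d1', hbζ]
    have := sq_add_sq_le_of_cone (a := -ζ 2) (b := -ζ 3) (c := d 2) (d := d 3) (s := r) (t := 1)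
      hr0.le zero_le_one (by simpa using hζ'.le) (by simpa using hdd'.le)
    linarith
  have p3 : qform e d ≤ 0 := by
    rw [qform_eq_along_across hU, e1, d1', e2]
    have := sq_add_sq_le_of_cone (a := -e 2) (b := -e 3) (c := d 2) (d := d 3) (s := 1) (t := 1)
      zero_le_one zero_le_one (by simpa using hee'.le) (by simpa using hdd'.le)
    linarith
  have hz : qform e d = 0 := by
    by_contra h
    have p3' : qform e d < 0 := lt_of_le_of_ne p3 h
    have := mul_pos_of_neg_of_neg (mul_neg_of_pos_of_neg p1 p3') p2
    linarith
  obtain ⟨c, hc, rfl⟩ := hΛ.proportional e he d hd hz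
  rw [along_smul, e1] at d1'
  rw [qform_smul_right] at d3
  nlinarith

end SpacelikeSurface

namespace SpacelikeSurface

variable {S : SpacelikeSurface}

/-! ### The positive cone over the boundary at infinity -/

/-- An entire maximal surface whose boundary at infinity is an achronal curve. -/
structure IsEntireMaximal (S : SpacelikeSurface) : Prop where
  maximal : S.IsMaximal
  entire : S.IsEntire
  cone : IsBoundaryCone (lifts S.bdryAtInfinity)

/-- The lifts of the points at infinity lying in the same sheet as the surface. -/
def idealCone (S : SpacelikeSurface) : Set (Fin 4 → ℝ) :=
  {ζ | ζ ∈ lifts S.bdryAtInfinity ∧ ∀ y, qform (S.emb y) ζ < 0}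

lemma continuous_emb : Continuous S.emb := S.contDiff_emb.continuous

lemma IsEntireMaximal.mem_or_neg_mem (H : S.IsEntireMaximal) {ζ : Fin 4 → ℝ}
    (hζ : ζ ∈ lifts S.bdryAtInfinity) : ζ ∈ S.idealCone ∨ -ζ ∈ S.idealCone := by
  have hne : ∀ y, qform (S.emb y) ζ ≠ 0 := fun y =>
    H.entire.qform_ne_zero H.cone (S.emb_mem_cover y) hζ
  have hc : Continuous fun y => qform (S.emb y) ζ := continuous_emb.qform continuous_const
  have hsame : ∀ y y', qform (S.emb y) ζ < 0 → qform (S.emb y') ζ < 0 := by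
    intro y y' h
    by_contra h'
    obtain ⟨z, hz⟩ := mem_range_of_exists_le_of_exists_ge hc ⟨y, h.le⟩ ⟨y', not_lt.1 h'⟩
    exact hne z hz
  rcases lt_or_gt_of_ne (hne 0) with h | h
  · exact Or.inl ⟨hζ, fun y => hsame 0 y h⟩
  · refine Or.inr ⟨by simpa using H.cone.smul_mem ζ hζ (-1) (by norm_num), fun y => ?_⟩
    rw [qform_neg_right]
    by_contra h'
    have := hsame y 0 (lt_of_le_of_ne (by linarith) (hne y))
    linarith

lemma IsEntireMaximal.smul_mem (H : S.IsEntireMaximal) {ζ : Fin 4 → ℝ} (hζ : ζ ∈ S.idealCone)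
    {c : ℝ} (hc : 0 < c) : c • ζ ∈ S.idealCone :=
  ⟨H.cone.smul_mem ζ hζ.1 c hc.ne', fun y => by
    rw [qform_smul_right]; exact mul_neg_of_pos_of_neg hc (hζ.2 y)⟩

lemma IsEntireMaximal.qform_nonpos (H : S.IsEntireMaximal) {ζ ξ : Fin 4 → ℝ}
    (hζ : ζ ∈ S.idealCone) (hξ : ξ ∈ S.idealCone) : qform ζ ξ ≤ 0 := by
  by_contra! hpos
  have hs := H.cone.sign (qformCLM (S.emb 0)).toLinearMap (qformCLM (ζ - ξ)).toLinearMap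
    (fun η hη => H.entire.qform_ne_zero H.cone (S.emb_mem_cover 0) hη) (fun η hη h0 => by
      change qform (ζ - ξ) η = 0 at h0
      rw [qform_sub_left] at h0
      have ht := H.cone.triple ζ hζ.1 ξ hξ.1 η hη
      rw [qform_comm η ζ] at ht
      have h1 : qform ξ η = qform ζ η := by linarith
      rw [h1] at ht
      have h2 : qform ζ η = 0 := by
        by_contra h
        have := mul_pos hpos (mul_self_pos.2 h)
        nlinarith
      obtain ⟨c, hc, rfl⟩ := H.cone.proportional ζ hζ.1 η hη h2
      obtain ⟨d, hd, e⟩ := H.cone.proportional _ hη ξ hξ.1 (by rw [qform_comm, h1, h2])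
      rw [e, smul_smul, qform_smul_right, H.cone.null ζ hζ.1] at hpos
      simp at hpos)
  have e1 : ∀ x y : Fin 4 → ℝ, (qformCLM x).toLinearMap y = qform x y := fun _ _ => rfl
  simp only [e1, qform_sub_left] at hs
  have hz := H.cone.null ζ hζ.1
  have hx := H.cone.null ξ hξ.1
  rcases hs with h | h
  · have := h ξ hξ.1
    rw [hx, sub_zero] at this
    nlinarith [hξ.2 0]
  · have := h ζ hζ.1
    rw [hz, qform_comm ξ] at this
    nlinarith [hζ.2 0]

lemma IsEntireMaximal.exists_qform_neg (H : S.IsEntireMaximal) {ζ : Fin 4 → ℝ}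
    (hζ : ζ ∈ S.idealCone) : ∃ ξ ∈ S.idealCone, qform ζ ξ < 0 := by
  have key : ∃ ξ ∈ lifts S.bdryAtInfinity, qform ζ ξ ≠ 0 := by
    by_contra! h
    obtain ⟨ξ, hξ, η, hη, -, -, h0, -⟩ := H.cone.exists_three
    obtain ⟨c, -, rfl⟩ := H.cone.proportional ζ hζ.1 ξ hξ (h ξ hξ)
    rw [qform_smul_left, h η hη, mul_zero] at h0
    exact h0 rfl
  obtain ⟨ξ, hξ, h⟩ := key
  rcases H.mem_or_neg_mem hξ with h1 | h1
  · exact ⟨ξ, h1, lt_of_le_of_ne (H.qform_nonpos hζ h1) h⟩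
  · exact ⟨-ξ, h1, lt_of_le_of_ne (H.qform_nonpos hζ h1) (by rw [qform_neg_right]; simpa using h)⟩

lemma IsEntireMaximal.idealCone_nonempty (H : S.IsEntireMaximal) : ∃ ζ, ζ ∈ S.idealCone := by
  obtain ⟨ζ, hζ, -⟩ := H.cone.exists_three
  rcases H.mem_or_neg_mem hζ with h | h
  exacts [⟨_, h⟩, ⟨_, h⟩]

lemma IsEntireMaximal.mem_of_tendsto (H : S.IsEntireMaximal) {u : ℕ → Fin 4 → ℝ} {ζ : Fin 4 → ℝ}
    (hu : ∀ n, u n ∈ S.idealCone) (h : Tendsto u atTop (𝓝 ζ)) (hζ : ζ ≠ 0) :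
    ζ ∈ S.idealCone := by
  rcases H.mem_or_neg_mem (H.cone.mem_of_tendsto u ζ (fun n => (hu n).1) h hζ) with h1 | h1
  · exact h1
  · have h2 : qform (S.emb 0) ζ ≤ 0 := le_of_tendsto
      (((continuous_const.qform continuous_id).tendsto ζ).comp h)
      (Eventually.of_forall fun n => ((hu n).2 0).le)
    have h3 := h1.2 0
    rw [qform_neg_right] at h3
    linarith

lemma IsEntireMaximal.mem_of_tendsto_smul (H : S.IsEntireMaximal) {y : ℕ → Fin 2 → ℝ} {c : ℕ → ℝ}
    {x : Fin 4 → ℝ} (hc : ∀ n, 0 ≤ c n) (hc0 : Tendsto c atTop (𝓝 0))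
    (h : Tendsto (fun n => c n • S.emb (y n)) atTop (𝓝 x)) (hx : x ≠ 0) : x ∈ S.idealCone := by
  rcases H.mem_or_neg_mem (SpacelikeSurface.mem_lifts_bdry_of_tendsto
    (fun n => S.emb_mem_cover (y n)) hc0 h hx) with h1 | h1
  · exact h1
  · obtain ⟨ξ, hξ, h2⟩ := H.exists_qform_neg h1
    have h3 : qform x ξ ≤ 0 := le_of_tendsto
      (((continuous_id.qform continuous_const).tendsto x).comp h)
      (Eventually.of_forall fun n => by
        simp only [Function.comp_apply, id, qform_smul_left]
        exact mul_nonpos_of_nonneg_of_nonpos (hc n) (hξ.2 _).le)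
    rw [qform_neg_left] at h2
    linarith

lemma IsEntireMaximal.isClosed_range (H : S.IsEntireMaximal) : IsClosed (range S.emb) := by
  obtain ⟨ζ, hζ⟩ := H.idealCone_nonempty
  have : range S.emb = S.cover ∩ {x | qform x ζ ≤ 0} := by
    ext x
    constructor
    · rintro ⟨y, rfl⟩
      exact ⟨S.emb_mem_cover y, (hζ.2 y).le⟩
    · rintro ⟨⟨y, rfl | rfl⟩, h⟩
      · exact ⟨y, rfl⟩
      · have := hζ.2 y
        simp only [mem_ofPred_eq, qform_neg_left] at h
        linarith
  rw [this]
  exact H.entire.isClosed_cover.inter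
    (isClosed_le (continuous_id.qform continuous_const) continuous_const)

/-- Divergent sequences on the surface subconverge projectively to points at infinity. -/
lemma IsEntireMaximal.exists_subseq (H : S.IsEntireMaximal) {y : ℕ → Fin 2 → ℝ}
    (h : Tendsto (fun n => ‖S.emb (y n)‖) atTop atTop) :
    ∃ ζ ∈ S.idealCone, ‖ζ‖ = 1 ∧ ∃ φ : ℕ → ℕ, StrictMono φ ∧
      Tendsto (fun n => ‖S.emb (y (φ n))‖⁻¹ • S.emb (y (φ n))) atTop (𝓝 ζ) := by
  have hmem : ∀ n, ‖S.emb (y n)‖⁻¹ • S.emb (y n) ∈ Metric.sphere (0 : Fin 4 → ℝ) 1 := fun n => by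
    rw [mem_sphere_zero_iff_norm, norm_smul, norm_inv, norm_norm]
    exact inv_mul_cancel₀ (norm_ne_zero_iff.2 (S.emb_ne_zero _))
  obtain ⟨ζ, hζ, φ, hφ, hlim⟩ := (isCompact_sphere (0 : Fin 4 → ℝ) 1).tendsto_subseq hmem
  rw [mem_sphere_zero_iff_norm] at hζ
  refine ⟨ζ, ?_, hζ, φ, hφ, hlim⟩
  exact H.mem_of_tendsto_smul (fun n => inv_nonneg.2 (norm_nonneg _))
    (tendsto_inv_atTop_zero.comp (h.comp hφ.tendsto_atTop)) hlim
    (norm_ne_zero_iff.1 (by rw [hζ]; norm_num))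

lemma IsEntireMaximal.exists_linear_growth (H : S.IsEntireMaximal) {p : Fin 4 → ℝ}
    (hp : ∀ ζ ∈ S.idealCone, 0 < qform ζ p) :
    ∃ c > 0, ∃ R : ℝ, ∀ y, R ≤ ‖S.emb y‖ → c * ‖S.emb y‖ ≤ qform (S.emb y) p := by
  by_contra! h
  choose! y hy using fun n : ℕ => h (1 / ((n : ℝ) + 1)) (by positivity) n
  have hinf : Tendsto (fun n => ‖S.emb (y n)‖) atTop atTop :=
    tendsto_atTop_mono (fun n => (hy n).1) tendsto_natCast_atTop_atTop
  obtain ⟨ζ, hζ, -, φ, hφ, hlim⟩ := H.exists_subseq hinf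
  have h1 : qform ζ p ≤ 0 := by
    refine le_of_tendsto_of_tendsto (((continuous_id.qform continuous_const).tendsto ζ).comp hlim)
      ((tendsto_one_div_add_atTop_nhds_zero_nat (𝕜 := ℝ)).comp hφ.tendsto_atTop)
      (Eventually.of_forall fun n => ?_)
    have hpos : 0 < ‖S.emb (y (φ n))‖ := norm_pos_iff.2 (S.emb_ne_zero _)
    simp only [Function.comp_apply, id, qform_smul_left]
    rw [inv_mul_le_iff₀ hpos, mul_comm]
    exact (hy (φ n)).2.le
  linarith [hp ζ hζ]

lemma IsEntireMaximal.exists_pos_le (H : S.IsEntireMaximal) {p : Fin 4 → ℝ}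
    (hp : ∀ ζ ∈ S.idealCone, 0 < qform ζ p) :
    ∃ c > 0, ∀ ζ ∈ S.idealCone, c * ‖ζ‖ ≤ qform ζ p := by
  by_contra! h
  choose! z hz using fun n : ℕ => h (1 / ((n : ℝ) + 1)) (by positivity)
  have hpos : ∀ n, 0 < ‖z n‖ := fun n => norm_pos_iff.2 (H.cone.ne_zero _ (hz n).1.1)
  have hmem : ∀ n, ‖z n‖⁻¹ • z n ∈ Metric.sphere (0 : Fin 4 → ℝ) 1 := fun n => by
    rw [mem_sphere_zero_iff_norm, norm_smul, norm_inv, norm_norm]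
    exact inv_mul_cancel₀ (hpos n).ne'
  obtain ⟨ζ, hζ, φ, hφ, hlim⟩ := (isCompact_sphere (0 : Fin 4 → ℝ) 1).tendsto_subseq hmem
  rw [mem_sphere_zero_iff_norm] at hζ
  have hζ' : ζ ∈ S.idealCone := H.mem_of_tendsto
    (fun n => H.smul_mem (hz (φ n)).1 (inv_pos.2 (hpos _))) hlim
    (norm_ne_zero_iff.1 (by rw [hζ]; norm_num))
  have h1 : qform ζ p ≤ 0 := by
    refine le_of_tendsto_of_tendsto (((continuous_id.qform continuous_const).tendsto ζ).comp hlim)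
      ((tendsto_one_div_add_atTop_nhds_zero_nat (𝕜 := ℝ)).comp hφ.tendsto_atTop)
      (Eventually.of_forall fun n => ?_)
    simp only [Function.comp_apply, id, qform_smul_left]
    rw [inv_mul_le_iff₀ (hpos _), mul_comm]
    exact (hz (φ n)).2.le
  linarith [hp ζ hζ']

/-! ### The maximum principle for linear functions -/

lemma IsEntireMaximal.exists_min (H : S.IsEntireMaximal) {p : Fin 4 → ℝ}
    (hp : ∀ ζ ∈ S.idealCone, 0 < qform ζ p) :
    ∃ y₀, ∀ y, qform (S.emb y₀) p ≤ qform (S.emb y) p := by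
  obtain ⟨c, hc, R, hR⟩ := H.exists_linear_growth hp
  have := ContinuousOn.exists_isMinOn' (f := fun x => qform x p) (s := range S.emb)
    (continuous_id.qform continuous_const).continuousOn H.isClosed_range (x₀ := S.emb 0) ⟨0, rfl⟩
    (by
      rw [eventually_inf_principal]
      have hev : ∀ᶠ x : Fin 4 → ℝ in cocompact _, max R (c⁻¹ * qform (S.emb 0) p) ≤ ‖x‖ :=
        tendsto_norm_cocompact_atTop.eventually_ge_atTop _
      filter_upwards [hev] with x hx
      rintro ⟨y, rfl⟩
      refine le_trans ?_ (hR y ((le_max_left _ _).trans hx))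
      rw [← inv_mul_le_iff₀ hc]
      exact (le_max_right _ _).trans hx)
  obtain ⟨x, ⟨y₀, rfl⟩, hx⟩ := this
  exact ⟨y₀, fun y => hx ⟨y, rfl⟩⟩

lemma IsEntireMaximal.qform_nonneg_of_cone (H : S.IsEntireMaximal) {p : Fin 4 → ℝ}
    (hp : ∀ ζ ∈ S.idealCone, 0 < qform ζ p) (y : Fin 2 → ℝ) : 0 ≤ qform (S.emb y) p := by
  obtain ⟨y₀, h⟩ := H.exists_min hp
  refine le_trans ?_ (h y)
  obtain ⟨F⟩ := S.nonempty_movingFrame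
  have hm : IsLocalMax (S.f (-p)).1 y₀ := Eventually.of_forall fun z => by
    change qform _ (-p) ≤ qform _ (-p)
    rw [qform_neg_right, qform_neg_right]
    linarith [h z]
  have h3 := (F.of_isLocalMax hm).2.2
  rw [F.lap_f H.maximal] at h3
  have h4 : 2 * qform (S.emb y₀) (-p) ≤ 0 := h3
  rw [qform_neg_right] at h4
  linarith

lemma qform_le_norm (x z : Fin 4 → ℝ) : |qform x z| ≤ ‖qformCLM‖ * ‖x‖ * ‖z‖ :=
  qformCLM.le_opNorm₂ x z

lemma IsEntireMaximal.qform_pos_of_cone (H : S.IsEntireMaximal) {p : Fin 4 → ℝ}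
    (hp : ∀ ζ ∈ S.idealCone, 0 < qform ζ p) (y : Fin 2 → ℝ) : 0 < qform (S.emb y) p := by
  obtain ⟨c, hc, h⟩ := H.exists_pos_le hp
  obtain ⟨ξ, hξ⟩ := H.idealCone_nonempty
  set K := ‖qformCLM‖ * ‖ξ‖ with hK
  have hK0 : 0 ≤ K := by positivity
  have h1 := H.qform_nonneg_of_cone (p := p + (c / (2 * (K + 1))) • ξ) (fun ζ hζ => by
    rw [qform_add_right, qform_smul_right]
    have hpos : 0 < ‖ζ‖ := norm_pos_iff.2 (H.cone.ne_zero _ hζ.1)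
    have h2 := (abs_le.1 (qform_le_norm ζ ξ)).1
    have h3 := h ζ hζ
    have h4 : c / (2 * (K + 1)) * qform ζ ξ ≥ c / (2 * (K + 1)) * -(K * ‖ζ‖) :=
      mul_le_mul_of_nonneg_left (by rw [hK]; linarith) (by positivity)
    have h5 : c / (2 * (K + 1)) * (K * ‖ζ‖) ≤ c / 2 * ‖ζ‖ := by
      rw [div_mul_eq_mul_div, div_le_iff₀ (by positivity)]
      nlinarith [mul_nonneg hc.le hpos.le]
    nlinarith [mul_pos hc hpos]) y
  rw [qform_add_right, qform_smul_right] at h1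
  have := mul_neg_of_pos_of_neg (show 0 < c / (2 * (K + 1)) by positivity) (hξ.2 y)
  linarith

end SpacelikeSurface

/-! ### Second variation of bilinear functions of two points -/

namespace SpacelikeSurface

variable {S : SpacelikeSurface}

/-- The second derivative of the embedding along a straight line of parameters. -/
def accel (S : SpacelikeSurface) (y v : Fin 2 → ℝ) : Fin 4 → ℝ :=
  fderiv ℝ (fun z => fderiv ℝ S.emb z v) y v

lemma contDiff_fderiv_emb (S : SpacelikeSurface) (v : Fin 2 → ℝ) :
    ContDiff ℝ ∞ fun z => fderiv ℝ S.emb z v :=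
  contDiff_fderiv_apply_field S.contDiff_emb contDiff_const

lemma qform_accel_emb (y v : Fin 2 → ℝ) : qform (S.accel y v) (S.emb y)
    = -qform (fderiv ℝ S.emb y v) (fderiv ℝ S.emb y v) :=
  qform_fderiv_eq_neg (S.contDiff_fderiv_emb v) S.contDiff_emb
    (fun z => qform_fderiv_self S.contDiff_emb S.on_quadric z v) y v

lemma qform_accel_normal (y v : Fin 2 → ℝ) : qform (S.accel y v) (S.normal y)
    = -qform (fderiv ℝ S.normal y v) (fderiv ℝ S.emb y v) :=
  qform_fderiv_eq_neg (S.contDiff_fderiv_emb v) S.contDiff_normal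
    (fun z => (qform_comm _ _).trans (S.normal_orth z v)) y v

lemma hasDerivAt_line {u : (Fin 2 → ℝ) → Fin 4 → ℝ} (hu : ContDiff ℝ ∞ u) (y v : Fin 2 → ℝ)
    (s : ℝ) : HasDerivAt (fun s : ℝ => u (y + s • v)) (fderiv ℝ u (y + s • v) v) s := by
  have h1 : HasDerivAt (fun s : ℝ => y + s • v) v s := by
    simpa using ((hasDerivAt_id s).smul_const v).const_add y
  exact ((hu.differentiable (by simp)) _).hasFDerivAt.comp_hasDerivAt s h1

lemma variation_of_isMax {T : (Fin 4 → ℝ) →L[ℝ] (Fin 4 → ℝ)} {y y' : Fin 2 → ℝ}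
    (h : ∀ z z', qform (T (S.emb z)) (S.emb z') ≤ qform (T (S.emb y)) (S.emb y'))
    (v v' : Fin 2 → ℝ) :
    qform (T (fderiv ℝ S.emb y v)) (S.emb y') = 0 ∧
    qform (T (S.emb y)) (fderiv ℝ S.emb y' v') = 0 ∧
    qform (T (S.accel y v)) (S.emb y') + qform (T (S.emb y)) (S.accel y' v')
      + 2 * qform (T (fderiv ℝ S.emb y v)) (fderiv ℝ S.emb y' v') ≤ 0 := by
  have hx := fun y v s => hasDerivAt_line S.contDiff_emb y v s
  have hv := fun y v s => hasDerivAt_line (S.contDiff_fderiv_emb v) y v s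
  have hd : ∀ v v' : Fin 2 → ℝ, ∀ s : ℝ, HasDerivAt
      (fun s : ℝ => qform (T (S.emb (y + s • v))) (S.emb (y' + s • v')))
      (qform (T (S.emb (y + s • v))) (fderiv ℝ S.emb (y' + s • v') v')
        + qform (T (fderiv ℝ S.emb (y + s • v) v)) (S.emb (y' + s • v'))) s := fun v v' s =>
    (qformCLM.comp T).hasDerivAt_of_bilinear (fun _ => hx y v s) (fun _ => hx y' v' s)
  have hmax : ∀ v v' : Fin 2 → ℝ, IsLocalMax
      (fun s : ℝ => qform (T (S.emb (y + s • v))) (S.emb (y' + s • v'))) 0 := fun v v' =>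
    Eventually.of_forall fun s => by simpa using h _ _
  have hz : fderiv ℝ S.emb y' (0 : Fin 2 → ℝ) = 0 ∧ fderiv ℝ S.emb y (0 : Fin 2 → ℝ) = 0 :=
    ⟨map_zero _, map_zero _⟩
  have h1 := (hd v 0 0).deriv.symm.trans (hmax v 0).deriv_eq_zero
  have h2 := (hd 0 v' 0).deriv.symm.trans (hmax 0 v').deriv_eq_zero
  simp only [zero_smul, add_zero, hz, map_zero, qform_zero_right, qform_zero_left, zero_add] at h1 h2
  refine ⟨h1, h2, ?_⟩
  have hdd := deriv_deriv_nonpos_of_isLocalMax (hd v v' 0).continuousAt (hmax v v')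
  rw [funext fun s => (hd v v' s).deriv] at hdd
  have h3 := (((qformCLM.comp T).hasDerivAt_of_bilinear (fun _ => hx y v 0)
      (fun _ => hv y' v' 0)).add
    ((qformCLM.comp T).hasDerivAt_of_bilinear (fun _ => hv y v 0)
      (fun _ => hx y' v' 0))).deriv
  have h4 := h3.symm.trans_le hdd
  change qform (T (S.emb (y + (0 : ℝ) • v))) (S.accel (y' + (0 : ℝ) • v') v')
    + qform (T (fderiv ℝ S.emb (y + (0 : ℝ) • v) v)) (fderiv ℝ S.emb (y' + (0 : ℝ) • v') v')
    + (qform (T (fderiv ℝ S.emb (y + (0 : ℝ) • v) v)) (fderiv ℝ S.emb (y' + (0 : ℝ) • v') v')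
      + qform (T (S.accel (y + (0 : ℝ) • v) v)) (S.emb (y' + (0 : ℝ) • v'))) ≤ 0 at h4
  simp only [zero_smul, add_zero] at h4
  linarith

end SpacelikeSurface

namespace MovingFrame

variable {S : SpacelikeSurface} (F : MovingFrame S)

lemma accel_eq (hS : S.IsMaximal) (y : Fin 2 → ℝ) (α β : ℝ) :
    ∃ c d : ℝ, S.accel y (α • F.E₁ y + β • F.E₂ y) = c • F.e₁ y + d • F.e₂ y
      + (α ^ 2 + β ^ 2) • S.emb y
      + ((α ^ 2 - β ^ 2) * F.a.1 y + 2 * α * β * F.b.1 y) • S.normal y := by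
  set v := α • F.E₁ y + β • F.E₂ y with hv
  have hX : fderiv ℝ S.emb y v = α • F.e₁ y + β • F.e₂ y := by
    rw [hv, map_add, map_smul, map_smul]; rfl
  have hN : fderiv ℝ S.normal y v = α • F.n₁ y + β • F.n₂ y := by
    rw [hv, map_add, map_smul, map_smul]; rfl
  have hf := F.orthoFrame y
  have h1 := S.qform_accel_emb y v
  have h2 := S.qform_accel_normal y v
  rw [hX] at h1 h2
  rw [hN] at h2
  simp only [qform_add_left, qform_add_right, qform_smul_left, qform_smul_right, hf.e11, hf.e22,
    hf.e12, qform_comm (F.e₂ y) (F.e₁ y), F.qform_n₂_e₁, F.qform_n₂_e₂ hS] at h1 h2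
  have ha : qform (F.n₁ y) (F.e₁ y) = F.a.1 y := rfl
  have hb : qform (F.n₁ y) (F.e₂ y) = F.b.1 y := rfl
  rw [ha, hb] at h2
  refine ⟨qform (S.accel y v) (F.e₁ y), qform (S.accel y v) (F.e₂ y), ?_⟩
  conv_lhs => rw [hf.expand (S.accel y v), h1, h2]
  module

lemma variation_frame (hS : S.IsMaximal) {T : (Fin 4 → ℝ) →L[ℝ] (Fin 4 → ℝ)} {y y' : Fin 2 → ℝ}
    (h : ∀ z z', qform (T (S.emb z)) (S.emb z') ≤ qform (T (S.emb y)) (S.emb y'))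
    (α β α' β' : ℝ) :
    (α ^ 2 + β ^ 2 + α' ^ 2 + β' ^ 2) * qform (T (S.emb y)) (S.emb y')
      + ((α ^ 2 - β ^ 2) * F.a.1 y + 2 * α * β * F.b.1 y) * qform (T (S.normal y)) (S.emb y')
      + ((α' ^ 2 - β' ^ 2) * F.a.1 y' + 2 * α' * β' * F.b.1 y') * qform (T (S.emb y)) (S.normal y')
      + 2 * (α * α' * qform (T (F.e₁ y)) (F.e₁ y') + α * β' * qform (T (F.e₁ y)) (F.e₂ y')
        + β * α' * qform (T (F.e₂ y)) (F.e₁ y') + β * β' * qform (T (F.e₂ y)) (F.e₂ y')) ≤ 0 := by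
  have h1 := (S.variation_of_isMax h (F.E₁ y) (F.E₁ y')).1
  have h2 := (S.variation_of_isMax h (F.E₂ y) (F.E₁ y')).1
  have h3 := (S.variation_of_isMax h (F.E₁ y) (F.E₁ y')).2.1
  have h4 := (S.variation_of_isMax h (F.E₁ y) (F.E₂ y')).2.1
  have h5 := (S.variation_of_isMax h (α • F.E₁ y + β • F.E₂ y) (α' • F.E₁ y' + β' • F.E₂ y')).2.2
  change qform (T (F.e₁ y)) _ = 0 at h1
  change qform (T (F.e₂ y)) _ = 0 at h2
  change qform _ (F.e₁ y') = 0 at h3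
  change qform _ (F.e₂ y') = 0 at h4
  have hX : ∀ (y : Fin 2 → ℝ) (α β : ℝ), fderiv ℝ S.emb y (α • F.E₁ y + β • F.E₂ y) = α • F.e₁ y + β • F.e₂ y := by
    intro y α β
    rw [map_add, map_smul, map_smul]; rfl
  obtain ⟨c, d, e1⟩ := F.accel_eq hS y α β
  obtain ⟨c', d', e2⟩ := F.accel_eq hS y' α' β'
  rw [hX, hX, e1, e2] at h5
  simp only [map_add, map_smul, qform_add_left, qform_add_right, qform_smul_left, qform_smul_right,
    h1, h2, h3, h4] at h5
  linarith

lemma sq_add_sq_le_four {x z : ℝ} (h : ∀ c s : ℝ, c ^ 2 + s ^ 2 = 1 → c * x + s * z ≤ 2) :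
    x ^ 2 + z ^ 2 ≤ 4 := by
  by_contra! h1
  have hr : 0 < √(x ^ 2 + z ^ 2) := Real.sqrt_pos.2 (by linarith)
  have hr2 := Real.sq_sqrt (show 0 ≤ x ^ 2 + z ^ 2 by linarith)
  have h2 := h (x / √(x ^ 2 + z ^ 2)) (z / √(x ^ 2 + z ^ 2)) (by
    rw [div_pow, div_pow, ← add_div, hr2]; exact div_self (by linarith))
  have h3 : x / √(x ^ 2 + z ^ 2) * x + z / √(x ^ 2 + z ^ 2) * z = √(x ^ 2 + z ^ 2) := by
    rw [div_mul_eq_mul_div, div_mul_eq_mul_div, ← add_div, div_eq_iff hr.ne']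
    linarith
  rw [h3] at h2
  nlinarith

/-- At a maximum with value `-1` of a symmetric bilinear function of two points, the mixed
second derivative has small conformal and anticonformal parts. -/
lemma mixed_le_four (hS : S.IsMaximal) {T : (Fin 4 → ℝ) →L[ℝ] (Fin 4 → ℝ)} {y y' : Fin 2 → ℝ}
    (h : ∀ z z', qform (T (S.emb z)) (S.emb z') ≤ qform (T (S.emb y)) (S.emb y'))
    (hv : qform (T (S.emb y)) (S.emb y') = -1) :
    (qform (T (F.e₁ y)) (F.e₁ y') + qform (T (F.e₂ y)) (F.e₂ y')) ^ 2
      + (qform (T (F.e₁ y)) (F.e₂ y') - qform (T (F.e₂ y)) (F.e₁ y')) ^ 2 ≤ 4 ∧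
    (qform (T (F.e₁ y)) (F.e₁ y') - qform (T (F.e₂ y)) (F.e₂ y')) ^ 2
      + (qform (T (F.e₁ y)) (F.e₂ y') + qform (T (F.e₂ y)) (F.e₁ y')) ^ 2 ≤ 4 := by
  constructor <;> refine sq_add_sq_le_four fun c s hcs => ?_
  · have h1 := F.variation_frame hS h 1 0 c s
    have h2 := F.variation_frame hS h 0 1 (-s) c
    rw [hv] at h1 h2
    nlinarith
  · have h1 := F.variation_frame hS h 1 0 c s
    have h2 := F.variation_frame hS h 0 1 s (-c)
    rw [hv] at h1 h2
    nlinarith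

end MovingFrame

/-! ### Achronality of the surface -/

lemma psd_form_bound {β γ n q u v m qc uc vc s : ℝ} (hn0 : 0 < β * q ^ 2 - γ * (u ^ 2 + v ^ 2))
    (hn : n ^ 2 = β * q ^ 2 - γ * (u ^ 2 + v ^ 2))
    (hm : n * m = β * q * qc - γ * (u * uc + v * vc))
    (hs : s = -β * qc ^ 2 + γ * (uc ^ 2 + vc ^ 2) + m ^ 2) :
    γ * ((q * uc - qc * u) ^ 2 + (q * vc - qc * v) ^ 2) ≤ q ^ 2 * s := by
  have h1 : n ^ 2 * (q ^ 2 * s - γ * ((q * uc - qc * u) ^ 2 + (q * vc - qc * v) ^ 2))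
      = γ ^ 2 * (u * (q * uc - qc * u) + v * (q * vc - qc * v)) ^ 2 := by
    have h2 : n ^ 2 * s = n ^ 2 * (-β * qc ^ 2 + γ * (uc ^ 2 + vc ^ 2)) + (n * m) ^ 2 := by
      rw [hs]; ring
    rw [mul_sub, mul_left_comm, h2, hm, hn]; ring
  have h3 : 0 < n ^ 2 := by rw [hn]; exact hn0
  have h4 : 0 ≤ n ^ 2 * (q ^ 2 * s - γ * ((q * uc - qc * u) ^ 2 + (q * vc - qc * v) ^ 2)) := by
    rw [h1]; positivity
  have := nonneg_of_mul_nonneg_right h4 h3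
  linarith

lemma det_nonneg_of_form_nonneg {a b c : ℝ} (h : ∀ x z : ℝ, 0 ≤ a * x ^ 2 + 2 * b * x * z + c * z ^ 2) :
    0 ≤ a * c - b ^ 2 := by
  have h1 := h 1 0
  have h2 := h (-b) a
  have h3 := h 1 (-b)
  have h5 := h (c + 1) (-b)
  by_contra! hneg
  have ha : 0 ≤ a := by simpa using h1
  have h4 : a * (a * c - b ^ 2) ≥ 0 := by nlinarith
  have ha0 : a = 0 := by
    rcases ha.lt_or_eq with h6 | h6
    · nlinarith
    · exact h6.symm
  subst ha0
  nlinarith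

lemma eq_zero_of_sq_add_sq_nonpos {x z : ℝ} (h : x ^ 2 + z ^ 2 ≤ 0) : x = 0 ∧ z = 0 := by
  constructor <;> nlinarith [sq_nonneg x, sq_nonneg z]

/-- The contradiction between the first and second variation at an interior maximum. -/
lemma variation_algebra {β γ n q u v m₁ m₂ q₁ u₁ v₁ q₂ u₂ v₂ A₁₁ A₁₂ A₂₁ A₂₂ : ℝ}
    (hγ : 0 < γ) (hn0 : 0 < β * q ^ 2 - γ * (u ^ 2 + v ^ 2)) (hq : q ≠ 0)
    (hn : n ^ 2 = β * q ^ 2 - γ * (u ^ 2 + v ^ 2))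
    (hm₁ : n * m₁ = β * q * q₁ - γ * (u * u₁ + v * v₁))
    (hm₂ : n * m₂ = β * q * q₂ - γ * (u * u₂ + v * v₂))
    (h₁₁ : A₁₁ ^ 2 + A₂₁ ^ 2 = 1 - β * q₁ ^ 2 + γ * (u₁ ^ 2 + v₁ ^ 2) + m₁ ^ 2)
    (h₂₂ : A₁₂ ^ 2 + A₂₂ ^ 2 = 1 - β * q₂ ^ 2 + γ * (u₂ ^ 2 + v₂ ^ 2) + m₂ ^ 2)
    (h₁₂ : A₁₁ * A₁₂ + A₂₁ * A₂₂ = -β * (q₁ * q₂) + γ * (u₁ * u₂ + v₁ * v₂) + m₁ * m₂)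
    (hp : (A₁₁ + A₂₂) ^ 2 + (A₁₂ - A₂₁) ^ 2 ≤ 4) (hp' : (A₁₁ - A₂₂) ^ 2 + (A₁₂ + A₂₁) ^ 2 ≤ 4) :
    q * u₁ = q₁ * u ∧ q * v₁ = q₁ * v ∧ q * u₂ = q₂ * u ∧ q * v₂ = q₂ * v := by
  have hq2 : 0 < q ^ 2 := by positivity
  set s₁ := -β * q₁ ^ 2 + γ * (u₁ ^ 2 + v₁ ^ 2) + m₁ ^ 2 with hs₁
  set s₂ := -β * q₂ ^ 2 + γ * (u₂ ^ 2 + v₂ ^ 2) + m₂ ^ 2 with hs₂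
  set s := -β * (q₁ * q₂) + γ * (u₁ * u₂ + v₁ * v₂) + m₁ * m₂ with hs
  have b₁ := psd_form_bound hn0 hn hm₁ hs₁
  have b₂ := psd_form_bound hn0 hn hm₂ hs₂
  have hdet : 0 ≤ s₁ * s₂ - s ^ 2 := det_nonneg_of_form_nonneg fun x z => by
    have := psd_form_bound hn0 hn (qc := x * q₁ + z * q₂) (uc := x * u₁ + z * u₂)
      (vc := x * v₁ + z * v₂) (m := x * m₁ + z * m₂) (by linear_combination x * hm₁ + z * hm₂) rfl
    have h0 : 0 ≤ γ * ((q * (x * u₁ + z * u₂) - (x * q₁ + z * q₂) * u) ^ 2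
      + (q * (x * v₁ + z * v₂) - (x * q₁ + z * q₂) * v) ^ 2) := by positivity
    have h1 := nonneg_of_mul_nonneg_right (h0.trans this) hq2
    rw [hs₁, hs₂, hs]
    linarith
  have c₁ : 0 ≤ s₁ := nonneg_of_mul_nonneg_right (le_trans (by positivity) b₁) hq2
  have c₂ : 0 ≤ s₂ := nonneg_of_mul_nonneg_right (le_trans (by positivity) b₂) hq2
  have e₁ : A₁₁ ^ 2 + A₂₁ ^ 2 = 1 + s₁ := by rw [h₁₁, hs₁]; ring
  have e₂ : A₁₂ ^ 2 + A₂₂ ^ 2 = 1 + s₂ := by rw [h₂₂, hs₂]; ring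
  have ed : (A₁₁ * A₂₂ - A₁₂ * A₂₁) ^ 2 = (1 + s₁) * (1 + s₂) - s ^ 2 := by
    rw [← e₁, ← e₂, ← h₁₂]; ring
  set d := A₁₁ * A₂₂ - A₁₂ * A₂₁ with hd
  have t₁ : 2 * d ≤ 2 - (s₁ + s₂) := by rw [hd]; linarith
  have t₂ : -(2 * d) ≤ 2 - (s₁ + s₂) := by rw [hd]; linarith
  have t₃ : (2 * d) ^ 2 ≤ (2 - (s₁ + s₂)) ^ 2 := sq_le_sq' (by linarith) t₁
  have t₄ : s₁ + s₂ = 0 := by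
    by_contra hne
    have hpos : 0 < s₁ + s₂ := lt_of_le_of_ne (by linarith) (Ne.symm hne)
    have t₅ : 8 * (s₁ + s₂) ≤ (s₁ + s₂) * (s₁ + s₂) := by linarith
    linarith [le_of_mul_le_mul_right t₅ hpos]
  have z₁ : s₁ = 0 := by linarith
  have z₂ : s₂ = 0 := by linarith
  rw [z₁, mul_zero] at b₁
  rw [z₂, mul_zero] at b₂
  obtain ⟨i₁, i₂⟩ := eq_zero_of_sq_add_sq_nonpos (nonpos_of_mul_nonpos_right b₁ hγ)
  obtain ⟨i₃, i₄⟩ := eq_zero_of_sq_add_sq_nonpos (nonpos_of_mul_nonpos_right b₂ hγ)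
  exact ⟨by linarith, by linarith, by linarith, by linarith⟩

/-- The perturbation `Y ↦ Y - M (⟨Y,q⟩ q - δ ∑ ⟨Y,pᵢ⟩ pᵢ)` of the identity. -/
def twist (q p₁ p₂ : Fin 4 → ℝ) (M δ : ℝ) : (Fin 4 → ℝ) →L[ℝ] (Fin 4 → ℝ) :=
  ContinuousLinearMap.id ℝ _ - M • ((qformCLM q).smulRight q
    - δ • ((qformCLM p₁).smulRight p₁ + (qformCLM p₂).smulRight p₂))

lemma twist_apply (q p₁ p₂ : Fin 4 → ℝ) (M δ : ℝ) (x : Fin 4 → ℝ) : twist q p₁ p₂ M δ x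
    = x - M • (qform q x • q - δ • (qform p₁ x • p₁ + qform p₂ x • p₂)) := rfl

lemma qform_twist (q p₁ p₂ : Fin 4 → ℝ) (M δ : ℝ) (x z : Fin 4 → ℝ) :
    qform (twist q p₁ p₂ M δ x) z = qform x z
      - M * (qform q x * qform q z - δ * (qform p₁ x * qform p₁ z + qform p₂ x * qform p₂ z)) := by
  simp only [twist_apply, qform_sub_left, qform_smul_left, qform_add_left]

lemma qform_twist_comm (q p₁ p₂ : Fin 4 → ℝ) (M δ : ℝ) (x z : Fin 4 → ℝ) :
    qform (twist q p₁ p₂ M δ x) z = qform (twist q p₁ p₂ M δ z) x := by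
  rw [qform_twist, qform_twist, qform_comm x z]; ring

lemma qform_twist_twist {q p₁ p₂ n : Fin 4 → ℝ} (h : IsOrthoFrame p₁ p₂ q n) (M δ : ℝ)
    (x z : Fin 4 → ℝ) :
    qform (twist q p₁ p₂ M δ x) (twist q p₁ p₂ M δ z) = qform x z
      - (2 * M + M ^ 2) * (qform q x * qform q z)
      + (2 * M * δ + M ^ 2 * δ ^ 2) * (qform p₁ x * qform p₁ z + qform p₂ x * qform p₂ z) := by
  simp only [twist_apply, qform_sub_left, qform_smul_left, qform_add_left,
    qform_sub_right, qform_smul_right, qform_add_right, h.e11, h.e22, h.e12, h.e1x, h.e2x, h.xx,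
    qform_comm p₂ p₁, qform_comm q p₁, qform_comm q p₂, qform_comm x]
  ring

lemma IsOrthoFrame.not_proportional {q p₁ p₂ n₀ e₁ e₂ x n : Fin 4 → ℝ}
    (hq : IsOrthoFrame p₁ p₂ q n₀) (hf : IsOrthoFrame e₁ e₂ x n) (hq0 : qform q x ≠ 0)
    (r₁ : qform q x * qform p₁ e₁ = qform q e₁ * qform p₁ x)
    (r₂ : qform q x * qform p₂ e₁ = qform q e₁ * qform p₂ x)
    (r₃ : qform q x * qform p₁ e₂ = qform q e₂ * qform p₁ x)
    (r₄ : qform q x * qform p₂ e₂ = qform q e₂ * qform p₂ x) : False := by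
  have nz : ∀ c d : ℝ, qform q (c • e₁ + d • e₂) = 0 →
      qform p₁ (c • e₁ + d • e₂) = 0 → qform p₂ (c • e₁ + d • e₂) = 0 →
      c ^ 2 + d ^ 2 ≤ 0 := by
    intro c d g1 g2 g3
    have g := hq.qform_expand (c • e₁ + d • e₂) (c • e₁ + d • e₂)
    rw [g1, g2, g3, qform_comm _ n₀] at g
    have g' : qform (c • e₁ + d • e₂) (c • e₁ + d • e₂) = c ^ 2 + d ^ 2 := by
      simp only [qform_add_left, qform_add_right, qform_smul_left, qform_smul_right, hf.e11,
        hf.e22, hf.e12, qform_comm e₂ e₁]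
      ring
    rw [← g', g]
    nlinarith [sq_nonneg (qform n₀ (c • e₁ + d • e₂))]
  have w : ∀ a b : ℝ, qform q x * a = b → b = 0 → a = 0 := fun a b h0 h1 =>
    (mul_eq_zero.1 (h0.trans h1)).resolve_left hq0
  have s1 := nz (qform q e₂) (-qform q e₁)
  simp only [qform_add_right, qform_smul_right] at s1
  have s2 := s1 (by ring) (w _ _ (by linear_combination (qform q e₂) * r₁
    - (qform q e₁) * r₃) rfl) (w _ _ (by linear_combination (qform q e₂) * r₂
    - (qform q e₁) * r₄) rfl)
  have z1 : qform q e₁ = 0 := neg_eq_zero.1 (eq_zero_of_sq_add_sq_nonpos s2).2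
  have z2 := nz 1 0
  simp only [qform_add_right, qform_smul_right, zero_mul, one_mul, add_zero] at z2
  have := z2 z1 (w _ _ r₁ (by rw [z1, zero_mul])) (w _ _ r₂ (by rw [z1, zero_mul]))
  norm_num at this

namespace SpacelikeSurface

variable {S : SpacelikeSurface}

lemma not_isMax_twist (hS : S.IsMaximal) {q p₁ p₂ n₀ : Fin 4 → ℝ} (hq : IsOrthoFrame p₁ p₂ q n₀)
    {M δ : ℝ} (hM : 0 < M) (hδ : 0 < δ) (hδ1 : δ ≤ 1) {y y' : Fin 2 → ℝ}
    (hpos : δ * (qform p₁ (S.emb y') ^ 2 + qform p₂ (S.emb y') ^ 2) < qform q (S.emb y') ^ 2)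
    (h : ∀ z z', qform (twist q p₁ p₂ M δ (S.emb z)) (S.emb z')
      ≤ qform (twist q p₁ p₂ M δ (S.emb y)) (S.emb y')) :
    qform (twist q p₁ p₂ M δ (S.emb y)) (S.emb y') ≠ -1 := by
  intro hv
  obtain ⟨F⟩ := S.nonempty_movingFrame
  obtain ⟨hp, hp'⟩ := F.mixed_le_four hS h hv
  have h1 := (S.variation_of_isMax h (F.E₁ y) (F.E₁ y')).1
  have h2 := (S.variation_of_isMax h (F.E₂ y) (F.E₁ y')).1
  have h3 := (S.variation_of_isMax h (F.E₁ y) (F.E₁ y')).2.1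
  have h4 := (S.variation_of_isMax h (F.E₁ y) (F.E₂ y')).2.1
  change qform (twist q p₁ p₂ M δ (F.e₁ y)) _ = 0 at h1
  change qform (twist q p₁ p₂ M δ (F.e₂ y)) _ = 0 at h2
  change qform _ (F.e₁ y') = 0 at h3
  change qform _ (F.e₂ y') = 0 at h4
  have hf := F.orthoFrame y
  have hf' := F.orthoFrame y'
  rw [qform_twist_comm] at h1 h2 h3 h4 hv
  have ex := fun x z => hf.qform_expand (twist q p₁ p₂ M δ x) (twist q p₁ p₂ M δ z)
  simp only [qform_twist_twist hq] at ex
  have cm : ∀ x z, qform z (twist q p₁ p₂ M δ x) = qform (twist q p₁ p₂ M δ x) z :=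
    fun x z => qform_comm _ _
  simp only [cm] at ex
  have ea := ex (S.emb y') (S.emb y')
  have eb₁ := ex (S.emb y') (F.e₁ y')
  have eb₂ := ex (S.emb y') (F.e₂ y')
  have ec₁₁ := ex (F.e₁ y') (F.e₁ y')
  have ec₂₂ := ex (F.e₂ y') (F.e₂ y')
  have ec₁₂ := ex (F.e₁ y') (F.e₂ y')
  rw [h1, h2, hv, hf'.xx] at ea
  rw [h1, h2, hv, h3, qform_comm, hf'.e1x] at eb₁
  rw [h1, h2, hv, h4, qform_comm, hf'.e2x] at eb₂
  rw [h3, hf'.e11] at ec₁₁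
  rw [h4, hf'.e22] at ec₂₂
  rw [h3, h4, hf'.e12] at ec₁₂
  simp only [qform_twist_comm q p₁ p₂ M δ (F.e₁ y), qform_twist_comm q p₁ p₂ M δ (F.e₂ y)] at hp hp'
  have hq0 : qform q (S.emb y') ≠ 0 := fun h0 => by
    rw [h0] at hpos
    have : 0 ≤ δ * (qform p₁ (S.emb y') ^ 2 + qform p₂ (S.emb y') ^ 2) := by positivity
    linarith
  have hn0 : 0 < (2 * M + M ^ 2) * qform q (S.emb y') ^ 2
      - (2 * M * δ + M ^ 2 * δ ^ 2) * (qform p₁ (S.emb y') ^ 2 + qform p₂ (S.emb y') ^ 2) := by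
    have k1 : (2 * M * δ + M ^ 2 * δ ^ 2) * (qform p₁ (S.emb y') ^ 2 + qform p₂ (S.emb y') ^ 2)
        ≤ (2 * M + M ^ 2) * (δ * (qform p₁ (S.emb y') ^ 2 + qform p₂ (S.emb y') ^ 2)) := by
      rw [← mul_assoc]
      refine mul_le_mul_of_nonneg_right ?_ (by positivity)
      nlinarith [mul_nonneg (sq_nonneg M) (mul_nonneg hδ.le (sub_nonneg.2 hδ1))]
    have k2 := mul_lt_mul_of_pos_left hpos (show 0 < 2 * M + M ^ 2 by positivity)
    linarith
  obtain ⟨r₁, r₂, r₃, r₄⟩ := variation_algebra (β := 2 * M + M ^ 2)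
    (γ := 2 * M * δ + M ^ 2 * δ ^ 2) (n := qform (twist q p₁ p₂ M δ (S.emb y')) (S.normal y))
    (m₁ := qform (twist q p₁ p₂ M δ (F.e₁ y')) (S.normal y))
    (m₂ := qform (twist q p₁ p₂ M δ (F.e₂ y')) (S.normal y))
    (q₁ := qform q (F.e₁ y')) (q₂ := qform q (F.e₂ y'))
    (u₁ := qform p₁ (F.e₁ y')) (u₂ := qform p₁ (F.e₂ y'))
    (v₁ := qform p₂ (F.e₁ y')) (v₂ := qform p₂ (F.e₂ y'))
    (by positivity) hn0 hq0 (by linear_combination ea)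
    (by linear_combination eb₁) (by linear_combination eb₂) (by linear_combination -ec₁₁)
    (by linear_combination -ec₂₂) (by linear_combination -ec₁₂) hp hp'
  exact hq.not_proportional hf' hq0 r₁ r₂ r₃ r₄

end SpacelikeSurface

namespace SpacelikeSurface

variable {S : SpacelikeSurface}

lemma IsEntireMaximal.exists_norm_le (H : S.IsEntireMaximal) {p : Fin 4 → ℝ}
    (hp : ∀ ζ ∈ S.idealCone, 0 < qform ζ p) :
    ∃ C > 0, ∀ y, ‖S.emb y‖ ≤ C * qform (S.emb y) p := by
  obtain ⟨c, hc, R, hR⟩ := H.exists_linear_growth hp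
  obtain ⟨y₀, hy₀⟩ := H.exists_min hp
  have hm := H.qform_pos_of_cone hp y₀
  refine ⟨max c⁻¹ (R / qform (S.emb y₀) p), lt_max_of_lt_left (inv_pos.2 hc), fun y => ?_⟩
  have hy := H.qform_pos_of_cone hp y
  rcases le_total R ‖S.emb y‖ with h | h
  · refine le_trans ?_ (mul_le_mul_of_nonneg_right (le_max_left _ _) hy.le)
    rw [inv_mul_eq_div, le_div_iff₀ hc, mul_comm]
    exact hR y h
  · refine le_trans ?_ (mul_le_mul_of_nonneg_right (le_max_right _ _) hy.le)
    have hR0 : 0 ≤ R := (norm_nonneg _).trans h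
    calc ‖S.emb y‖ ≤ R := h
      _ = R / qform (S.emb y₀) p * qform (S.emb y₀) p := by field_simp
      _ ≤ _ := mul_le_mul_of_nonneg_left (hy₀ y) (by positivity)

lemma cone_neg_emb (y : Fin 2 → ℝ) : ∀ ζ ∈ S.idealCone, 0 < qform ζ (-S.emb y) := fun ζ hζ => by
  rw [qform_neg_right, qform_comm]
  linarith [hζ.2 y]

lemma one_le_norm_sq (y : Fin 2 → ℝ) : 1 ≤ ‖qformCLM‖ * ‖S.emb y‖ * ‖S.emb y‖ := by
  have := qform_le_norm (S.emb y) (S.emb y)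
  rw [S.on_quadric] at this
  simpa using this

lemma IsEntireMaximal.asymptotic_le (H : S.IsEntireMaximal) {ε : ℝ} (hε : 0 < ε) :
    ∃ R : ℝ, ∀ y y', R ≤ ‖S.emb y‖ →
      1 + qform (S.emb y) (S.emb y') ≤ ε * (‖S.emb y‖ * ‖S.emb y'‖) := by
  by_contra! h
  choose y y' hy using fun n : ℕ => h n
  have hinf : Tendsto (fun n => ‖S.emb (y n)‖) atTop atTop :=
    tendsto_atTop_mono (fun n => (hy n).1) tendsto_natCast_atTop_atTop
  obtain ⟨ζ, hζ, -, φ, hφ, hlim⟩ := H.exists_subseq hinf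
  set K := ‖qformCLM‖
  have hK : 0 < K := by
    by_contra! h0
    have := one_le_norm_sq (S := S) 0
    have h1 : K * ‖S.emb 0‖ * ‖S.emb 0‖ ≤ 0 := by
      rw [mul_assoc]; exact mul_nonpos_of_nonpos_of_nonneg h0 (by positivity)
    linarith
  have h1 : ∀ᶠ n in atTop, ‖‖S.emb (y (φ n))‖⁻¹ • S.emb (y (φ n)) - ζ‖ < ε / (2 * K) :=
    ((tendsto_iff_norm_sub_tendsto_zero.1 hlim).eventually_lt_const (by positivity))
  have h2 : ∀ᶠ n in atTop, 4 * K / ε ^ 2 + 1 ≤ ‖S.emb (y (φ n))‖ ^ 2 := by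
    have := (tendsto_pow_atTop (n := 2) (by norm_num)).comp (hinf.comp hφ.tendsto_atTop)
    exact this.eventually_ge_atTop _
  obtain ⟨n, h1, h2⟩ := (h1.and h2).exists
  have h3 := (hy (φ n)).2
  set X := S.emb (y (φ n))
  set X' := S.emb (y' (φ n)) with hX'
  have hX : 0 < ‖X‖ := norm_pos_iff.2 (S.emb_ne_zero _)
  have hXp : 0 < ‖X'‖ := norm_pos_iff.2 (S.emb_ne_zero _)
  have h4 : qform X X' ≤ ε / 2 * (‖X‖ * ‖X'‖) := by
    have e : qform X X' = ‖X‖ * (qform (‖X‖⁻¹ • X - ζ) X' + qform ζ X') := by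
      rw [qform_sub_left, qform_smul_left]; field_simp; ring
    have l1 : qform (‖X‖⁻¹ • X - ζ) X' ≤ ε / 2 * ‖X'‖ := by
      refine (le_abs_self _).trans ((qform_le_norm _ _).trans ?_)
      refine mul_le_mul_of_nonneg_right ?_ hXp.le
      calc K * ‖‖X‖⁻¹ • X - ζ‖ ≤ K * (ε / (2 * K)) := mul_le_mul_of_nonneg_left h1.le hK.le
        _ = ε / 2 := by field_simp
    have l2 : qform ζ X' < 0 := by rw [qform_comm]; exact hζ.2 _
    rw [e]
    calc ‖X‖ * (qform (‖X‖⁻¹ • X - ζ) X' + qform ζ X') ≤ ‖X‖ * (ε / 2 * ‖X'‖) :=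
          mul_le_mul_of_nonneg_left (by linarith) hX.le
      _ = _ := by ring
  have h5 : ε / 2 * (‖X‖ * ‖X'‖) < 1 := by linarith
  have h6 : (ε / 2 * (‖X‖ * ‖X'‖)) ^ 2 < 1 := by
    rw [sq_lt_one_iff₀ (by positivity)]; exact h5
  have h7 := one_le_norm_sq (S := S) (y' (φ n))
  rw [← hX'] at h7
  have h8 : 4 * K / ε ^ 2 * ε ^ 2 = 4 * K := by field_simp
  have h9 : 4 * K < ε ^ 2 * ‖X‖ ^ 2 := by
    have := mul_le_mul_of_nonneg_right h2 (sq_nonneg ε)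
    nlinarith [sq_pos_of_pos hε]
  have h10 : 4 ≤ 4 * K * (‖X'‖ * ‖X'‖) := by
    have : K * ‖X'‖ * ‖X'‖ = K * (‖X'‖ * ‖X'‖) := by ring
    linarith
  have h11 := mul_lt_mul_of_pos_right h9 (mul_pos hXp hXp)
  have h12 : (ε / 2 * (‖X‖ * ‖X'‖)) ^ 2 = ε ^ 2 * ‖X‖ ^ 2 * (‖X'‖ * ‖X'‖) / 4 := by ring
  linarith

/-- Any two points of an entire maximal surface are not causally related. -/
theorem IsEntireMaximal.achronal (H : S.IsEntireMaximal) (y y' : Fin 2 → ℝ) :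
    qform (S.emb y) (S.emb y') ≤ -1 := by
  by_contra! hcon
  obtain ⟨F⟩ := S.nonempty_movingFrame
  have hq := F.orthoFrame 0
  set q := S.emb 0 with hqdef
  set p₁ := F.e₁ 0
  set p₂ := F.e₂ 0
  obtain ⟨C, hC, hCle⟩ := H.exists_norm_le (S.cone_neg_emb 0)
  have hℓ : ∀ z, 0 < -qform q (S.emb z) := fun z => by
    have := H.qform_pos_of_cone (S.cone_neg_emb 0) z
    rwa [qform_neg_right, qform_comm] at this
  have hCle' : ∀ z, ‖S.emb z‖ ≤ C * -qform q (S.emb z) := fun z => by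
    have := hCle z
    rwa [qform_neg_right, qform_comm] at this
  set K := ‖qformCLM‖ * (‖p₁‖ + ‖p₂‖) * C with hK
  have hK0 : 0 ≤ K := by positivity
  have hb : ∀ z, |qform p₁ (S.emb z)| ≤ K * -qform q (S.emb z) ∧
      |qform p₂ (S.emb z)| ≤ K * -qform q (S.emb z) := by
    have aux : ∀ p : Fin 4 → ℝ, ‖p‖ ≤ ‖p₁‖ + ‖p₂‖ → ∀ z,
        |qform p (S.emb z)| ≤ K * -qform q (S.emb z) := fun p hp z =>
      calc |qform p (S.emb z)| ≤ ‖qformCLM‖ * ‖p‖ * ‖S.emb z‖ := qform_le_norm _ _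
        _ ≤ ‖qformCLM‖ * (‖p₁‖ + ‖p₂‖) * (C * -qform q (S.emb z)) :=
          mul_le_mul (mul_le_mul_of_nonneg_left hp (norm_nonneg qformCLM)) (hCle' z) (norm_nonneg _)
            (by positivity)
        _ = _ := by rw [hK]; ring
    exact fun z => ⟨aux p₁ (by linarith [norm_nonneg p₂]) z, aux p₂ (by linarith [norm_nonneg p₁]) z⟩
  set δ := 1 / (4 * K ^ 2 + 1) with hδ
  have hδ0 : 0 < δ := by positivity
  have hδ1 : δ ≤ 1 := by
    rw [hδ, div_le_one (by positivity)]; nlinarith [sq_nonneg K]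
  have hδK : δ * (2 * K ^ 2) ≤ 1 / 2 := by
    rw [hδ, div_mul_eq_mul_div, div_le_div_iff₀ (by positivity) (by norm_num)]; linarith
  let Qf : (Fin 4 → ℝ) → (Fin 4 → ℝ) → ℝ := fun x z =>
    qform q x * qform q z - δ * (qform p₁ x * qform p₁ z + qform p₂ x * qform p₂ z)
  have hQ : ∀ z z', 1 / 2 * (qform q (S.emb z) * qform q (S.emb z')) ≤ Qf (S.emb z) (S.emb z') := by
    intro z z'
    have k : ∀ p : Fin 4 → ℝ, (∀ z, |qform p (S.emb z)| ≤ K * -qform q (S.emb z)) →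
        qform p (S.emb z) * qform p (S.emb z')
          ≤ K ^ 2 * (qform q (S.emb z) * qform q (S.emb z')) := fun p hp =>
      calc _ ≤ |qform p (S.emb z)| * |qform p (S.emb z')| := by
            rw [← abs_mul]; exact le_abs_self _
        _ ≤ (K * -qform q (S.emb z)) * (K * -qform q (S.emb z')) :=
          mul_le_mul (hp z) (hp z') (abs_nonneg _) (mul_nonneg hK0 (hℓ z).le)
        _ = _ := by ring
    have k1 := k p₁ fun z => (hb z).1
    have k2 := k p₂ fun z => (hb z).2
    have k3 : 0 < qform q (S.emb z) * qform q (S.emb z') := by nlinarith [hℓ z, hℓ z']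
    have k4 : δ * (qform p₁ (S.emb z) * qform p₁ (S.emb z')
        + qform p₂ (S.emb z) * qform p₂ (S.emb z'))
        ≤ δ * (2 * K ^ 2) * (qform q (S.emb z) * qform q (S.emb z')) := by
      rw [mul_assoc]
      exact mul_le_mul_of_nonneg_left (by linarith) hδ0.le
    have k5 := mul_le_mul_of_nonneg_right hδK k3.le
    change _ ≤ _ - _
    linarith
  have hQpos : ∀ z z', 0 < Qf (S.emb z) (S.emb z') := fun z z' => by
    refine lt_of_lt_of_le ?_ (hQ z z')
    nlinarith [hℓ z, hℓ z', mul_pos (hℓ z) (hℓ z')]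
  have hQn : ∀ z z', 1 / (2 * C ^ 2) * (‖S.emb z‖ * ‖S.emb z'‖) ≤ Qf (S.emb z) (S.emb z') := by
    intro z z'
    refine le_trans ?_ (hQ z z')
    rw [div_mul_eq_mul_div, div_le_iff₀ (by positivity)]
    have := mul_le_mul (hCle' z) (hCle' z') (norm_nonneg _) (mul_nonneg hC.le (hℓ z).le)
    linarith
  let Φ : (Fin 4 → ℝ) × (Fin 4 → ℝ) → ℝ := fun x => (1 + qform x.1 x.2) / Qf x.1 x.2
  have hcont : ContinuousOn Φ (range S.emb ×ˢ range S.emb) := by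
    refine ContinuousOn.div (continuous_const.add continuous_qform).continuousOn ?_ ?_
    · have c1 : ∀ p : Fin 4 → ℝ, Continuous fun x : (Fin 4 → ℝ) × (Fin 4 → ℝ) => qform p x.1 :=
        fun p => continuous_const.qform continuous_fst
      have c2 : ∀ p : Fin 4 → ℝ, Continuous fun x : (Fin 4 → ℝ) × (Fin 4 → ℝ) => qform p x.2 :=
        fun p => continuous_const.qform continuous_snd
      exact (((c1 q).mul (c2 q)).sub (continuous_const.mul
        (((c1 p₁).mul (c2 p₁)).add ((c1 p₂).mul (c2 p₂))))).continuousOn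
    · rintro ⟨x, z⟩ ⟨⟨a, rfl⟩, b, rfl⟩
      exact (hQpos a b).ne'
  set r := Φ (S.emb y, S.emb y') with hr
  have hr0 : 0 < r := div_pos (by change 0 < 1 + qform (S.emb y) (S.emb y'); linarith) (hQpos y y')
  obtain ⟨R, hR⟩ := H.asymptotic_le (ε := r * (1 / (2 * C ^ 2))) (by positivity)
  have hbd : ∀ z z', R ≤ ‖S.emb z‖ → 1 + qform (S.emb z) (S.emb z') ≤ r * Qf (S.emb z) (S.emb z') :=
    fun z z' h => (hR z z' h).trans (by
      rw [mul_assoc]; exact mul_le_mul_of_nonneg_left (hQn z z') hr0.le)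
  obtain ⟨⟨x, x'⟩, ⟨⟨z, rfl⟩, z', rfl⟩, hmax⟩ := ContinuousOn.exists_isMaxOn' hcont
    (H.isClosed_range.prod H.isClosed_range) (x₀ := (S.emb y, S.emb y')) ⟨⟨y, rfl⟩, y', rfl⟩ (by
      rw [eventually_inf_principal]
      have hev : ∀ᶠ x : (Fin 4 → ℝ) × (Fin 4 → ℝ) in cocompact _, R ≤ ‖x‖ :=
        tendsto_norm_cocompact_atTop.eventually_ge_atTop _
      filter_upwards [hev]
      rintro ⟨x, x'⟩ hx ⟨⟨a, rfl⟩, b, rfl⟩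
      change (1 + qform (S.emb a) (S.emb b)) / Qf (S.emb a) (S.emb b) ≤ r
      rw [div_le_iff₀ (hQpos a b)]
      rcases le_max_iff.1 (hx.trans_eq (Prod.norm_def _)) with h | h
      · exact hbd a b h
      · have := hbd b a h
        rw [qform_comm] at this
        refine this.trans_eq ?_
        simp only [Qf]; ring)
  set M := Φ (S.emb z, S.emb z') with hM
  have hM0 : 0 < M := lt_of_lt_of_le hr0 (hmax (show (S.emb y, S.emb y') ∈ _ from ⟨⟨y, rfl⟩, y', rfl⟩))
  have hval : qform (twist q p₁ p₂ M δ (S.emb z)) (S.emb z') = -1 := by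
    have : M * Qf (S.emb z) (S.emb z') = 1 + qform (S.emb z) (S.emb z') := by
      rw [hM]; exact div_mul_cancel₀ _ (hQpos z z').ne'
    rw [qform_twist]
    change _ - M * Qf (S.emb z) (S.emb z') = _
    rw [this]; ring
  refine not_isMax_twist H.maximal hq hM0 hδ0 hδ1 (y := z) (y' := z') ?_ (fun a b => ?_) hval
  · have := hQpos z' z'
    simp only [Qf] at this
    nlinarith
  · rw [hval, qform_twist]
    have h1 : Φ (S.emb a, S.emb b) ≤ M :=
      hmax (show (S.emb a, S.emb b) ∈ _ from ⟨⟨a, rfl⟩, b, rfl⟩)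
    have h2 : 1 + qform (S.emb a) (S.emb b) ≤ M * Qf (S.emb a) (S.emb b) :=
      (div_le_iff₀ (hQpos a b)).1 h1
    change _ - M * Qf (S.emb a) (S.emb b) ≤ _
    linarith

end SpacelikeSurface

namespace SpacelikeSurface

variable {S : SpacelikeSurface}

/-- Sweeping the surface along its normals and the position vector covers a neighbourhood. -/
lemma map_nhds_tube (S : SpacelikeSurface) (y : Fin 2 → ℝ) :
    map (fun q : (Fin 2 → ℝ) × ℝ × ℝ => (1 + q.2.1) • S.emb q.1 + q.2.2 • S.normal q.1)
      (𝓝 (y, 0, 0)) = 𝓝 (S.emb y) := by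
  obtain ⟨F⟩ := S.nonempty_movingFrame
  set Φ : (Fin 2 → ℝ) × ℝ × ℝ → Fin 4 → ℝ :=
    fun q => (1 + q.2.1) • S.emb q.1 + q.2.2 • S.normal q.1 with hΦ
  have hsm : ContDiff ℝ ∞ Φ :=
    ((contDiff_const.add (contDiff_fst.comp contDiff_snd)).smul (S.contDiff_emb.comp contDiff_fst)).add
      ((contDiff_snd.comp contDiff_snd).smul (S.contDiff_normal.comp contDiff_fst))
  have hs : HasStrictFDerivAt Φ (fderiv ℝ Φ (y, 0, 0)) (y, 0, 0) :=
    hsm.contDiffAt.hasStrictFDerivAt (by simp)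
  have hd : ∀ v r s, fderiv ℝ Φ (y, 0, 0) (v, r, s)
      = fderiv ℝ S.emb y v + r • S.emb y + s • S.normal y := fun v r s => by
    have hX : HasFDerivAt (fun q : (Fin 2 → ℝ) × ℝ × ℝ => S.emb q.1) _ (y, (0 : ℝ), (0 : ℝ)) :=
      HasFDerivAt.comp (y, (0 : ℝ), (0 : ℝ))
        ((S.contDiff_emb.differentiable (by simp)) y).hasFDerivAt hasFDerivAt_fst
    have hN : HasFDerivAt (fun q : (Fin 2 → ℝ) × ℝ × ℝ => S.normal q.1) _ (y, (0 : ℝ), (0 : ℝ)) :=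
      HasFDerivAt.comp (y, (0 : ℝ), (0 : ℝ))
        ((S.contDiff_normal.differentiable (by simp)) y).hasFDerivAt hasFDerivAt_fst
    have hp : HasFDerivAt (fun q : (Fin 2 → ℝ) × ℝ × ℝ => q.2) _ (y, (0 : ℝ), (0 : ℝ)) :=
      hasFDerivAt_snd (𝕜 := ℝ) (E := Fin 2 → ℝ) (F := ℝ × ℝ)
    have h1 : HasFDerivAt (fun q : (Fin 2 → ℝ) × ℝ × ℝ => 1 + q.2.1) _ (y, (0 : ℝ), (0 : ℝ)) :=
      hp.fst.const_add 1
    have h2 : HasFDerivAt (fun q : (Fin 2 → ℝ) × ℝ × ℝ => q.2.2) _ (y, (0 : ℝ), (0 : ℝ)) :=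
      hp.snd
    have h3 : HasFDerivAt Φ _ (y, (0 : ℝ), (0 : ℝ)) := (h1.smul hX).add (h2.smul hN)
    rw [h3.fderiv]
    simp
  have hsurj : (fderiv ℝ Φ (y, 0, 0)).range = ⊤ := by
    rw [LinearMap.range_eq_top]
    intro w
    refine ⟨(qform w (F.e₁ y) • F.E₁ y + qform w (F.e₂ y) • F.E₂ y, -qform w (S.emb y),
      -qform w (S.normal y)), ?_⟩
    refine (hd _ _ _).trans ?_
    rw [map_add, map_smul, map_smul]
    refine Eq.trans ?_ ((F.orthoFrame y).expand w).symm
    simp only [MovingFrame.e₁, MovingFrame.e₂]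
    module
  have := hs.map_nhds_eq_of_surj hsurj
  rwa [show Φ (y, 0, 0) = S.emb y by simp [hΦ]] at this

lemma IsEntireMaximal.isClosedEmbedding (H : S.IsEntireMaximal) :
    Topology.IsClosedEmbedding S.emb := by
  refine ⟨⟨⟨le_antisymm ?_ ?_⟩, S.inj⟩, H.isClosed_range⟩
  · exact continuous_emb.le_induced
  · rw [le_iff_nhds]
    intro y U hU
    rw [nhds_induced, mem_comap]
    have hV : (U ×ˢ (Ioi (-1 : ℝ) ×ˢ univ) : Set ((Fin 2 → ℝ) × ℝ × ℝ)) ∈ 𝓝 (y, (0 : ℝ), (0 : ℝ)) :=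
      prod_mem_nhds hU (prod_mem_nhds (Ioi_mem_nhds (by norm_num)) univ_mem)
    refine ⟨_, (S.map_nhds_tube y) ▸ image_mem_map hV, ?_⟩
    rintro z ⟨⟨u, r, s⟩, ⟨hu, hr, -⟩, hz⟩
    change (1 + r) • S.emb u + s • S.normal u = S.emb z at hz
    have h1 := H.achronal z u
    have h2 := S.on_quadric z
    have hn := S.normal_orth_base u
    have hn' := hn
    rw [qform_comm] at hn'
    rw [← hz, qform_add_left, qform_smul_left, qform_smul_left, S.on_quadric, hn] at h1
    rw [← hz] at h2
    simp only [qform_add_left, qform_smul_left, qform_add_right, qform_smul_right, S.on_quadric,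
      S.normal_unit, hn, hn'] at h2
    have hr0 : r = 0 := by nlinarith [sq_nonneg s]
    have hs0 : s = 0 := by
      subst hr0
      nlinarith
    subst hr0 hs0
    have : u = z := S.inj (by simpa using hz)
    exact this ▸ hu

/-- Functions of linear growth are proper on an entire maximal surface. -/
lemma IsEntireMaximal.tendsto_qform (H : S.IsEntireMaximal) {p : Fin 4 → ℝ}
    (hp : ∀ ζ ∈ S.idealCone, 0 < qform ζ p) :
    Tendsto (fun y => qform (S.emb y) p) (cocompact _) atTop := by
  obtain ⟨C, hC, h⟩ := H.exists_norm_le hp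
  have h1 := (tendsto_norm_cocompact_atTop (E := Fin 4 → ℝ)).comp H.isClosedEmbedding.tendsto_cocompact
  refine tendsto_atTop_mono (fun y => ?_) (h1.const_mul_atTop (inv_pos.2 hC))
  change C⁻¹ * ‖S.emb y‖ ≤ _
  rw [inv_mul_le_iff₀ hC]
  exact h y

end SpacelikeSurface

/-! ### The Omori–Yau maximum principle -/

lemma smoothFn.two_apply (y : Fin 2 → ℝ) : (2 : smoothFn).1 y = 2 := rfl

lemma smoothFn.three_apply (y : Fin 2 → ℝ) : (3 : smoothFn).1 y = 3 := rfl

lemma smoothFn.four_apply (y : Fin 2 → ℝ) : (4 : smoothFn).1 y = 4 := rfl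

lemma smoothFn.eq_apply {φ ψ : smoothFn} (h : φ = ψ) (y : Fin 2 → ℝ) : φ.1 y = ψ.1 y := h ▸ rfl

lemma fieldDeriv_eq_deriv_mul {E : (Fin 2 → ℝ) → Fin 2 → ℝ} (hE : ContDiff ℝ ∞ E) {φ ψ : smoothFn}
    {h : ℝ → ℝ} {h' : ℝ} {y : Fin 2 → ℝ} (hψ : ∀ y, ψ.1 y = h (φ.1 y))
    (hh : HasDerivAt h h' (φ.1 y)) :
    (fieldDeriv E hE ψ).1 y = h' * (fieldDeriv E hE φ).1 y := by
  have := hh.comp_hasFDerivAt y (smoothFn.differentiable φ y).hasFDerivAt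
  rw [fieldDeriv_apply, fieldDeriv_apply, show ψ.1 = h ∘ φ.1 from funext hψ, this.fderiv]
  simp

namespace MovingFrame

variable {S : SpacelikeSurface} (F : MovingFrame S)

lemma gradSq_apply (p : Fin 4 → ℝ) (y : Fin 2 → ℝ) :
    (F.gradSq p).1 y = (S.f p).1 y ^ 2 + (S.g p).1 y ^ 2 + qform p p := by
  have := smoothFn.eq_apply (F.sq_add_sq p) y
  rw [gradSq]
  simpa using this

lemma gradSq_nonneg (p : Fin 4 → ℝ) (y : Fin 2 → ℝ) : 0 ≤ (F.gradSq p).1 y :=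
  add_nonneg (sq_nonneg ((F.f₁ p).1 y)) (sq_nonneg ((F.f₂ p).1 y))

/-- There is a proper function with bounded gradient and Laplacian bounded above. -/
lemma exists_exhaustion (H : S.IsEntireMaximal) (hQ : ∀ y, F.Q.1 y ≤ 1) :
    ∃ ψ : smoothFn, (∀ y, 0 ≤ ψ.1 y) ∧ Tendsto ψ.1 (cocompact _) atTop ∧
      ∀ y, (F.D₁ ψ).1 y ^ 2 + (F.D₂ ψ).1 y ^ 2 ≤ 8 ∧ (F.lap ψ).1 y ≤ 8 := by
  set p := -S.emb 0 with hp
  have hqp : qform p p = -1 := by rw [hp, qform_neg_left, qform_neg_right, neg_neg, S.on_quadric]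
  set Y : smoothFn := 1 + F.gradSq p with hY
  have hY' : ∀ y, Y.1 y = (S.f p).1 y ^ 2 + (S.g p).1 y ^ 2 := fun y => by
    have := F.gradSq_apply p y
    rw [hqp] at this
    change 1 + (F.gradSq p).1 y = _
    linarith
  have hY1 : ∀ y, 1 ≤ Y.1 y := fun y => by
    change 1 ≤ 1 + (F.gradSq p).1 y
    linarith [F.gradSq_nonneg p y]
  have hY0 : ∀ y, 0 < Y.1 y := fun y => one_pos.trans_le (hY1 y)
  set ψ : smoothFn := ⟨fun y => Real.log (Y.1 y), (smoothFn.contDiff Y).log fun y => (hY0 y).ne'⟩ with hψ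
  have hD : ∀ {E : (Fin 2 → ℝ) → Fin 2 → ℝ} (hE : ContDiff ℝ ∞ E),
      Y * fieldDeriv E hE ψ = fieldDeriv E hE Y := fun hE => by
    ext y
    change Y.1 y * (fieldDeriv _ hE ψ).1 y = _
    rw [fieldDeriv_eq_deriv_mul hE (φ := Y) (fun y => rfl) (Real.hasDerivAt_log (hY0 y).ne'),
      mul_inv_cancel_left₀ (hY0 y).ne']
  have h1 : Y * F.D₁ ψ = F.D₁ Y := hD F.smooth₁
  have h2 : Y * F.D₂ ψ = F.D₂ Y := hD F.smooth₂
  have hDY1 : F.D₁ Y = F.D₁ (F.gradSq p) := by rw [hY, map_add, Derivation.map_one_eq_zero, zero_add]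
  have hDY2 : F.D₂ Y = F.D₂ (F.gradSq p) := by rw [hY, map_add, Derivation.map_one_eq_zero, zero_add]
  have hlap : Y * F.lap ψ + Y * (F.D₁ ψ ^ 2 + F.D₂ ψ ^ 2) = F.lap (F.gradSq p) := by
    rw [lap, lap, ← hDY1, ← hDY2, ← h1, ← h2]
    simp only [Derivation.leibniz, smul_eq_mul, ← h1, ← h2]
    ring
  refine ⟨ψ, fun y => Real.log_nonneg (hY1 y), ?_, fun y => ?_⟩
  · refine Real.tendsto_log_atTop.comp (tendsto_atTop_mono (fun y => ?_)
      ((tendsto_pow_atTop two_ne_zero).comp (H.tendsto_qform (S.cone_neg_emb 0))))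
    rw [hY']
    exact le_add_of_nonneg_right (sq_nonneg _)
  · have e1 := smoothFn.eq_apply (h1.trans (hDY1.trans (F.D₁_gradSq p))) y
    have e2 := smoothFn.eq_apply (h2.trans (hDY2.trans (F.D₂_gradSq H.maximal p))) y
    have e3 := smoothFn.eq_apply (hlap.trans (F.lap_gradSq H.maximal p)) y
    have hG : (F.G p).1 y = F.Q.1 y * (S.g p).1 y ^ 2 := rfl
    have hF : (F.gradSq p).1 y = (F.f₁ p).1 y ^ 2 + (F.f₂ p).1 y ^ 2 := rfl
    have hQ' : F.Q.1 y = F.a.1 y ^ 2 + F.b.1 y ^ 2 := rfl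
    have hYF : Y.1 y = 1 + (F.gradSq p).1 y := rfl
    have hYy := hY' y
    have hY0y := hY0 y
    have hQy := hQ y
    simp only [Subalgebra.coe_add, Subalgebra.coe_sub, Subalgebra.coe_mul, Subalgebra.coe_pow, Subalgebra.coe_one,
      Pi.add_apply, Pi.sub_apply, Pi.mul_apply, Pi.pow_apply, Pi.one_apply, smoothFn.two_apply,
      smoothFn.four_apply] at e1 e2 e3
    clear_value Y ψ
    clear hψ hY hp h1 h2 hDY1 hDY2 hlap hD hY' hY1 hY0 hQ
    generalize Y.1 y = Y at *
    generalize (F.D₁ ψ).1 y = u at *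
    generalize (F.D₂ ψ).1 y = v at *
    generalize (F.lap ψ).1 y = l at *
    generalize (S.f p).1 y = f at *
    generalize (S.g p).1 y = g at *
    rw [hG] at e3
    generalize (F.f₁ p).1 y = s at *
    generalize (F.f₂ p).1 y = t at *
    generalize (F.gradSq p).1 y = W at *
    generalize F.a.1 y = a at *
    generalize F.b.1 y = b at *
    generalize F.Q.1 y = q at *
    have hq0 : 0 ≤ q := by rw [hQ']; positivity
    have hW0 : 0 ≤ W := by rw [hF]; positivity
    have hg : q * g ^ 2 ≤ g ^ 2 := mul_le_of_le_one_left (sq_nonneg g) hQy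
    constructor
    · have hid : Y ^ 2 * (u ^ 2 + v ^ 2) = 8 * W * (f ^ 2 + q * g ^ 2)
          - 4 * ((s * (f - a * g) - t * (b * g)) ^ 2 + (t * (f + a * g) - s * (b * g)) ^ 2) := by
        rw [show Y ^ 2 * (u ^ 2 + v ^ 2) = (Y * u) ^ 2 + (Y * v) ^ 2 by ring, e1, e2, hF, hQ']
        ring
      have h3 : 8 * W * (f ^ 2 + q * g ^ 2) ≤ 8 * Y * Y := by
        apply mul_le_mul <;> first | positivity | linarith
      have h4 : Y ^ 2 * (u ^ 2 + v ^ 2) ≤ Y ^ 2 * 8 := by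
        rw [hid]
        nlinarith [sq_nonneg (s * (f - a * g) - t * (b * g)), sq_nonneg (t * (f + a * g) - s * (b * g))]
      exact le_of_mul_le_mul_left h4 (by positivity)
    · have h5 : Y * l ≤ Y * 8 := by
        have : 0 ≤ Y * (u ^ 2 + v ^ 2) := by positivity
        have : q * W ≤ W := mul_le_of_le_one_left hW0 hQy
        nlinarith
      exact le_of_mul_le_mul_left h5 hY0y

/-- The Omori–Yau maximum principle. -/
lemma omori_yau (H : S.IsEntireMaximal) (hQ : ∀ y, F.Q.1 y ≤ 1) {φ : smoothFn} {M : ℝ}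
    (hφ : ∀ y, φ.1 y ≤ M) {ε : ℝ} (hε : 0 < ε) (y₁ : Fin 2 → ℝ) :
    ∃ y, φ.1 y₁ - ε ≤ φ.1 y ∧ (F.D₁ φ).1 y ^ 2 + (F.D₂ φ).1 y ^ 2 ≤ ε ^ 2 ∧ (F.lap φ).1 y ≤ ε := by
  obtain ⟨ψ, hψ0, hψ, hb⟩ := F.exists_exhaustion H hQ
  have hpos : 0 < 8 + ψ.1 y₁ := by linarith [hψ0 y₁]
  set δ := ε / (8 + ψ.1 y₁) with hδ
  have hδ0 : 0 < δ := div_pos hε hpos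
  have hδε : 8 * δ + δ * ψ.1 y₁ = ε := by rw [hδ]; field_simp
  set χ : smoothFn := φ - algebraMap ℝ smoothFn δ * ψ with hχ
  have hχy : ∀ y, χ.1 y = φ.1 y - δ * ψ.1 y := fun y => rfl
  obtain ⟨y, hy⟩ := (smoothFn.contDiff χ).continuous.exists_forall_ge
    (tendsto_atBot_mono (fun y => by rw [hχy]; exact sub_le_sub_right (hφ y) _)
      (tendsto_const_nhds.add_atBot (tendsto_neg_atTop_atBot.comp (hψ.const_mul_atTop hδ0))))
  obtain ⟨h1, h2, h3⟩ := F.of_isLocalMax (φ := χ) (y := y) (Eventually.of_forall hy)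
  have e1 : F.D₁ χ = F.D₁ φ - algebraMap ℝ smoothFn δ * F.D₁ ψ := by
    simp [hχ, Derivation.leibniz]
  have e2 : F.D₂ χ = F.D₂ φ - algebraMap ℝ smoothFn δ * F.D₂ ψ := by
    simp [hχ, Derivation.leibniz]
  have e3 : F.lap χ = F.lap φ - algebraMap ℝ smoothFn δ * F.lap ψ := by
    rw [hχ, lap_sub, lap_mul, lap_algebraMap]
    simp
  rw [e1] at h1
  rw [e2] at h2
  rw [e3] at h3
  change (F.D₁ φ).1 y - δ * (F.D₁ ψ).1 y = 0 at h1
  change (F.D₂ φ).1 y - δ * (F.D₂ ψ).1 y = 0 at h2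
  change (F.lap φ).1 y - δ * (F.lap ψ).1 y ≤ 0 at h3
  have h4 := hy y₁
  rw [hχy, hχy] at h4
  have h5 := mul_nonneg hδ0.le (hψ0 y)
  have h6 := mul_nonneg hδ0.le (hψ0 y₁)
  refine ⟨y, by linarith, ?_, by nlinarith [(hb y).2]⟩
  rw [sub_eq_zero.1 h1, sub_eq_zero.1 h2, show (δ * (F.D₁ ψ).1 y) ^ 2 + (δ * (F.D₂ ψ).1 y) ^ 2
    = δ ^ 2 * ((F.D₁ ψ).1 y ^ 2 + (F.D₂ ψ).1 y ^ 2) by ring]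
  calc _ ≤ δ ^ 2 * 8 := mul_le_mul_of_nonneg_left (hb y).1 (sq_nonneg _)
    _ ≤ (8 * δ) ^ 2 := by nlinarith
    _ ≤ ε ^ 2 := by gcongr; linarith

end MovingFrame

/-! ### The gradient estimate for the ratio of linear functions -/

lemma twisted_gradient_lower_bound {a b s t f g c : ℝ} (hc : 0 ≤ c) (hf : 0 < f)
    (hab : a ^ 2 + b ^ 2 ≤ c ^ 2) (hg : c * f ≤ g) :
    (s ^ 2 + t ^ 2) * (g - c * f) ^ 2 ≤
      (f * (a * s + b * t) - g * s) ^ 2 + (f * (b * s - a * t) - g * t) ^ 2 := by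
  set z := a * (s ^ 2 - t ^ 2) + 2 * b * s * t with hz
  have hW : 0 ≤ s ^ 2 + t ^ 2 := by positivity
  obtain ⟨r, hr0, hr⟩ : ∃ r : ℝ, 0 ≤ r ∧ r ^ 2 = a ^ 2 + b ^ 2 :=
    ⟨√(a ^ 2 + b ^ 2), Real.sqrt_nonneg _, Real.sq_sqrt (by positivity)⟩
  have hrc : r ≤ c := by
    rw [← hr] at hab
    exact (abs_le_of_sq_le_sq hab hc).trans' (le_abs_self r)
  have hz2 : z ^ 2 ≤ (r * (s ^ 2 + t ^ 2)) ^ 2 := by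
    have h1 : z ^ 2 + (b * (s ^ 2 - t ^ 2) - 2 * a * s * t) ^ 2
        = (r * (s ^ 2 + t ^ 2)) ^ 2 := by rw [hz, mul_pow, hr]; ring
    linarith [sq_nonneg (b * (s ^ 2 - t ^ 2) - 2 * a * s * t)]
  have hz' : z ≤ r * (s ^ 2 + t ^ 2) := (le_abs_self z).trans (abs_le_of_sq_le_sq hz2 (by positivity))
  have hg0 : 0 ≤ g := le_trans (by positivity) hg
  have hid : (f * (a * s + b * t) - g * s) ^ 2 + (f * (b * s - a * t) - g * t) ^ 2
      = (s ^ 2 + t ^ 2) * (g ^ 2 + r ^ 2 * f ^ 2) - 2 * (f * g) * z := by rw [hz, hr]; ring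
  have h1 : (f * g) * z ≤ (f * g) * (r * (s ^ 2 + t ^ 2)) :=
    mul_le_mul_of_nonneg_left hz' (by positivity)
  have h2 : (g - c * f) ^ 2 ≤ (g - r * f) ^ 2 := by
    have : r * f ≤ c * f := mul_le_mul_of_nonneg_right hrc hf.le
    apply pow_le_pow_left₀ <;> linarith
  calc _ ≤ (s ^ 2 + t ^ 2) * (g - r * f) ^ 2 := mul_le_mul_of_nonneg_left h2 hW
    _ ≤ _ := by rw [hid]; linarith

lemma ratio_estimate_contradiction {a b s t f g u σ Λ P A₁ A₂ k T : ℝ} (hΛ0 : 0 ≤ Λ) (hf : 0 < f)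
    (hg : Λ * f ≤ σ * g) (hσ : σ ^ 2 = 1) (hQ : a ^ 2 + b ^ 2 ≤ Λ ^ 2)
    (hW : s ^ 2 + t ^ 2 = f ^ 2 + g ^ 2 + P) (hK : -2 * P ≤ f ^ 2) (hu : u * f = σ * g)
    (hA : A₁ ^ 2 + A₂ ^ 2 ≤ (k / 2) ^ 2) (hT : 0 < 1 + T) (hk : 0 < k) (hkT : k * (1 + T) = T - Λ)
    (hTu : T ≤ u) (h₁ : (f ^ 2 + g ^ 2) * A₁ = f * (σ * (a * s + b * t)) - σ * g * s)
    (h₂ : (f ^ 2 + g ^ 2) * A₂ = f * (σ * (b * s - a * t)) - σ * g * t) : False := by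
  have key := twisted_gradient_lower_bound (a := σ * a) (b := σ * b) (s := s) (t := t) hΛ0 hf
    (by rw [mul_pow, mul_pow, hσ]; linarith) hg
  have e : f ^ 2 + g ^ 2 = f ^ 2 * (1 + u ^ 2) := by
    linear_combination (-(u * f) - σ * g) * hu - g ^ 2 * hσ
  have hlow : (f ^ 2 * (1 + u ^ 2)) / 2 ≤ s ^ 2 + t ^ 2 := by
    rw [hW, ← e]; linarith [sq_nonneg g]
  have hR : (f ^ 2 * (1 + u ^ 2)) ^ 2 * (A₁ ^ 2 + A₂ ^ 2)
      = (f * (σ * a * s + σ * b * t) - σ * g * s) ^ 2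
        + (f * (σ * b * s - σ * a * t) - σ * g * t) ^ 2 := by
    rw [← e, mul_add, ← mul_pow, ← mul_pow, h₁, h₂]; ring
  rw [← hR, ← hu, show u * f - Λ * f = (u - Λ) * f by ring] at key
  have h1 : (f ^ 2 * (1 + u ^ 2)) / 2 * ((u - Λ) * f) ^ 2
      ≤ (f ^ 2 * (1 + u ^ 2)) ^ 2 * (k / 2) ^ 2 :=
    (mul_le_mul_of_nonneg_right hlow (sq_nonneg _)).trans
      (key.trans (mul_le_mul_of_nonneg_left hA (sq_nonneg _)))
  have hu0 : 0 ≤ u := by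
    have : 0 ≤ u * f := hu ▸ le_trans (by positivity) hg
    exact nonneg_of_mul_nonneg_left this hf
  have h2 : (u - Λ) ^ 2 ≤ (1 + u ^ 2) * (k ^ 2 / 2) := by
    have hm : 0 < f ^ 4 * (1 + u ^ 2) := by positivity
    refine le_of_mul_le_mul_left ?_ hm
    linear_combination 2 * h1
  have h3 : k * (1 + u) ≤ u - Λ := by
    refine le_of_mul_le_mul_right ?_ hT
    rw [mul_right_comm, hkT]
    linear_combination (1 + Λ) * hTu
  have h4 : (k * (1 + u)) ^ 2 ≤ (u - Λ) ^ 2 := pow_le_pow_left₀ (by positivity) h3 2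
  have h5 : 0 < k ^ 2 * (1 + u ^ 2) := by positivity
  have h6 : 0 ≤ k ^ 2 * u := by positivity
  linarith [show (k * (1 + u)) ^ 2 = k ^ 2 * (1 + u ^ 2) + 2 * (k ^ 2 * u) by ring,
    show (1 + u ^ 2) * (k ^ 2 / 2) = k ^ 2 * (1 + u ^ 2) / 2 by ring]

namespace MovingFrame

variable {S : SpacelikeSurface} (F : MovingFrame S)

lemma mul_g_le (H : S.IsEntireMaximal) {Λ : ℝ} (hΛ0 : 0 ≤ Λ) (hΛ1 : Λ < 1)
    (hQ : ∀ y, F.Q.1 y ≤ Λ ^ 2) {p : Fin 4 → ℝ} (hp : ∀ y, 0 < (S.f p).1 y) {c : ℝ} (hc : Λ ≤ c)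
    {σ : ℝ} (hσ : σ ^ 2 = 1)
    (h : ∀ y, (S.f p).1 y ^ 2 < -2 * qform p p → σ * (S.g p).1 y ≤ c * (S.f p).1 y)
    (y₁ : Fin 2 → ℝ) : σ * (S.g p).1 y₁ ≤ c * (S.f p).1 y₁ := by
  by_contra! hlt
  set u : smoothFn := ⟨fun y => σ * (S.g p).1 y / (S.f p).1 y,
    (contDiff_const.mul (smoothFn.contDiff (S.g p))).div (smoothFn.contDiff (S.f p))
      fun y => (hp y).ne'⟩ with hu
  have hufy : ∀ y, u.1 y * (S.f p).1 y = σ * (S.g p).1 y := fun y => div_mul_cancel₀ _ (hp y).ne'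
  have huf : u * S.f p = algebraMap ℝ smoothFn σ * S.g p := by ext y; exact hufy y
  set A : smoothFn := ⟨fun y => arctan (u.1 y), (smoothFn.contDiff u).arctan⟩ with hA
  have hlt' : arctan c < A.1 y₁ := arctan_strictMono ((lt_div_iff₀ (hp y₁)).2 hlt)
  set θ := (A.1 y₁ + arctan c) / 2 with hθ
  have hθ1 : arctan c < θ := by rw [hθ]; linarith
  have hθ2 : θ < A.1 y₁ := by rw [hθ]; linarith
  set T := tan θ with hT
  have hTθ : arctan T = θ := arctan_tan ((neg_pi_div_two_lt_arctan c).trans hθ1)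
    (hθ2.trans (arctan_lt_pi_div_two _))
  have hcT : c < T := arctan_lt_arctan_iff.1 (hTθ ▸ hθ1)
  set k := (T - Λ) / (1 + T) with hk
  have hT1 : 0 < 1 + T := by linarith
  have hk0 : 0 < k := div_pos (by linarith) hT1
  obtain ⟨y, hy1, hy2, -⟩ := F.omori_yau H (φ := A) (M := π / 2)
    (fun y => (hQ y).trans (by nlinarith)) (fun y => (arctan_lt_pi_div_two _).le)
    (ε := min (A.1 y₁ - θ) (k / 2)) (lt_min (by linarith) (by linarith)) y₁
  have hTu : T ≤ u.1 y := by
    have : θ ≤ A.1 y := by linarith [min_le_left (A.1 y₁ - θ) (k / 2)]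
    rw [← hTθ] at this
    exact arctan_le_arctan_iff.1 this
  have hfy := hp y
  have hcf : c * (S.f p).1 y < σ * (S.g p).1 y := by
    rw [← hufy]; exact mul_lt_mul_of_pos_right (hcT.trans_le hTu) hfy
  have hK : -2 * qform p p ≤ (S.f p).1 y ^ 2 := by
    by_contra! h'
    exact absurd (h y h') (not_le.2 hcf)
  have hD : ∀ {E : (Fin 2 → ℝ) → Fin 2 → ℝ} (hE : ContDiff ℝ ∞ E),
      ((S.f p).1 y ^ 2 + (S.g p).1 y ^ 2) * (fieldDeriv E hE A).1 y
        = (S.f p).1 y * (σ * (fieldDeriv E hE (S.g p)).1 y)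
          - (σ * (S.g p).1 y) * (fieldDeriv E hE (S.f p)).1 y := fun {E} hE => by
    have h1 := smoothFn.eq_apply (congrArg (fieldDeriv E hE) huf) y
    simp only [Derivation.leibniz, Derivation.map_algebraMap, smul_eq_mul, mul_zero, add_zero] at h1
    change u.1 y * (fieldDeriv E hE (S.f p)).1 y + (S.f p).1 y * (fieldDeriv E hE u).1 y
      = σ * (fieldDeriv E hE (S.g p)).1 y at h1
    rw [fieldDeriv_eq_deriv_mul hE (φ := u) (fun y => rfl) (hasDerivAt_arctan _), ← h1, ← hufy]
    have h2 : (S.f p).1 y ^ 2 + (S.g p).1 y ^ 2 = (S.f p).1 y ^ 2 * (1 + u.1 y ^ 2) := by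
      rw [mul_add, ← mul_pow, mul_comm _ (u.1 y), hufy, mul_pow, hσ]; ring
    rw [h2]
    have : 1 + u.1 y ^ 2 ≠ 0 := by positivity
    field_simp
    ring
  have d1 : _ = (S.f p).1 y * (σ * (F.D₁ (S.g p)).1 y) - (σ * (S.g p).1 y) * (F.D₁ (S.f p)).1 y :=
    hD F.smooth₁
  have d2 : _ = (S.f p).1 y * (σ * (F.D₂ (S.g p)).1 y) - (σ * (S.g p).1 y) * (F.D₂ (S.f p)).1 y :=
    hD F.smooth₂
  change _ * (F.D₁ A).1 y = _ at d1
  change _ * (F.D₂ A).1 y = _ at d2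
  rw [F.D₁_f, F.D₁_g] at d1
  rw [F.D₂_f, F.D₂_g H.maximal] at d2
  change _ = (S.f p).1 y * (σ * (F.a.1 y * (F.f₁ p).1 y + F.b.1 y * (F.f₂ p).1 y)) - _ at d1
  change _ = (S.f p).1 y * (σ * (F.b.1 y * (F.f₁ p).1 y - F.a.1 y * (F.f₂ p).1 y)) - _ at d2
  have hW := F.gradSq_apply p y
  change (F.f₁ p).1 y ^ 2 + (F.f₂ p).1 y ^ 2 = _ at hW
  have hQy : F.a.1 y ^ 2 + F.b.1 y ^ 2 ≤ Λ ^ 2 := hQ y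
  have huy := hufy y
  have hε : min (A.1 y₁ - θ) (k / 2) ^ 2 ≤ (k / 2) ^ 2 :=
    pow_le_pow_left₀ (le_min (by linarith) (by linarith)) (min_le_right _ _) 2
  have hkT : k * (1 + T) = T - Λ := div_mul_cancel₀ _ hT1.ne'
  replace hy2 := hy2.trans hε
  exact ratio_estimate_contradiction hΛ0 hfy (mul_le_mul_of_nonneg_right hc hfy.le |>.trans hcf.le)
    hσ hQy hW hK (hufy y) hy2 hT1 hk0 hkT hTu d1 d2

lemma abs_g_le (H : S.IsEntireMaximal) {Λ : ℝ} (hΛ0 : 0 ≤ Λ) (hΛ1 : Λ < 1)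
    (hQ : ∀ y, F.Q.1 y ≤ Λ ^ 2) {p : Fin 4 → ℝ} (hp : ∀ y, 0 < (S.f p).1 y) {c : ℝ} (hc : Λ ≤ c)
    (h : ∀ y, (S.f p).1 y ^ 2 < -2 * qform p p → |(S.g p).1 y| ≤ c * (S.f p).1 y)
    (y : Fin 2 → ℝ) : |(S.g p).1 y| ≤ c * (S.f p).1 y := by
  rw [abs_le']
  constructor
  · simpa using F.mul_g_le H hΛ0 hΛ1 hQ hp hc (σ := 1) (by norm_num)
      (fun y hy => by simpa using (le_abs_self _).trans (h y hy)) y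
  · simpa using F.mul_g_le H hΛ0 hΛ1 hQ hp hc (σ := -1) (by norm_num)
      (fun y hy => by simpa using (neg_le_abs _).trans (h y hy)) y

lemma abs_g_le_of_mem_idealCone (H : S.IsEntireMaximal) {Λ : ℝ} (hΛ0 : 0 ≤ Λ) (hΛ1 : Λ < 1)
    (hQ : ∀ y, F.Q.1 y ≤ Λ ^ 2) {ζ : Fin 4 → ℝ} (hζ : ζ ∈ S.idealCone) (y : Fin 2 → ℝ) :
    |qform (S.normal y) ζ| ≤ Λ * -qform (S.emb y) ζ := by
  have hfy : ∀ y, (S.f (-ζ)).1 y = -qform (S.emb y) ζ := fun y => qform_neg_right _ _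
  have hgy : ∀ y, (S.g (-ζ)).1 y = -qform (S.normal y) ζ := fun y => qform_neg_right _ _
  have h0 : qform (-ζ) (-ζ) = 0 := by
    rw [qform_neg_left, qform_neg_right, neg_neg]; exact H.cone.null ζ hζ.1
  have := F.abs_g_le H hΛ0 hΛ1 hQ (p := -ζ) (fun y => by rw [hfy]; linarith [hζ.2 y]) le_rfl
    (fun y hy => absurd hy (by rw [h0]; simpa using sq_nonneg _)) y
  rwa [hfy, hgy, abs_neg] at this

lemma exists_abs_g_le (H : S.IsEntireMaximal) {Λ : ℝ} (hΛ0 : 0 ≤ Λ) (hΛ1 : Λ < 1)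
    (hQ : ∀ y, F.Q.1 y ≤ Λ ^ 2) {p : Fin 4 → ℝ} (hp : ∀ ζ ∈ S.idealCone, 0 < qform ζ p) :
    ∃ c, 0 ≤ c ∧ ∀ y, |(S.g p).1 y| ≤ c * (S.f p).1 y := by
  have hpos : ∀ y, 0 < (S.f p).1 y := H.qform_pos_of_cone hp
  obtain ⟨t, ht, hsub⟩ := mem_cocompact.1 ((H.tendsto_qform hp).eventually_gt_atTop
    (-2 * qform p p + 1))
  obtain ⟨C, hC⟩ := ht.exists_bound_of_continuousOn
    (f := fun y => (S.g p).1 y / (S.f p).1 y)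
    ((smoothFn.contDiff (S.g p)).continuous.div (smoothFn.contDiff (S.f p)).continuous
      fun y => (hpos y).ne').continuousOn
  refine ⟨max Λ C, hΛ0.trans (le_max_left _ _), F.abs_g_le H hΛ0 hΛ1 hQ hpos (le_max_left _ _)
    fun y hy => ?_⟩
  have hyt : y ∈ t := by
    by_contra hyt
    have h1 : -2 * qform p p + 1 < (S.f p).1 y := hsub hyt
    nlinarith [hpos y, sq_nonneg ((S.f p).1 y - 1)]
  have h2 := hC y hyt
  rw [Real.norm_eq_abs, abs_div, abs_of_pos (hpos y), div_le_iff₀ (hpos y)] at h2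
  exact h2.trans (mul_le_mul_of_nonneg_right (le_max_right _ _) (hpos y).le)

end MovingFrame

/-! ### The curvature estimate -/

lemma inner_le_of_sq_le {x y s t A w : ℝ} (hA : 0 ≤ A) (hw : 0 ≤ w) (h : x ^ 2 + y ^ 2 ≤ A ^ 2)
    (hst : s ^ 2 + t ^ 2 = w ^ 2) : x * s + y * t ≤ A * w := by
  refine (le_abs_self _).trans (abs_le_of_sq_le_sq ?_ (by positivity))
  have h1 := mul_le_mul_of_nonneg_right h (sq_nonneg w)
  rw [mul_pow]
  refine le_trans ?_ h1
  rw [← hst]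
  linarith [sq_nonneg (x * t - y * s), show (x ^ 2 + y ^ 2) * (s ^ 2 + t ^ 2)
    = (x * s + y * t) ^ 2 + (x * t - y * s) ^ 2 by ring]

lemma scale_free_contradiction {R φ τ μ : ℝ} (hφ : 0 ≤ φ) (hR : 400 ≤ R)
    (hRe : R = τ ^ 2 + 3 * φ ^ 2)
    (h₁ : 4 * μ ^ 2 + 4 * τ ^ 2 + 12 ≤ (6 + 2 * R) * φ ^ 2 + 1 / 10 + 4 / 10 * φ)
    (h₂ : 2 * (R - 3) * φ ≤ 2 * (τ * μ) + 6 * (τ * φ) + 1 / 10) : False := by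
  have hφ1 : 1 ≤ φ := by
    by_contra! h
    have h3 : (18 + 2 * R) * φ ^ 2 ≤ (18 + 2 * R) * 1 := by gcongr; nlinarith
    nlinarith [sq_nonneg μ]
  have hτR : τ ≤ R / 20 := by
    refine (le_abs_self _).trans (abs_le_of_sq_le_sq ?_ (by linarith))
    nlinarith [sq_nonneg φ]
  have h3 : τ * φ ≤ R / 20 * φ := mul_le_mul_of_nonneg_right hτR hφ
  have h4 : 84 / 100 * R * φ ≤ τ * μ := by nlinarith
  have h5 : (84 / 100 * R * φ) ^ 2 ≤ (τ * μ) ^ 2 := pow_le_pow_left₀ (by positivity) h4 2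
  have h6 : μ ^ 2 ≤ (16 / 10 + R / 2) * φ ^ 2 := by nlinarith [sq_nonneg τ]
  have h7 : (τ * μ) ^ 2 ≤ R * ((16 / 10 + R / 2) * φ ^ 2) := by
    rw [mul_pow]
    exact mul_le_mul (by nlinarith [sq_nonneg φ]) h6 (sq_nonneg _) (by linarith)
  have h8 : 0 < R * φ ^ 2 := by positivity
  have h9 : R * φ ^ 2 * (7056 / 10000 * R) ≤ R * φ ^ 2 * (16 / 10 + R / 2) := by linarith
  have := le_of_mul_le_mul_left h9 h8
  linarith

lemma curvature_estimate_contradiction {a b q s t f g W M₁ M₂ R R₁ R₂ l : ℝ} (hf : 0 < f)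
    (hq : q = a ^ 2 + b ^ 2) (hq1 : q ≤ 1) (hW : W = s ^ 2 + t ^ 2) (hR : 400 ≤ R)
    (hRe : R * f ^ 2 = q * g ^ 2 + 3 * W) (hR' : R₁ ^ 2 + R₂ ^ 2 ≤ (1 / 10) ^ 2) (hl : l ≤ 1 / 10)
    (h₁ : 2 * g * (a * M₁ + b * M₂) + 3 * (2 * (s * (f + a * g) + t * (b * g)))
      = R * (2 * (f * s)) + f ^ 2 * R₁)
    (h₂ : 2 * g * (a * M₂ - b * M₁) + 3 * (2 * (s * (b * g) + t * (f - a * g)))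
      = R * (2 * (f * t)) + f ^ 2 * R₂)
    (h₃ : 4 * (q * g ^ 2) * (2 * q - 1) + 4 * (M₁ ^ 2 + M₂ ^ 2) - 2 * q ^ 2 * W
        + 3 * (4 * f ^ 2 + 4 * (q * g ^ 2) + 2 * (1 + q) * W)
      = f ^ 2 * l + R * (4 * f ^ 2 + 2 * W) + 4 * f * (R₁ * s + R₂ * t)) : False := by
  have hq0 : 0 ≤ q := by rw [hq]; positivity
  have hW0 : 0 ≤ W := by rw [hW]; positivity
  obtain ⟨w, hw0, hw⟩ : ∃ w : ℝ, 0 ≤ w ∧ w ^ 2 = W := ⟨√W, Real.sqrt_nonneg _, Real.sq_sqrt hW0⟩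
  obtain ⟨m, hm0, hm⟩ : ∃ m : ℝ, 0 ≤ m ∧ m ^ 2 = M₁ ^ 2 + M₂ ^ 2 :=
    ⟨√(M₁ ^ 2 + M₂ ^ 2), Real.sqrt_nonneg _, Real.sq_sqrt (by positivity)⟩
  obtain ⟨γ, hγ0, hγ⟩ : ∃ γ : ℝ, 0 ≤ γ ∧ γ ^ 2 = q * g ^ 2 :=
    ⟨√(q * g ^ 2), Real.sqrt_nonneg _, Real.sq_sqrt (by positivity)⟩
  have hst : s ^ 2 + t ^ 2 = w ^ 2 := by rw [hw, hW]
  have c1 : R₁ * s + R₂ * t ≤ 1 / 10 * w := inner_le_of_sq_le (by norm_num) hw0 hR' hst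
  have c2 : -R₁ * s + -R₂ * t ≤ 1 / 10 * w :=
    inner_le_of_sq_le (by norm_num) hw0 (by simpa using hR') hst
  have c3 : (g * (a * M₁ + b * M₂)) * s + (g * (a * M₂ - b * M₁)) * t ≤ γ * m * w := by
    refine inner_le_of_sq_le (by positivity) hw0 (le_of_eq ?_) hst
    rw [mul_pow γ, hγ, hm, hq]; ring
  have c4 : (g * (a * s + b * t)) * s + (g * (b * s - a * t)) * t ≤ γ * w * w := by
    refine inner_le_of_sq_le (by positivity) hw0 (le_of_eq ?_) hst
    rw [mul_pow γ, hγ, ← hst, hq]; ring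
  have i1 : 4 * m ^ 2 + 4 * γ ^ 2 + 12 * f ^ 2
      ≤ (6 + 2 * R) * w ^ 2 + 1 / 10 * f ^ 2 + 4 / 10 * (f * w) := by
    have e1 : 0 ≤ q * (q * g ^ 2) := by positivity
    have e2 : 0 ≤ (6 * q - 2 * q ^ 2) * W := mul_nonneg (by nlinarith) hW0
    have e3 := mul_le_mul_of_nonneg_left hl (sq_nonneg f)
    have e4 := mul_le_mul_of_nonneg_left c1 hf.le
    rw [hm, hγ, hw]
    linarith [show R * (4 * f ^ 2 + 2 * W) = 4 * (R * f ^ 2) + 2 * R * W by ring]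
  have i2 : 2 * (R - 3) * (f * w) ≤ 2 * (γ * m) + 6 * (γ * w) + 1 / 10 * f ^ 2 := by
    rcases hw0.eq_or_lt with h | h
    · rw [← h]; simp; positivity
    · refine le_of_mul_le_mul_right ?_ h
      have e1 : 2 * (R - 3) * (f * w) * w = 2 * ((g * (a * M₁ + b * M₂)) * s
          + (g * (a * M₂ - b * M₁)) * t) + 6 * ((g * (a * s + b * t)) * s
          + (g * (b * s - a * t)) * t) + f ^ 2 * (-R₁ * s + -R₂ * t) := by
        linear_combination -s * h₁ - t * h₂ - 2 * (R - 3) * f * hst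
      rw [e1]
      linarith [mul_le_mul_of_nonneg_left c2 (sq_nonneg f)]
  have hf2 : f ^ 2 ≠ 0 := by positivity
  refine scale_free_contradiction (R := R) (φ := w / f) (τ := γ / f) (μ := m / f)
    (by positivity) hR ?_ ?_ ?_
  · rw [div_pow, div_pow, hγ, hw, eq_comm, ← mul_div_assoc, ← add_div, div_eq_iff hf2, hRe]
  · have : 0 < f ^ 2 := by positivity
    refine le_of_mul_le_mul_right ?_ this
    rw [show (4 * (m / f) ^ 2 + 4 * (γ / f) ^ 2 + 12) * f ^ 2
      = 4 * m ^ 2 + 4 * γ ^ 2 + 12 * f ^ 2 by field_simp]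
    refine i1.trans (le_of_eq ?_)
    field_simp
  · have : 0 < f ^ 2 := by positivity
    refine le_of_mul_le_mul_right ?_ this
    rw [show 2 * (R - 3) * (w / f) * f ^ 2 = 2 * (R - 3) * (f * w) by field_simp]
    refine i2.trans (le_of_eq ?_)
    field_simp

namespace MovingFrame

variable {S : SpacelikeSurface} (F : MovingFrame S)

/-- The principal curvature controls the ratio of the normal and position components of a vector
positive on the ideal cone. -/
lemma G_le (H : S.IsEntireMaximal) {Λ : ℝ} (hΛ0 : 0 ≤ Λ) (hΛ1 : Λ < 1)
    (hQ : ∀ y, F.Q.1 y ≤ Λ ^ 2) {p : Fin 4 → ℝ} (hp : ∀ ζ ∈ S.idealCone, 0 < qform ζ p)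
    (y₁ : Fin 2 → ℝ) : (F.G p).1 y₁ ≤ 400 * (S.f p).1 y₁ ^ 2 := by
  have hpos : ∀ y, 0 < (S.f p).1 y := H.qform_pos_of_cone hp
  have hQ1 : ∀ y, F.Q.1 y ≤ 1 := fun y => (hQ y).trans (by nlinarith)
  obtain ⟨c, hc0, hc⟩ := F.exists_abs_g_le H hΛ0 hΛ1 hQ hp
  obtain ⟨y₀, hy₀⟩ := H.exists_min hp
  replace hy₀ : ∀ y, (S.f p).1 y₀ ≤ (S.f p).1 y := hy₀
  set Z : smoothFn := F.G p + 3 * F.gradSq p with hZ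
  have hZy : ∀ y, Z.1 y = F.Q.1 y * (S.g p).1 y ^ 2 + 3 * (F.gradSq p).1 y := fun y => rfl
  have hsm : ContDiff ℝ ∞ (fun y => Z.1 y / (S.f p).1 y ^ 2) :=
    (smoothFn.contDiff Z).div ((smoothFn.contDiff (S.f p)).pow 2)
      fun y => (pow_pos (hpos y) 2).ne'
  set R : smoothFn := ⟨_, hsm⟩ with hR
  have hRZy : ∀ y, R.1 y * (S.f p).1 y ^ 2 = Z.1 y := fun y =>
    div_mul_cancel₀ _ (pow_pos (hpos y) 2).ne'
  have hRZ : R * S.f p ^ 2 = Z := by ext y; exact hRZy y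
  have hbound : ∀ y, R.1 y ≤ 4 * c ^ 2 + 3 + 3 * |qform p p| / (S.f p).1 y₀ ^ 2 := fun y => by
    have h1 : (S.g p).1 y ^ 2 ≤ c ^ 2 * (S.f p).1 y ^ 2 := by
      rw [← mul_pow, ← sq_abs]; exact pow_le_pow_left₀ (abs_nonneg _) (hc y) 2
    have h2 : |qform p p| ≤ |qform p p| / (S.f p).1 y₀ ^ 2 * (S.f p).1 y ^ 2 := by
      have := pow_pos (hpos y₀) 2
      rw [div_mul_eq_mul_div, le_div_iff₀ this]
      exact mul_le_mul_of_nonneg_left (pow_le_pow_left₀ (hpos y₀).le (hy₀ y) 2) (abs_nonneg _)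
    have h3 := mul_le_mul_of_nonneg_right (hQ1 y) (sq_nonneg ((S.g p).1 y))
    change Z.1 y / (S.f p).1 y ^ 2 ≤ _
    rw [div_le_iff₀ (pow_pos (hpos y) 2), hZy, F.gradSq_apply, mul_div_assoc]
    linarith [le_abs_self (qform p p)]
  by_contra! hlt
  have hR1 : 400 < R.1 y₁ := by
    change 400 < Z.1 y₁ / (S.f p).1 y₁ ^ 2
    rw [lt_div_iff₀ (pow_pos (hpos y₁) 2)]
    change _ < (F.G p).1 y₁ + 3 * (F.gradSq p).1 y₁
    linarith [F.gradSq_nonneg p y₁]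
  obtain ⟨y, hy1, hy2, hy3⟩ := F.omori_yau H hQ1 hbound
    (ε := min (R.1 y₁ - 400) (1 / 10)) (lt_min (by linarith) (by norm_num)) y₁
  have hε : min (R.1 y₁ - 400) (1 / 10) ^ 2 ≤ (1 / 10) ^ 2 :=
    pow_le_pow_left₀ (le_min (by linarith) (by norm_num)) (min_le_right _ _) 2
  have d1 : 2 * S.g p * (F.a * F.M₁ p + F.b * F.M₂ p)
      + 3 * (2 * (F.f₁ p * (S.f p + F.a * S.g p) + F.f₂ p * (F.b * S.g p)))
      = R * (2 * (S.f p * F.f₁ p)) + S.f p ^ 2 * F.D₁ R := by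
    have := congrArg F.D₁ hRZ
    rw [hZ, map_add, F.D₁_G H.maximal, show (3 : smoothFn) * F.gradSq p
      = algebraMap ℝ smoothFn 3 * F.gradSq p from rfl] at this
    simp only [Derivation.leibniz, pow_two, F.D₁_f, smul_eq_mul, Derivation.map_algebraMap,
      F.D₁_gradSq, mul_zero, add_zero] at this
    rw [show algebraMap ℝ smoothFn 3 = 3 from rfl] at this
    rw [← this]; ring
  have d2 : 2 * S.g p * (F.a * F.M₂ p - F.b * F.M₁ p)
      + 3 * (2 * (F.f₁ p * (F.b * S.g p) + F.f₂ p * (S.f p - F.a * S.g p)))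
      = R * (2 * (S.f p * F.f₂ p)) + S.f p ^ 2 * F.D₂ R := by
    have := congrArg F.D₂ hRZ
    rw [hZ, map_add, F.D₂_G H.maximal, show (3 : smoothFn) * F.gradSq p
      = algebraMap ℝ smoothFn 3 * F.gradSq p from rfl] at this
    simp only [Derivation.leibniz, pow_two, F.D₂_f, smul_eq_mul, Derivation.map_algebraMap,
      F.D₂_gradSq H.maximal, mul_zero, add_zero] at this
    rw [show algebraMap ℝ smoothFn 3 = 3 from rfl] at this
    rw [← this]; ring
  have d3 : 4 * F.G p * (2 * F.Q - 1) + 4 * (F.M₁ p ^ 2 + F.M₂ p ^ 2) - 2 * F.Q ^ 2 * F.gradSq p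
        + 3 * (4 * S.f p ^ 2 + 4 * F.G p + 2 * (1 + F.Q) * F.gradSq p)
      = S.f p ^ 2 * F.lap R + R * (4 * S.f p ^ 2 + 2 * F.gradSq p)
        + 4 * S.f p * (F.D₁ R * F.f₁ p + F.D₂ R * F.f₂ p) := by
    have := congrArg F.lap hRZ
    rw [hZ, F.lap_add, F.lap_G H.maximal, show (3 : smoothFn) * F.gradSq p
      = algebraMap ℝ smoothFn 3 * F.gradSq p from rfl, F.lap_mul (algebraMap ℝ smoothFn 3),
      F.lap_algebraMap, F.lap_gradSq H.maximal, pow_two (S.f p), F.lap_mul, F.lap_mul,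
      F.lap_f H.maximal] at this
    simp only [Derivation.leibniz, F.D₁_f, F.D₂_f, smul_eq_mul, Derivation.map_algebraMap,
      mul_zero, add_zero, zero_mul] at this
    rw [show algebraMap ℝ smoothFn 3 = 3 from rfl] at this
    have hg : F.gradSq p = F.f₁ p ^ 2 + F.f₂ p ^ 2 := rfl
    linear_combination (-1 : smoothFn) * this - 2 * R * hg
  have e1 := smoothFn.eq_apply d1 y
  have e2 := smoothFn.eq_apply d2 y
  have e3 := smoothFn.eq_apply d3 y
  simp only [Subalgebra.coe_add, Subalgebra.coe_sub, Subalgebra.coe_mul, Subalgebra.coe_pow,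
    Subalgebra.coe_one, Pi.add_apply, Pi.sub_apply, Pi.mul_apply, Pi.pow_apply, Pi.one_apply,
    smoothFn.two_apply, smoothFn.three_apply, smoothFn.four_apply] at e1 e2 e3
  exact curvature_estimate_contradiction (hpos y) (rfl : F.Q.1 y = _) (hQ1 y)
    (rfl : (F.gradSq p).1 y = _) (by linarith [min_le_left (R.1 y₁ - 400) (1 / 10)])
    ((hRZy y).trans (hZy y)) (hy2.trans hε) (hy3.trans (min_le_right _ _)) e1 e2 e3

end MovingFrame

/-! ### Compactness of convex hulls -/

lemma isCompact_convexJoin {E : Type*} [AddCommGroup E] [Module ℝ E] [TopologicalSpace E]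
    [ContinuousAdd E] [ContinuousSMul ℝ E] {s t : Set E} (hs : IsCompact s) (ht : IsCompact t) :
    IsCompact (convexJoin ℝ s t) := by
  have : convexJoin ℝ s t
      = (fun q : ℝ × E × E => (1 - q.1) • q.2.1 + q.1 • q.2.2) '' Icc (0 : ℝ) 1 ×ˢ s ×ˢ t := by
    ext x
    simp only [mem_convexJoin, segment_eq_image, mem_image, mem_prod, Prod.exists]
    constructor
    · rintro ⟨a, ha, b, hb, θ, hθ, rfl⟩
      exact ⟨θ, a, b, ⟨hθ, ha, hb⟩, rfl⟩
    · rintro ⟨θ, a, b, ⟨hθ, ha, hb⟩, rfl⟩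
      exact ⟨a, ha, b, hb, θ, hθ, rfl⟩
  rw [this]
  exact (isCompact_Icc.prod (hs.prod ht)).image (by fun_prop)

lemma exists_isCompact_convexHull_finset_subset {E : Type*} [AddCommGroup E] [Module ℝ E]
    [TopologicalSpace E] [ContinuousAdd E] [ContinuousSMul ℝ E] {s : Set E} (hs : IsCompact s)
    (n : ℕ) :
    ∃ K : Set E, IsCompact K ∧ s ⊆ K ∧ K ⊆ convexHull ℝ s ∧
      ∀ t : Finset E, ↑t ⊆ s → t.card ≤ n + 1 → convexHull ℝ (t : Set E) ⊆ K := by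
  classical
  induction n with
  | zero =>
    refine ⟨s, hs, subset_rfl, subset_convexHull ℝ s, fun t hts ht => ?_⟩
    rcases Finset.eq_empty_or_nonempty t with rfl | hne
    · simp
    · obtain ⟨x, rfl⟩ := Finset.card_eq_one.1 (le_antisymm ht hne.card_pos)
      simpa using hts
  | succ n ih =>
    obtain ⟨K, hK, hsK, hKs, h⟩ := ih
    refine ⟨convexJoin ℝ s K, isCompact_convexJoin hs hK, ?_,
      convexJoin_subset (subset_convexHull ℝ s) hKs (convex_convexHull ℝ s), fun t hts ht => ?_⟩
    · intro x hx
      exact subset_convexJoin_left ⟨x, hsK hx⟩ hx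
    · rcases Finset.eq_empty_or_nonempty t with rfl | ⟨x, hx⟩
      · simp
      · have hxs : x ∈ s := hts hx
        have ht' : ((t.erase x : Finset E) : Set E) ⊆ s :=
          (Finset.coe_subset.2 (Finset.erase_subset x t)).trans hts
        have hc : (t.erase x).card ≤ n + 1 := by
          rw [Finset.card_erase_of_mem hx]; omega
        have hsub := h _ ht' hc
        rw [← Finset.insert_erase hx, Finset.coe_insert]
        rcases Finset.eq_empty_or_nonempty (t.erase x) with he | hne
        · rw [he]
          simpa using subset_convexJoin_left ⟨x, hsK hxs⟩ hxs
        · rw [convexHull_insert (Finset.coe_nonempty.2 hne)]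
          exact convexJoin_mono (singleton_subset_iff.2 hxs) hsub

lemma _root_.IsCompact.isCompact_convexHull {E : Type*} [NormedAddCommGroup E] [NormedSpace ℝ E]
    [FiniteDimensional ℝ E] {s : Set E} (hs : IsCompact s) : IsCompact (convexHull ℝ s) := by
  obtain ⟨K, hK, -, hKs, h⟩ := exists_isCompact_convexHull_finset_subset hs (Module.finrank ℝ E)
  refine (Subset.antisymm ?_ hKs : convexHull ℝ s = K) ▸ hK
  rw [convexHull_eq_union]
  refine iUnion_subset fun t => iUnion_subset fun hts => iUnion_subset fun ht => h t hts ?_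
  have h1 := ht.card_le_finrank_succ
  rw [Fintype.card_coe] at h1
  exact h1.trans (Nat.succ_le_succ (Submodule.finrank_le _))

namespace SpacelikeSurface

variable {S : SpacelikeSurface}

/-! ### The convex hull of the ideal cone -/

lemma linear_nonpos_of_mem_convexHull {s : Set (Fin 4 → ℝ)} (L : (Fin 4 → ℝ) →ₗ[ℝ] ℝ)
    (h : ∀ ζ ∈ s, L ζ ≤ 0) {x : Fin 4 → ℝ} (hx : x ∈ convexHull ℝ s) : L x ≤ 0 :=
  convexHull_min (t := {x | L x ≤ 0}) h (convex_halfSpace_le L.isLinear 0) hx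

lemma linear_pos_of_mem_convexHull {s : Set (Fin 4 → ℝ)} (L : (Fin 4 → ℝ) →ₗ[ℝ] ℝ)
    (h : ∀ ζ ∈ s, 0 < L ζ) {x : Fin 4 → ℝ} (hx : x ∈ convexHull ℝ s) : 0 < L x :=
  convexHull_min (t := {x | 0 < L x}) h (convex_halfSpace_gt L.isLinear 0) hx

lemma qform_emb_neg_of_mem_hull {x : Fin 4 → ℝ} (hx : x ∈ convexHull ℝ S.idealCone)
    (y : Fin 2 → ℝ) : qform (S.emb y) x < 0 := by
  have := linear_pos_of_mem_convexHull (-(qformCLM (S.emb y)).toLinearMap)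
    (fun ζ hζ => neg_pos.2 (hζ.2 y)) hx
  exact neg_pos.1 this

open scoped Pointwise in
lemma IsEntireMaximal.smul_mem_hull (H : S.IsEntireMaximal) {x : Fin 4 → ℝ}
    (hx : x ∈ convexHull ℝ S.idealCone) {c : ℝ} (hc : 0 < c) :
    c • x ∈ convexHull ℝ S.idealCone := by
  have h : c • x ∈ convexHull ℝ (c • S.idealCone) := by
    rw [convexHull_smul]; exact smul_mem_smul_set hx
  refine convexHull_mono ?_ h
  rintro _ ⟨ζ, hζ, rfl⟩
  exact H.smul_mem hζ hc

lemma IsEntireMaximal.hull_qform_nonpos (H : S.IsEntireMaximal) {A B : Fin 4 → ℝ}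
    (hA : A ∈ convexHull ℝ S.idealCone) (hB : B ∈ convexHull ℝ S.idealCone) :
    qform A B ≤ 0 := by
  refine linear_nonpos_of_mem_convexHull (qformCLM A).toLinearMap (fun ζ hζ => ?_) hB
  rw [ContinuousLinearMap.coe_coe, qformCLM_apply, qform_comm]
  exact linear_nonpos_of_mem_convexHull (qformCLM ζ).toLinearMap
    (fun ξ hξ => H.qform_nonpos hζ hξ) hA

lemma IsEntireMaximal.qform_neg_or_smul (H : S.IsEntireMaximal) {ζ A : Fin 4 → ℝ}
    (hζ : ζ ∈ S.idealCone) (hA : A ∈ convexHull ℝ S.idealCone) :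
    qform ζ A < 0 ∨ ∃ c : ℝ, A = c • ζ := by
  have hle : ∀ x ∈ convexHull ℝ S.idealCone, qform ζ x ≤ 0 := fun x hx =>
    H.hull_qform_nonpos (subset_convexHull ℝ _ hζ) hx
  have hconv : Convex ℝ {x | x ∈ convexHull ℝ S.idealCone ∧
      (qform ζ x < 0 ∨ ∃ c : ℝ, x = c • ζ)} := by
    rintro x ⟨hx, hx'⟩ y ⟨hy, hy'⟩ a b ha hb hab
    refine ⟨convex_convexHull ℝ _ hx hy ha hb hab, ?_⟩
    have h1 := mul_nonpos_of_nonneg_of_nonpos ha (hle x hx)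
    have h2 := mul_nonpos_of_nonneg_of_nonpos hb (hle y hy)
    rw [qform_add_right, qform_smul_right, qform_smul_right]
    rcases ha.eq_or_lt with rfl | ha
    · obtain rfl : b = 1 := by linarith
      simpa using hy'
    rcases hb.eq_or_lt with rfl | hb
    · obtain rfl : a = 1 := by linarith
      simpa using hx'
    rcases hx' with hx' | ⟨c, rfl⟩
    · exact Or.inl (by linarith [mul_neg_of_pos_of_neg ha hx'])
    rcases hy' with hy' | ⟨d, rfl⟩
    · exact Or.inl (by linarith [mul_neg_of_pos_of_neg hb hy'])
    · exact Or.inr ⟨a * c + b * d, by rw [add_smul, mul_smul, mul_smul]⟩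
  refine (convexHull_min (s := S.idealCone) (t := {x | x ∈ convexHull ℝ S.idealCone ∧
    (qform ζ x < 0 ∨ ∃ c : ℝ, x = c • ζ)}) (fun ξ hξ => ⟨subset_convexHull ℝ _ hξ, ?_⟩)
    hconv hA).2
  rcases (H.qform_nonpos hζ hξ).eq_or_lt with h | h
  · obtain ⟨c, -, hc⟩ := H.cone.proportional ζ hζ.1 ξ hξ.1 h
    exact Or.inr ⟨c, hc⟩
  · exact Or.inl h

lemma IsEntireMaximal.qform_neg_of_timelike (H : S.IsEntireMaximal) {ζ A : Fin 4 → ℝ}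
    (hζ : ζ ∈ S.idealCone) (hA : A ∈ convexHull ℝ S.idealCone) (hAA : qform A A < 0) :
    qform ζ A < 0 := by
  rcases H.qform_neg_or_smul hζ hA with h | ⟨c, rfl⟩
  · exact h
  · rw [qform_smul_left, qform_smul_right, H.cone.null ζ hζ.1, mul_zero, mul_zero] at hAA
    exact absurd hAA (lt_irrefl _)

lemma IsEntireMaximal.mem_projConvexHull (H : S.IsEntireMaximal) {x : Fin 4 → ℝ} (hx : x ≠ 0)
    (h : x ∈ convexHull ℝ S.idealCone) : projPt x hx ∈ projConvexHull S.bdryAtInfinity := by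
  refine ⟨-(qformCLM (S.emb 0)).toLinearMap, fun ζ hζ => ?_, x, hx, rfl, ?_⟩
  · exact neg_ne_zero.2 (H.entire.qform_ne_zero H.cone (S.emb_mem_cover 0) hζ)
  · refine convexHull_mono ?_ h
    exact fun ζ hζ => ⟨hζ.1, neg_pos.2 (hζ.2 0)⟩

lemma IsEntireMaximal.mem_hull_or_neg_mem (H : S.IsEntireMaximal) {x : Fin 4 → ℝ} {hx : x ≠ 0}
    (h : projPt x hx ∈ projConvexHull S.bdryAtInfinity) :
    x ∈ convexHull ℝ S.idealCone ∨ -x ∈ convexHull ℝ S.idealCone := by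
  obtain ⟨L, hL, y, hy, hyx, hmem⟩ := h
  have key : y ∈ convexHull ℝ S.idealCone ∨ -y ∈ convexHull ℝ S.idealCone := by
    rcases H.cone.sign L (qformCLM (S.emb 0)).toLinearMap hL
      (fun ζ hζ => H.entire.qform_ne_zero H.cone (S.emb_mem_cover 0) hζ) with hs | hs
    · refine Or.inr (convexHull_min (t := {z | -z ∈ convexHull ℝ S.idealCone}) ?_
        ((convex_convexHull ℝ S.idealCone).linear_preimage (-LinearMap.id)) hmem)
      rintro ζ ⟨hζ, hLζ⟩
      refine subset_convexHull ℝ _ ((H.mem_or_neg_mem hζ).resolve_left fun h => ?_)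
      exact (mul_neg_of_pos_of_neg hLζ (h.2 0)).not_gt (hs ζ hζ)
    · refine Or.inl (convexHull_mono ?_ hmem)
      rintro ζ ⟨hζ, hLζ⟩
      refine (H.mem_or_neg_mem hζ).resolve_right fun h => ?_
      have h1 := h.2 0
      rw [qform_neg_right, neg_lt_zero] at h1
      exact (mul_pos hLζ h1).not_gt (hs ζ hζ)
  obtain ⟨c, rfl⟩ := (Projectivization.mk_eq_mk_iff' ℝ x y hx hy).1 hyx.symm
  rcases lt_trichotomy c 0 with hc | rfl | hc
  · rcases key with h | h
    · right; rw [← neg_smul]; exact H.smul_mem_hull h (neg_pos.2 hc)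
    · left; rw [← neg_smul_neg]; exact H.smul_mem_hull h (neg_pos.2 hc)
  · simp at hx
  · rcases key with h | h
    · exact Or.inl (H.smul_mem_hull h hc)
    · right; rw [← smul_neg]; exact H.smul_mem_hull h hc

/-- A vector outside the convex hull of the ideal cone is strictly separated from it. -/
lemma IsEntireMaximal.exists_separating (H : S.IsEntireMaximal) {y₀ : Fin 2 → ℝ}
    {D : Fin 4 → ℝ} (hD0 : qform (S.emb y₀) D < 0) (hD : D ∉ convexHull ℝ S.idealCone) :
    ∃ p : Fin 4 → ℝ, (∀ ζ ∈ S.idealCone, 0 < qform ζ p) ∧ qform D p < 0 := by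
  set x := S.emb y₀ with hx
  set s : Set (Fin 4 → ℝ) := {ζ | ζ ∈ S.idealCone ∧ qform x ζ = -1} with hs
  have hcpt : IsCompact s := by
    obtain ⟨c, hc, hcle⟩ := H.exists_pos_le (S.cone_neg_emb y₀)
    refine Metric.isCompact_of_isClosed_isBounded ?_ ?_
    · refine isSeqClosed_iff_isClosed.1 fun u ζ hu hlim => ?_
      have h1 : qform x ζ = -1 := tendsto_nhds_unique
        (((continuous_const.qform continuous_id).tendsto ζ).comp hlim)
        (tendsto_const_nhds.congr fun n => (hu n).2.symm)
      refine ⟨H.mem_of_tendsto (fun n => (hu n).1) hlim ?_, h1⟩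
      rintro rfl
      rw [qform_zero_right] at h1
      norm_num at h1
    · refine (Metric.isBounded_closedBall (x := 0) (r := c⁻¹)).subset fun ζ hζ => ?_
      have h1 := hcle ζ hζ.1
      rw [qform_neg_right, qform_comm, ← hx, hζ.2, neg_neg] at h1
      rw [mem_closedBall_zero_iff, ← one_div, le_div_iff₀ hc, mul_comm]
      exact h1
  set d := -qform x D with hd
  have hd0 : 0 < d := neg_pos.2 hD0
  have hnot : d⁻¹ • D ∉ convexHull ℝ s := fun hmem => hD (by
    have := H.smul_mem_hull (convexHull_mono (fun ζ hζ => hζ.1) hmem) hd0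
    rwa [smul_inv_smul₀ hd0.ne'] at this)
  obtain ⟨g, u, hg, hgu⟩ := geometric_hahn_banach_point_closed (convex_convexHull ℝ s)
    hcpt.isCompact_convexHull.isClosed hnot
  obtain ⟨q, hq⟩ : ∃ q : Fin 4 → ℝ, ∀ v, g v = qform v q := by
    refine ⟨![g (Pi.single 0 1), g (Pi.single 1 1), -g (Pi.single 2 1), -g (Pi.single 3 1)],
      fun v => ?_⟩
    conv_lhs => rw [← Finset.univ_sum_single v]
    have : ∀ i, g (Pi.single i (v i)) = v i * g (Pi.single i 1) := fun i => by
      rw [← smul_eq_mul, ← map_smul, ← Pi.single_smul, smul_eq_mul, mul_one]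
    rw [map_sum, Fin.sum_univ_four]
    simp [this, qform]
  refine ⟨q + u • x, fun ζ hζ => ?_, ?_⟩
  · have h1 : 0 < -qform x ζ := neg_pos.2 (hζ.2 y₀)
    have h2 := hgu ((-qform x ζ)⁻¹ • ζ) (subset_convexHull ℝ _
      ⟨H.smul_mem hζ (inv_pos.2 h1), by
        rw [qform_smul_right, inv_neg, neg_mul, inv_mul_cancel₀ (neg_pos.1 h1).ne]⟩)
    rw [hq, qform_smul_left, inv_mul_eq_div, lt_div_iff₀ h1] at h2
    rw [qform_add_right, qform_smul_right, qform_comm ζ x]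
    linarith
  · rw [hq, qform_smul_left, inv_mul_eq_div, div_lt_iff₀ hd0] at hg
    rw [qform_add_right, qform_smul_right, qform_comm D x]
    linarith

end SpacelikeSurface

namespace SpacelikeSurface

variable {S : SpacelikeSurface}

/-! ### The width of the convex hull -/

/-- The lengths of the timelike geodesic segments contained in the convex hull of `Γ`. -/
def timelikeLengths (Γ : Set RP3) : Set ℝ :=
  {T : ℝ | 0 ≤ T ∧ T < π ∧ ∃ a b : Fin 4 → ℝ,
      qform a a = -1 ∧ qform b b = -1 ∧ qform a b = 0 ∧
      ∀ t ∈ Icc (0 : ℝ) T, ∃ h : (Real.cos t • a + Real.sin t • b) ≠ 0,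
        projPt (Real.cos t • a + Real.sin t • b) h ∈ projConvexHull Γ}

/-- The endpoints of a timelike segment in the convex hull have coherent lifts. -/
lemma IsEntireMaximal.exists_endpoints (H : S.IsEntireMaximal) {T : ℝ}
    (hT : T ∈ timelikeLengths S.bdryAtInfinity) :
    ∃ A ∈ convexHull ℝ S.idealCone, ∃ B ∈ convexHull ℝ S.idealCone,
      qform A A = -1 ∧ qform B B = -1 ∧ qform A B = -Real.cos T := by
  obtain ⟨h0, -, a, b, haa, hbb, hab, h⟩ := hT
  set D : ℝ → Fin 4 → ℝ := fun t => Real.cos t • a + Real.sin t • b with hD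
  have hmem : ∀ t ∈ Icc (0 : ℝ) T, D t ∈ convexHull ℝ S.idealCone ∨
      -D t ∈ convexHull ℝ S.idealCone := fun t ht => by
    obtain ⟨_, h1⟩ := h t ht
    exact H.mem_hull_or_neg_mem h1
  have hne : ∀ t ∈ Icc (0 : ℝ) T, qform (S.emb 0) (D t) ≠ 0 := fun t ht => by
    rcases hmem t ht with h1 | h1
    · exact (qform_emb_neg_of_mem_hull h1 0).ne
    · have := qform_emb_neg_of_mem_hull h1 0
      rw [qform_neg_right, neg_lt_zero] at this
      exact this.ne'
  have hDc : Continuous D := by fun_prop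
  have hcont : Continuous fun t => qform (S.emb 0) (D t) := continuous_const.qform hDc
  have hbba : qform b a = 0 := by rw [qform_comm, hab]
  have hD0 : D 0 = a := by simp [hD]
  have hTT : qform (D T) (D T) = -1 := by
    simp only [hD, qform_add_left, qform_add_right, qform_smul_left, qform_smul_right, haa, hbb,
      hab, hbba]
    linear_combination -Real.sin_sq_add_cos_sq T
  have h0T : qform a (D T) = -Real.cos T := by
    simp only [hD, qform_add_right, qform_smul_right, haa, hab]; ring
  have hsame : 0 < qform (S.emb 0) a * qform (S.emb 0) (D T) := by
    by_contra! hle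
    have h1 : (0 : ℝ) ∈ uIcc (qform (S.emb 0) (D 0)) (qform (S.emb 0) (D T)) := by
      rw [hD0, mem_uIcc]
      rcases mul_nonpos_iff.1 hle with h2 | h2
      · exact Or.inr ⟨h2.2, h2.1⟩
      · exact Or.inl ⟨h2.1, h2.2⟩
    obtain ⟨t, ht, ht0⟩ := intermediate_value_uIcc hcont.continuousOn h1
    rw [uIcc_of_le h0] at ht
    exact hne t ht ht0
  have hA := hmem 0 (left_mem_Icc.2 h0)
  rw [hD0] at hA
  rcases hA with hA | hA <;> rcases hmem T (right_mem_Icc.2 h0) with hB | hB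
  · exact ⟨a, hA, D T, hB, haa, hTT, h0T⟩
  · have h1 := qform_emb_neg_of_mem_hull hA 0
    have h2 := qform_emb_neg_of_mem_hull hB 0
    rw [qform_neg_right, neg_lt_zero] at h2
    exact absurd hsame (mul_neg_of_neg_of_pos h1 h2).not_gt
  · have h1 := qform_emb_neg_of_mem_hull hA 0
    have h2 := qform_emb_neg_of_mem_hull hB 0
    rw [qform_neg_right, neg_lt_zero] at h1
    exact absurd hsame (mul_neg_of_pos_of_neg h1 h2).not_gt
  · exact ⟨-a, hA, -D T, hB, by rw [qform_neg_left, qform_neg_right, neg_neg, haa],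
      by rw [qform_neg_left, qform_neg_right, neg_neg, hTT],
      by rw [qform_neg_left, qform_neg_right, neg_neg, h0T]⟩

lemma IsEntireMaximal.length_le_pi_div_two (H : S.IsEntireMaximal) {T : ℝ}
    (hT : T ∈ timelikeLengths S.bdryAtInfinity) : T ≤ π / 2 := by
  by_contra! h
  obtain ⟨A, hA, B, hB, -, -, hAB⟩ := H.exists_endpoints hT
  have h1 := H.hull_qform_nonpos hA hB
  have h2 := Real.cos_neg_of_pi_div_two_lt_of_lt h (by linarith [hT.2.1, Real.pi_pos])
  linarith

lemma IsEntireMaximal.width_mem_Icc (H : S.IsEntireMaximal) :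
    width S.bdryAtInfinity ∈ Icc 0 (π / 2) :=
  ⟨Real.sSup_nonneg fun _ hT => hT.1,
    Real.sSup_le (fun _ hT => H.length_le_pi_div_two hT) (by positivity)⟩

lemma IsEntireMaximal.abs_normal_le_of_mem_hull (H : S.IsEntireMaximal) (F : MovingFrame S) {Λ : ℝ}
    (hΛ0 : 0 ≤ Λ) (hΛ1 : Λ < 1) (hQ : ∀ y, F.Q.1 y ≤ Λ ^ 2) {A : Fin 4 → ℝ}
    (hA : A ∈ convexHull ℝ S.idealCone) (y : Fin 2 → ℝ) :
    |qform (S.normal y) A| ≤ Λ * -qform (S.emb y) A := by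
  have key : ∀ ζ ∈ S.idealCone, |qform (S.normal y) ζ| ≤ Λ * -qform (S.emb y) ζ := fun ζ hζ =>
    F.abs_g_le_of_mem_idealCone H hΛ0 hΛ1 hQ hζ y
  have h1 := linear_nonpos_of_mem_convexHull (qformCLM (S.normal y + Λ • S.emb y)).toLinearMap
    (fun ζ hζ => by
      rw [ContinuousLinearMap.coe_coe, qformCLM_apply, qform_add_left, qform_smul_left]
      linarith [(abs_le.1 (key ζ hζ)).2]) hA
  have h2 := linear_nonpos_of_mem_convexHull (qformCLM (-S.normal y + Λ • S.emb y)).toLinearMap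
    (fun ζ hζ => by
      rw [ContinuousLinearMap.coe_coe, qformCLM_apply, qform_add_left, qform_smul_left,
        qform_neg_left]
      linarith [(abs_le.1 (key ζ hζ)).1]) hA
  rw [ContinuousLinearMap.coe_coe, qformCLM_apply, qform_add_left, qform_smul_left] at h1 h2
  rw [qform_neg_left] at h2
  exact abs_le.2 ⟨by linarith, by linarith⟩

lemma hull_product_bound {Λ f g f' g' : ℝ} (hΛ0 : 0 ≤ Λ) (hΛ1 : Λ < 1) (hf : 0 ≤ f)
    (hf' : 0 ≤ f') (hg : |g| ≤ Λ * f) (hg' : |g'| ≤ Λ * f') (h : 1 ≤ f ^ 2 + g ^ 2)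
    (h' : 1 ≤ f' ^ 2 + g' ^ 2) : (1 - Λ ^ 2) / (1 + Λ ^ 2) ≤ f * f' + g * g' := by
  have hpos : 0 < 1 + Λ ^ 2 := by positivity
  have sq : ∀ {x z : ℝ}, |z| ≤ Λ * x → 1 ≤ x ^ 2 + z ^ 2 → 1 / (1 + Λ ^ 2) ≤ x ^ 2 := by
    intro x z hz h1
    have h2 : z ^ 2 ≤ Λ ^ 2 * x ^ 2 := by
      rw [← mul_pow, ← sq_abs]; exact pow_le_pow_left₀ (abs_nonneg _) hz 2
    rw [div_le_iff₀ hpos]; linarith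
  have h1 : 1 / (1 + Λ ^ 2) ≤ f * f' := by
    refine le_of_sq_le_sq ?_ (by positivity)
    rw [mul_pow, pow_two (1 / (1 + Λ ^ 2))]
    exact mul_le_mul (sq hg h) (sq hg' h') (by positivity) (by positivity)
  have h2 : -(Λ ^ 2 * (f * f')) ≤ g * g' := by
    have h3 := mul_le_mul hg hg' (abs_nonneg _) (by positivity)
    rw [← abs_mul] at h3
    linarith [neg_abs_le (g * g')]
  have h3 : 0 ≤ 1 - Λ ^ 2 := by nlinarith
  calc (1 - Λ ^ 2) / (1 + Λ ^ 2) = (1 - Λ ^ 2) * (1 / (1 + Λ ^ 2)) := by ring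
    _ ≤ (1 - Λ ^ 2) * (f * f') := mul_le_mul_of_nonneg_left h1 h3
    _ ≤ f * f' + g * g' := by linarith

lemma IsEntireMaximal.hull_qform_le (H : S.IsEntireMaximal) (F : MovingFrame S) {Λ : ℝ}
    (hΛ0 : 0 ≤ Λ) (hΛ1 : Λ < 1) (hQ : ∀ y, F.Q.1 y ≤ Λ ^ 2) {A B : Fin 4 → ℝ}
    (hA : A ∈ convexHull ℝ S.idealCone) (hB : B ∈ convexHull ℝ S.idealCone)
    (hAA : qform A A = -1) (hBB : qform B B = -1) :
    (1 - Λ ^ 2) / (1 + Λ ^ 2) ≤ -qform A B := by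
  obtain ⟨y, hy⟩ := H.exists_min (p := -A) fun ζ hζ => by
    rw [qform_neg_right]
    exact neg_pos.2 (H.qform_neg_of_timelike hζ hA (by rw [hAA]; norm_num))
  have hmax : IsLocalMax (S.f A).1 y := Eventually.of_forall fun z => by
    have := hy z
    rw [qform_neg_right, qform_neg_right] at this
    exact neg_le_neg_iff.1 this
  obtain ⟨h1, h2, -⟩ := F.of_isLocalMax hmax
  rw [F.D₁_f] at h1
  rw [F.D₂_f] at h2
  replace h1 : qform (F.e₁ y) A = 0 := h1
  replace h2 : qform (F.e₂ y) A = 0 := h2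
  have eAB := (F.orthoFrame y).qform_expand A B
  have eAA := (F.orthoFrame y).qform_expand A A
  have eBB := (F.orthoFrame y).qform_expand B B
  rw [qform_comm A (F.e₁ y), qform_comm A (F.e₂ y), h1, h2, qform_comm A (S.emb y),
    qform_comm A (S.normal y)] at eAB eAA
  rw [qform_comm B (F.e₁ y), qform_comm B (F.e₂ y), qform_comm B (S.emb y),
    qform_comm B (S.normal y)] at eBB
  have := hull_product_bound hΛ0 hΛ1 (neg_pos.2 (qform_emb_neg_of_mem_hull hA y)).le
    (neg_pos.2 (qform_emb_neg_of_mem_hull hB y)).le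
    (H.abs_normal_le_of_mem_hull F hΛ0 hΛ1 hQ hA y) (H.abs_normal_le_of_mem_hull F hΛ0 hΛ1 hQ hB y)
    (by linarith) (by linarith [sq_nonneg (qform (F.e₁ y) B), sq_nonneg (qform (F.e₂ y) B)])
  linarith

lemma IsEntireMaximal.width_lt_pi_div_two (H : S.IsEntireMaximal) (F : MovingFrame S) {Λ : ℝ}
    (hΛ0 : 0 ≤ Λ) (hΛ1 : Λ < 1) (hQ : ∀ y, F.Q.1 y ≤ Λ ^ 2) :
    width S.bdryAtInfinity < π / 2 := by
  set κ := (1 - Λ ^ 2) / (1 + Λ ^ 2) with hκ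
  have hκ0 : 0 < κ := div_pos (by nlinarith) (by positivity)
  refine lt_of_le_of_lt ?_ (Real.arccos_lt_pi_div_two.2 hκ0)
  refine Real.sSup_le (fun T hT => ?_) (Real.arccos_nonneg _)
  obtain ⟨A, hA, B, hB, hAA, hBB, hAB⟩ := H.exists_endpoints hT
  have h1 := H.hull_qform_le F hΛ0 hΛ1 hQ hA hB hAA hBB
  rw [hAB, neg_neg] at h1
  rw [← Real.arccos_cos hT.1 hT.2.1.le]
  exact Real.arccos_le_arccos h1

lemma IsEntireMaximal.lambdaAt_mul_abs_normal_le (H : S.IsEntireMaximal) (F : MovingFrame S)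
    {Λ : ℝ} (hΛ0 : 0 ≤ Λ) (hΛ1 : Λ < 1) (hQ : ∀ y, F.Q.1 y ≤ Λ ^ 2) {p : Fin 4 → ℝ}
    (hp : ∀ ζ ∈ S.idealCone, 0 < qform ζ p) (y : Fin 2 → ℝ) :
    S.lambdaAt y * |qform (S.normal y) p| ≤ 20 * qform (S.emb y) p := by
  have h0 := H.qform_pos_of_cone hp y
  have hG : F.Q.1 y * qform (S.normal y) p ^ 2 ≤ 400 * qform (S.emb y) p ^ 2 :=
    F.G_le H hΛ0 hΛ1 hQ hp y
  refine le_of_sq_le_sq ?_ (by positivity)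
  rw [mul_pow, sq_abs, mul_pow, F.lambdaAt_eq H.maximal,
    Real.sq_sqrt (by positivity)]
  refine le_trans hG (le_of_eq ?_)
  norm_num

lemma IsEntireMaximal.arctan_lambdaAt_le_width (H : S.IsEntireMaximal) (F : MovingFrame S)
    {Λ : ℝ} (hΛ0 : 0 ≤ Λ) (hΛ1 : Λ < 1) (hQ : ∀ y, F.Q.1 y ≤ Λ ^ 2) (y : Fin 2 → ℝ) :
    Real.arctan (S.lambdaAt y / 20) ≤ width S.bdryAtInfinity := by
  have hl : 0 ≤ S.lambdaAt y := Real.sqrt_nonneg _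
  set T := Real.arctan (S.lambdaAt y / 20) with hT
  have hT2 : T < π / 2 := Real.arctan_lt_pi_div_two _
  refine le_csSup ⟨π / 2, fun _ h => H.length_le_pi_div_two h⟩ ⟨Real.arctan_nonneg.2 (by positivity),
    by linarith [Real.pi_pos], S.emb y, S.normal y, S.on_quadric y, S.normal_unit y,
    by rw [qform_comm]; exact S.normal_orth_base y, fun t ht => ?_⟩
  set D := Real.cos t • S.emb y + Real.sin t • S.normal y with hD
  have hcos : 0 < Real.cos t :=
    Real.cos_pos_of_mem_Ioo ⟨by linarith [ht.1, Real.pi_pos], ht.2.trans_lt hT2⟩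
  have hsin : 0 ≤ Real.sin t :=
    Real.sin_nonneg_of_nonneg_of_le_pi ht.1 (by linarith [ht.2, Real.pi_pos])
  have hXD : qform (S.emb y) D = -Real.cos t := by
    rw [hD, qform_add_right, qform_smul_right, qform_smul_right, S.on_quadric,
      qform_comm (S.emb y) (S.normal y), S.normal_orth_base]
    ring
  have hD0 : D ≠ 0 := by
    intro h
    rw [h, qform_zero_right] at hXD
    linarith
  refine ⟨hD0, H.mem_projConvexHull hD0 ?_⟩
  by_contra hnot
  obtain ⟨p, hp, hDp⟩ := H.exists_separating (y₀ := y) (by rw [hXD]; linarith) hnot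
  have h1 := H.lambdaAt_mul_abs_normal_le F hΛ0 hΛ1 hQ hp y
  have h2 := H.qform_pos_of_cone hp y
  rw [hD, qform_add_left, qform_smul_left, qform_smul_left] at hDp
  have h3 : Real.tan t ≤ S.lambdaAt y / 20 := by
    rw [← Real.tan_arctan (S.lambdaAt y / 20)]
    rcases ht.2.eq_or_lt with h | h
    · rw [h]
    · exact (Real.tan_lt_tan_of_nonneg_of_lt_pi_div_two ht.1 hT2 h).le
  rw [Real.tan_eq_sin_div_cos, div_le_iff₀ hcos] at h3
  have h4 := mul_le_mul_of_nonneg_right h3 (abs_nonneg (qform (S.normal y) p))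
  have h5 := mul_le_mul_of_nonneg_left (neg_abs_le (qform (S.normal y) p)) hsin
  have h6 := mul_le_mul_of_nonneg_left h1 hcos.le
  linarith

lemma IsEntireMaximal.lambdaSup_le (H : S.IsEntireMaximal) (h1 : S.lambdaSup < 1) :
    S.lambdaSup ≤ 20 * Real.tan (width S.bdryAtInfinity) := by
  obtain ⟨hw0, hw1⟩ := H.width_mem_Icc
  have htan := Real.tan_nonneg_of_nonneg_of_le_pi_div_two hw0 hw1
  rcases le_or_gt S.lambdaSup 0 with h0 | h0
  · exact h0.trans (by positivity)
  have hbdd : BddAbove (range S.lambdaAt) := by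
    by_contra h
    exact h0.ne' (Real.iSup_of_not_bddAbove h)
  obtain ⟨F⟩ := S.nonempty_movingFrame
  have hQ : ∀ y, F.Q.1 y ≤ S.lambdaSup ^ 2 := fun y => by
    have h2 : S.lambdaAt y ≤ S.lambdaSup := le_ciSup hbdd y
    rw [F.lambdaAt_eq H.maximal] at h2
    exact (Real.sqrt_le_left h0.le).1 h2
  refine ciSup_le fun y => ?_
  have hlt := H.width_lt_pi_div_two F h0.le h1 hQ
  have hle := H.arctan_lambdaAt_le_width F h0.le h1 hQ y
  have h2 : S.lambdaAt y / 20 ≤ Real.tan (width S.bdryAtInfinity) := by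
    rw [← Real.tan_arctan (S.lambdaAt y / 20)]
    rcases hle.eq_or_lt with h | h
    · rw [h]
    · exact (Real.tan_lt_tan_of_lt_of_lt_pi_div_two (Real.neg_pi_div_two_lt_arctan _) hlt h).le
  linarith

lemma isEntireMaximal_of_grGraph {φ : RP1 ≃ₜ RP1} (hM : S.IsMaximal) (hE : S.IsEntire)
    (hφ : OrientationPreserving ⇑φ) (hS : S.bdryAtInfinity = grGraph ⇑φ) : S.IsEntireMaximal where
  maximal := hM
  entire := hE
  cone := by
    have hcl := hE.mem_lifts_bdry_of_tendsto
    rw [hS] at hcl ⊢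
    exact isBoundaryCone_of_grGraph hφ hcl

end SpacelikeSurface

open SpacelikeSurface in
/-- **Theorem A.** There exists a universal constant `C₁ > 0` such that for every entire
maximal surface `S` in AdS³ with `‖λ‖∞ < 1`, whose asymptotic boundary is the graph of an
orientation-preserving homeomorphism of `ℝP¹` with convex hull of width `w`, one has
`‖λ‖∞ ≤ C₁ · tan w`. -/
theorem principal_curvatures_le_tan_width :
    ∃ C₁ : ℝ, 0 < C₁ ∧
      ∀ (S : SpacelikeSurface) (φ : RP1 ≃ₜ RP1),
        S.IsMaximal → S.IsEntire →
        OrientationPreserving ⇑φ →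
        S.bdryAtInfinity = grGraph ⇑φ →
        S.lambdaSup < 1 →
        S.lambdaSup ≤ C₁ * Real.tan (width S.bdryAtInfinity) := by
  refine ⟨20, by norm_num, fun S φ hM hE hφ hS h1 => ?_⟩
  exact (isEntireMaximal_of_grGraph hM hE hφ hS).lambdaSup_le h1

end AdSPaper
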